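/- Fix an odd prime power q, an integer n₀ ≥ 1, an element g ∈ GL_{n₀}(𝔽_q), and an integer m ≥ 0. For each n ≥ n₀, regard g as an element of GL_n(𝔽_q) via the block-diagonal embedding. Then the proportion of self-dual irreducible complex characters χ of GL_n(𝔽_q) such that 2^m divides χ(g), among all self-dual irreducible complex characters of GL_n(𝔽_q), tends to 1 as n → ∞. -/

import Mathlib

open Filter Topology CategoryTheory Matrix

/-- The block-diagonal embedding `GL_{n₀}(F) → GL_n(F)`, `g ↦ diag(g, I_{n-n₀})`. -/
noncomputable def glEmbed (F : Type) [Field F] {n₀ n : ℕ} (h : n₀ ≤ n)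
    (g : GL (Fin n₀) F) : GL (Fin n) F :=
  Units.map
    ((Matrix.reindexAlgEquiv F F
        (finSumFinEquiv.trans (finCongr (Nat.add_sub_cancel' h)) :
          Fin n₀ ⊕ Fin (n - n₀) ≃ Fin n)).toRingEquiv.toMonoidHom)
    ⟨Matrix.fromBlocks g.val 0 0 1, Matrix.fromBlocks (↑g⁻¹) 0 0 1,
      by
        rw [Matrix.fromBlocks_multiply]
        simp only [Matrix.mul_zero, Matrix.zero_mul, Matrix.mul_one, Matrix.one_mul, mul_zero, zero_mul, mul_one, one_mul, add_zero, zero_add,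
          Units.mul_inv, Units.inv_mul]
        rw [Matrix.fromBlocks_one],
      by
        rw [Matrix.fromBlocks_multiply]
        simp only [Matrix.mul_zero, Matrix.zero_mul, Matrix.mul_one, Matrix.one_mul, mul_zero, zero_mul, mul_one, one_mul, add_zero, zero_add,
          Units.mul_inv, Units.inv_mul]
        rw [Matrix.fromBlocks_one]⟩

section Characters

variable {G : Type} [Group G]

/-- A function which is the character of a simple finite-dimensional complex representation. -/
def IsIrrChar (χ : G → ℂ) : Prop := ∃ V : FDRep ℂ G, Simple V ∧ χ = V.character

/-- Schur's lemma. -/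
theorem FDRep.exists_eq_smul_one_of_commute (V : FDRep ℂ G) [Simple V] (T : V →ₗ[ℂ] V)
    (hT : ∀ g, T ∘ₗ V.ρ g = V.ρ g ∘ₗ T) : ∃ c : ℂ, T = c • LinearMap.id := by
  let f : V ⟶ V := ⟨InducedCategory.homMk (ModuleCat.ofHom T), fun g ↦ by
    ext x
    exact LinearMap.congr_fun (hT g) x⟩
  obtain ⟨c, hc⟩ := (finrank_eq_one_iff_of_nonzero' (𝟙 V) (id_nonzero V)).mp
    (finrank_endomorphism_simple_eq_one ℂ V) f
  refine ⟨c, ?_⟩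
  have := congrArg (fun h : V ⟶ V => h.hom.hom.hom) hc
  exact this.symm

variable [Fintype G]

theorem IsIrrChar.exists_dim {χ : G → ℂ} (h : IsIrrChar χ) : ∃ d : ℕ, χ 1 = d ∧ d ≠ 0 := by
  obtain ⟨V, hV, rfl⟩ := h
  refine ⟨Module.finrank ℂ V, by simp, fun h0 => ?_⟩
  have h2 := (FDRep.simple_iff_char_is_norm_one V).mp hV
  have h1 : Subsingleton V := Module.finrank_zero_iff.mp h0
  have : ∀ g, V.character g = 0 := fun g => by
    have : V.ρ g = 0 := by ext x; exact Subsingleton.elim _ _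
    simp [FDRep.character, this]
  simp [this] at h2
  exact absurd h2.symm (by simp)

omit [Fintype G] in
theorem IsIrrChar.conj {χ : G → ℂ} (h : IsIrrChar χ) (g x : G) : χ (x * g * x⁻¹) = χ g := by
  obtain ⟨V, hV, rfl⟩ := h
  simp

omit [Fintype G] in
theorem IsIrrChar.mul_comm {χ : G → ℂ} (h : IsIrrChar χ) (g x : G) : χ (g * x) = χ (x * g) := by
  obtain ⟨V, hV, rfl⟩ := h
  exact FDRep.char_mul_comm _ _ _

theorem IsIrrChar.inv {χ : G → ℂ} (h : IsIrrChar χ) : IsIrrChar (fun g => χ g⁻¹) := by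
  obtain ⟨V, hV, rfl⟩ := h
  refine ⟨FDRep.of (Representation.dual V.ρ), ?_, ?_⟩
  · rw [FDRep.simple_iff_char_is_norm_one] at hV ⊢
    simp only [FDRep.char_dual, inv_inv]
    rw [← hV]
    exact Finset.sum_congr rfl fun g _ => _root_.mul_comm _ _
  · ext g; simp

theorem IsIrrChar.sum_conj_mul {χ : G → ℂ} (h : IsIrrChar χ) (g k : G) :
    ∑ x : G, χ (x * g * x⁻¹ * k) = Fintype.card G * χ g * χ k / χ 1 := by
  have h1 : χ 1 ≠ 0 := by obtain ⟨d, hd, hd0⟩ := h.exists_dim; rw [hd]; exact_mod_cast hd0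
  obtain ⟨V, hV, rfl⟩ := h
  obtain ⟨c, hc⟩ := V.exists_eq_smul_one_of_commute (∑ x : G, V.ρ (x * g * x⁻¹)) (fun y => by
    rw [← Module.End.mul_eq_comp, ← Module.End.mul_eq_comp, Finset.sum_mul, Finset.mul_sum, ← Equiv.sum_comp (Equiv.mulLeft y)]
    refine Finset.sum_congr rfl fun x _ => ?_
    rw [← map_mul, ← map_mul]
    simp [mul_assoc])
  have key : ∀ k, ∑ x : G, V.character (x * g * x⁻¹ * k) = c * V.character k := fun k => by
    have := congrArg (fun T => LinearMap.trace ℂ V (T * V.ρ k)) hc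
    simp only [Finset.sum_mul, map_sum, ← map_mul] at this
    rw [FDRep.character, ← smul_eq_mul, ← map_smul]
    refine this.trans ?_
    congr 1
  have h2 := key 1
  simp only [mul_one, FDRep.char_conj, Finset.sum_const, Finset.card_univ, nsmul_eq_mul] at h2
  rw [key, h2]
  field_simp

theorem IsIrrChar.sum_mul_inv_self {χ : G → ℂ} (h : IsIrrChar χ) :
    ∑ g : G, χ g * χ g⁻¹ = Fintype.card G := by
  obtain ⟨V, hV, rfl⟩ := h
  rw [(FDRep.simple_iff_char_is_norm_one V).mp hV, Nat.card_eq_fintype_card]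

theorem IsIrrChar.sum_mul_inv_of_ne {χ ψ : G → ℂ} (h : IsIrrChar χ) (h' : IsIrrChar ψ)
    (hne : χ ≠ ψ) : ∑ g : G, χ g * ψ g⁻¹ = 0 := by
  obtain ⟨V, hV, rfl⟩ := h
  obtain ⟨W, hW, rfl⟩ := h'
  have hG : (Nat.card G : ℂ) ≠ 0 := by simp
  have := invertibleOfNonzero hG
  have := FDRep.char_orthonormal V W
  rw [if_neg (fun ⟨i⟩ => hne (FDRep.char_iso i))] at this
  simpa using this

theorem IsIrrChar.sum_mul_mul_inv {χ ψ : G → ℂ} (h : IsIrrChar χ) (h' : IsIrrChar ψ) (r : G) :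
    ∑ g : G, χ (r * g) * ψ g⁻¹ = χ r / χ 1 * ∑ g : G, χ g * ψ g⁻¹ := by
  have hG : (Fintype.card G : ℂ) ≠ 0 := by simp
  have e : ∀ x : G, ∑ g : G, χ (r * g) * ψ g⁻¹ = ∑ g : G, χ (x * g * x⁻¹ * r) * ψ g⁻¹ := fun x => by
    rw [← Equiv.sum_comp (MulAut.conj x).toEquiv]
    refine Finset.sum_congr rfl fun g _ => ?_
    simp only [MulEquiv.toEquiv_eq_coe, MulEquiv.coe_toEquiv, MulAut.conj_apply]
    rw [h.mul_comm, show (x * g * x⁻¹)⁻¹ = x * g⁻¹ * x⁻¹ by group, h'.conj]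
  have := Finset.sum_congr (rfl : (Finset.univ : Finset G) = _) fun x _ => e x
  rw [Finset.sum_const, Finset.card_univ, nsmul_eq_mul, Finset.sum_comm] at this
  simp_rw [← Finset.sum_mul, h.sum_conj_mul] at this
  apply mul_left_cancel₀ hG
  rw [this, Finset.mul_sum, Finset.mul_sum]
  refine Finset.sum_congr rfl fun g _ => by ring

/-- Linear independence of the functions `g ↦ ∑ r ∈ R, χ (r * g)`. -/
theorem IsIrrChar.eq_zero_of_sum_translates_eq_zero (B : Finset (G → ℂ)) (R : Finset G)
    (hB : ∀ χ ∈ B, IsIrrChar χ ∧ ∑ r ∈ R, χ r ≠ 0) (a : (G → ℂ) → ℂ)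
    (h : ∀ g, ∑ r ∈ R, ∑ χ ∈ B, a χ * χ (r * g) = 0) : ∀ χ ∈ B, a χ = 0 := by
  intro ψ hψ
  have h0 : ∑ g : G, (∑ r ∈ R, ∑ χ ∈ B, a χ * χ (r * g)) * ψ g⁻¹ = 0 := by simp [h]
  have h1 : ∑ g : G, (∑ r ∈ R, ∑ χ ∈ B, a χ * χ (r * g)) * ψ g⁻¹ =
      ∑ r ∈ R, ∑ χ ∈ B, a χ * (χ r / χ 1 * ∑ g : G, χ g * ψ g⁻¹) := by
    simp_rw [Finset.sum_mul]
    rw [Finset.sum_comm]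
    refine Finset.sum_congr rfl fun r _ => ?_
    rw [Finset.sum_comm]
    refine Finset.sum_congr rfl fun χ hχ => ?_
    rw [← (hB χ hχ).1.sum_mul_mul_inv (hB ψ hψ).1, Finset.mul_sum]
    exact Finset.sum_congr rfl fun g _ => by ring
  have h2 : ∀ r, ∑ χ ∈ B, a χ * (χ r / χ 1 * ∑ g : G, χ g * ψ g⁻¹) =
      a ψ / ψ 1 * Fintype.card G * ψ r := fun r => by
    rw [Finset.sum_eq_single_of_mem ψ hψ]
    · rw [(hB ψ hψ).1.sum_mul_inv_self]; ring
    · intro χ hχ hne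
      rw [(hB χ hχ).1.sum_mul_inv_of_ne (hB ψ hψ).1 hne]; ring
  rw [h1] at h0
  simp_rw [h2, ← Finset.mul_sum] at h0
  have h3 : ψ 1 ≠ 0 := by
    obtain ⟨d, hd, hd0⟩ := (hB ψ hψ).1.exists_dim; rw [hd]; exact_mod_cast hd0
  have hG : (Fintype.card G : ℂ) ≠ 0 := by simp
  simpa [h3, hG, (hB ψ hψ).2] using h0

end Characters

section Completeness

variable {G : Type} [Group G] [Fintype G]

theorem isIrrChar_of_isIrreducible {V : Type} [AddCommGroup V] [Module ℂ V]
    [FiniteDimensional ℂ V] (ρ : Representation ℂ G V) [ρ.IsIrreducible] :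
    IsIrrChar ρ.character := by
  have hG : (Nat.card G : ℂ) ≠ 0 := by simp
  have := invertibleOfNonzero hG
  refine ⟨FDRep.of ρ, ?_, rfl⟩
  rw [FDRep.simple_iff_char_is_norm_one]
  have h := Representation.char_orthonormal ρ ρ
  rw [if_pos ⟨Representation.Equiv.refl ρ⟩, inv_mul_eq_one₀ hG] at h
  exact h.symm

theorem Representation.exists_character_eq_sum (n : ℕ) : ∀ {V : Type} [AddCommGroup V] [Module ℂ V]
    [FiniteDimensional ℂ V] (ρ : Representation ℂ G V), Module.finrank ℂ V = n →
    ∃ s : Multiset (G → ℂ), (∀ χ ∈ s, IsIrrChar χ) ∧ ρ.character = s.sum := by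
  induction n using Nat.strong_induction_on with
  | _ n ih =>
  intro V _ _ _ ρ hn
  by_cases hirr : ρ.IsIrreducible
  · exact ⟨{ρ.character}, by simpa using isIrrChar_of_isIrreducible ρ, by simp⟩
  by_cases hV : Subsingleton V
  · refine ⟨0, by simp, ?_⟩
    ext g
    have : ρ g = 0 := by ext x; exact Subsingleton.elim _ _
    simp [Representation.character, this]
  have : Nontrivial V := not_subsingleton_iff_nontrivial.mp hV
  have hW : ∃ W : Subrepresentation ρ, W ≠ ⊥ ∧ W ≠ ⊤ := by
    by_contra! hcon
    have : Nontrivial (Subrepresentation ρ) := ⟨⊥, ⊤, fun h => by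
      have := congrArg Subrepresentation.toSubmodule h
      exact bot_ne_top this⟩
    exact hirr ⟨fun W => or_iff_not_imp_left.mpr (hcon W)⟩
  obtain ⟨W, hW0, hW1⟩ := hW
  obtain ⟨W', hc⟩ := exists_isCompl W
  have hc' : IsCompl W.toSubmodule W'.toSubmodule := by
    constructor
    · rw [disjoint_iff, ← Subrepresentation.toSubmodule_inf, hc.inf_eq_bot]; rfl
    · rw [codisjoint_iff, ← Subrepresentation.toSubmodule_sup, hc.sup_eq_top]; rfl
  have hlt : ∀ U : Subrepresentation ρ, U ≠ ⊤ → Module.finrank ℂ U.toSubmodule < n := fun U hU => by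
    rw [← hn]
    apply Submodule.finrank_lt
    intro h
    exact hU (Subrepresentation.toSubmodule_injective h)
  have hW'1 : W' ≠ ⊤ := by
    rintro rfl
    apply hW0
    have := hc.inf_eq_bot
    simpa using this
  obtain ⟨s, hs, hs'⟩ := ih _ (hlt W hW1) W.toRepresentation rfl
  obtain ⟨t, ht, ht'⟩ := ih _ (hlt W' hW'1) W'.toRepresentation rfl
  refine ⟨s + t, fun χ hχ => (Multiset.mem_add.mp hχ).elim (hs χ) (ht χ), ?_⟩
  rw [Multiset.sum_add, ← hs', ← ht']
  ext g
  have hint : DirectSum.IsInternal (fun b : Bool => cond b W.toSubmodule W'.toSubmodule) := by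
    rw [DirectSum.isInternal_submodule_iff_isCompl _ (i := true) (j := false) (by simp)
      (by ext b; cases b <;> simp)]
    exact hc'
  have hm : ∀ b : Bool, Set.MapsTo (ρ g) (cond b W.toSubmodule W'.toSubmodule : Submodule ℂ V)
      (cond b W.toSubmodule W'.toSubmodule : Submodule ℂ V) := by
    rintro (_ | _)
    · exact fun v hv => W'.apply_mem_toSubmodule g hv
    · exact fun v hv => W.apply_mem_toSubmodule g hv
  have := LinearMap.trace_eq_sum_trace_restrict hint hm
  rw [Fintype.sum_bool] at this
  exact this

/-- The irreducible characters of a finite group form a finite set, and the character of the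
regular representation is `∑ χ, χ 1 * χ`. -/
theorem exists_finset_isIrrChar : ∃ I : Finset (G → ℂ), (∀ χ, χ ∈ I ↔ IsIrrChar χ) ∧
    (∑ χ ∈ I, χ 1 * χ 1 = Fintype.card G) ∧ ∀ x, x ≠ 1 → ∑ χ ∈ I, χ 1 * χ x = 0 := by
  classical
  let ρ : Representation ℂ G (G → ℂ) :=
    { toFun := fun x => LinearMap.funLeft ℂ ℂ (fun g => x⁻¹ * g)
      map_one' := by ext; simp
      map_mul' := fun x y => by ext; simp [LinearMap.funLeft, mul_assoc] }
  obtain ⟨s, hs, hs'⟩ := Representation.exists_character_eq_sum _ ρ rfl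
  have hreg : ∀ x, ρ.character x =
      if x = 1 then (Fintype.card G : ℂ) else 0 := by
    intro x
    split_ifs with hx
    · rw [hx, Representation.char_one]; simp
    · rw [Representation.character, LinearMap.trace_eq_matrix_trace ℂ (Pi.basisFun ℂ G),
        Matrix.trace]
      refine Finset.sum_eq_zero fun g _ => ?_
      rw [Matrix.diag_apply, LinearMap.toMatrix_apply]
      simp [ρ, LinearMap.funLeft, hx]
  have hcount : ∀ χ, IsIrrChar χ → (s.count χ : ℂ) = χ 1 := by
    intro χ hχ
    have h1 : ∑ g : G, s.sum g * χ g⁻¹ = Fintype.card G * χ 1 := by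
      rw [← hs', Finset.sum_eq_single 1]
      · simp [hreg]
      · intro b _ hb; simp [hreg, hb]
      · simp
    have h2 : ∑ g : G, s.sum g * χ g⁻¹ = Fintype.card G * (s.count χ : ℂ) := by
      rw [Finset.sum_multiset_count]
      simp only [Finset.sum_apply, Pi.smul_apply, Finset.sum_mul]
      rw [Finset.sum_comm]
      have : ∀ ψ ∈ s.toFinset, ∑ g : G, (s.count ψ • ψ g) * χ g⁻¹ =
          if ψ = χ then Fintype.card G * (s.count χ : ℂ) else 0 := by
        intro ψ hψ
        simp_rw [nsmul_eq_mul, mul_assoc, ← Finset.mul_sum]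
        split_ifs with he
        · rw [he, hχ.sum_mul_inv_self, mul_comm]
        · rw [(hs ψ (Multiset.mem_toFinset.mp hψ)).sum_mul_inv_of_ne hχ he, mul_zero]
      rw [Finset.sum_congr rfl this, Finset.sum_ite_eq']
      split_ifs with hm
      · rfl
      · rw [Multiset.mem_toFinset, ← Multiset.count_ne_zero, not_not] at hm
        rw [hm, Nat.cast_zero, mul_zero]
    have hG : (Fintype.card G : ℂ) ≠ 0 := by simp
    exact mul_left_cancel₀ hG (h2.symm.trans h1)
  refine ⟨s.toFinset, fun χ => ⟨fun h => hs χ (Multiset.mem_toFinset.mp h), fun h => ?_⟩, ?_⟩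
  · rw [Multiset.mem_toFinset, ← Multiset.count_ne_zero]
    obtain ⟨d, hd, hd0⟩ := h.exists_dim
    have := hcount χ h
    rw [hd, Nat.cast_inj] at this
    rwa [this]
  · have hsum : ∀ x, ∑ χ ∈ s.toFinset, χ 1 * χ x = if x = 1 then (Fintype.card G : ℂ) else 0 := by
      intro x
      rw [← hreg, hs', Finset.sum_multiset_count, Finset.sum_apply]
      refine Finset.sum_congr rfl fun χ hχ => ?_
      rw [Pi.smul_apply, nsmul_eq_mul, hcount χ (hs χ (Multiset.mem_toFinset.mp hχ))]
    exact ⟨by rw [hsum, if_pos rfl], fun x hx => by rw [hsum, if_neg hx]⟩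

theorem finite_setOf_isIrrChar : {χ : G → ℂ | IsIrrChar χ}.Finite := by
  obtain ⟨I, hI, -⟩ := exists_finset_isIrrChar (G := G)
  exact I.finite_toSet.subset fun χ hχ => (hI χ).mpr hχ

end Completeness

section SelfDual

variable {G : Type} [Group G] [Fintype G]

/-- There are at least as many self-dual irreducible characters as real conjugacy classes. -/
theorem card_le_card_selfDual {ι : Type} [Fintype ι] (g : ι → G)
    (hinj : ∀ i j, IsConj (g i) (g j) → i = j) (hreal : ∀ i, IsConj (g i) (g i)⁻¹) :
    Fintype.card ι ≤ Nat.card {χ : G → ℂ // IsIrrChar χ ∧ ∀ x, χ x⁻¹ = χ x} := by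
  classical
  obtain ⟨I, hI, hreg1, hreg⟩ := exists_finset_isIrrChar (G := G)
  have hG : (Fintype.card G : ℂ) ≠ 0 := by simp
  have hcol : ∀ h k : G, ∑ χ ∈ I, χ h * χ k =
      ((Finset.univ.filter fun x : G => x * h * x⁻¹ * k = 1).card : ℂ) := by
    intro h k
    have e1 : ∑ x : G, ∑ χ ∈ I, χ 1 * χ (x * h * x⁻¹ * k) =
        Fintype.card G * ∑ χ ∈ I, χ h * χ k := by
      rw [Finset.sum_comm, Finset.mul_sum]
      refine Finset.sum_congr rfl fun χ hχ => ?_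
      rw [← Finset.mul_sum, ((hI χ).mp hχ).sum_conj_mul]
      obtain ⟨d, hd, hd0⟩ := ((hI χ).mp hχ).exists_dim
      have : χ 1 ≠ 0 := by rw [hd]; exact_mod_cast hd0
      field_simp
    have e2 : ∑ x : G, ∑ χ ∈ I, χ 1 * χ (x * h * x⁻¹ * k) =
        ((Finset.univ.filter fun x : G => x * h * x⁻¹ * k = 1).card : ℂ) *
          ∑ χ ∈ I, χ 1 * χ 1 := by
      rw [Finset.card_filter, Nat.cast_sum, Finset.sum_mul]
      refine Finset.sum_congr rfl fun x _ => ?_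
      split_ifs with hx
      · simp [hx]
      · simp [hreg _ hx]
    apply mul_left_cancel₀ hG
    rw [← e1, e2, hreg1, mul_comm]
  have hsd : (Fintype.card G : ℂ) * ((I.filter fun χ => ∀ x, χ x⁻¹ = χ x).card : ℂ) =
      ∑ h : G, ((Finset.univ.filter fun x : G => x * h * x⁻¹ * h = 1).card : ℂ) := by
    simp_rw [← hcol]
    rw [Finset.sum_comm, Finset.card_filter, Nat.cast_sum, Finset.mul_sum]
    refine Finset.sum_congr rfl fun χ hχ => ?_
    have hχ' := (hI χ).mp hχ
    split_ifs with hx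
    · rw [Nat.cast_one, mul_one, ← hχ'.sum_mul_inv_self]
      simp [hx]
    · rw [Nat.cast_zero, mul_zero, ← hχ'.sum_mul_inv_of_ne hχ'.inv
        (fun e => hx fun x => (congrFun e x).symm)]
      simp
  have hcard : Nat.card {χ : G → ℂ // IsIrrChar χ ∧ ∀ x, χ x⁻¹ = χ x} =
      (I.filter fun χ => ∀ x, χ x⁻¹ = χ x).card := by
    exact Nat.subtype_card _ fun χ => by rw [Finset.mem_filter, hI]
  rw [hcard]
  have hnat : Fintype.card G * (I.filter fun χ => ∀ x, χ x⁻¹ = χ x).card =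
      Fintype.card (Σ h : G, {x : G // x * h * x⁻¹ * h = 1}) := by
    rw [Fintype.card_sigma]
    simp_rw [Fintype.card_subtype]
    exact_mod_cast hsd
  refine Nat.le_of_mul_le_mul_left ?_ (Fintype.card_pos (α := G))
  rw [hnat, mul_comm, ← Fintype.card_prod]
  choose r hr using fun i => isConj_iff.mp (hreal i)
  have hsec : ∀ (i : ι) (h : G), ∃ y : G, IsConj (g i) h → y * g i * y⁻¹ = h := fun i h => by
    by_cases hc : IsConj (g i) h
    · obtain ⟨c, hc'⟩ := isConj_iff.mp hc
      exact ⟨c, fun _ => hc'⟩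
    · exact ⟨1, fun h => absurd h hc⟩
  choose y hy using hsec
  have hcj : ∀ i z, IsConj (g i) (z * g i * z⁻¹) := fun i z => isConj_iff.mpr ⟨z, rfl⟩
  refine Fintype.card_le_of_injective (fun p : ι × G =>
    ⟨p.2 * g p.1 * p.2⁻¹, p.2 * r p.1 * (y p.1 (p.2 * g p.1 * p.2⁻¹))⁻¹, ?_⟩) ?_
  · obtain ⟨i, z⟩ := p
    have h1 := hy i _ (hcj i z)
    have h2 := hr i
    dsimp only
    generalize y i (z * g i * z⁻¹) = w at *
    rw [mul_eq_one_iff_eq_inv]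
    conv_lhs => rw [← h1]
    calc z * r i * w⁻¹ * (w * g i * w⁻¹) * (z * r i * w⁻¹)⁻¹ = z * (r i * g i * (r i)⁻¹) * z⁻¹ := by
          group
      _ = _ := by rw [h2]; group
  · rintro ⟨i, z⟩ ⟨j, z'⟩ he
    obtain ⟨h1, h2⟩ := Prod.ext_iff.mp (congrArg (fun s => (s.1, s.2.1)) he)
    dsimp only at h1 h2
    have hij : i = j := hinj i j ((hcj i z).trans (h1 ▸ (hcj j z').symm))
    subst hij
    rw [h1] at h2
    simpa using h2

end SelfDual

section Divisibility

variable {G : Type} [Group G] [Fintype G]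

theorem IsIrrChar.isIntegral {χ : G → ℂ} (h : IsIrrChar χ) (g : G) : IsIntegral ℤ (χ g) := by
  obtain ⟨V, hV, rfl⟩ := h
  rw [FDRep.character, Module.End.trace_eq_sum_roots_charpoly_of_splits
    (IsAlgClosed.splits (LinearMap.charpoly (V.ρ g)))]
  refine IsIntegral.multiset_sum fun μ hμ => ?_
  have hμ' := (Module.End.hasEigenvalue_iff_isRoot_charpoly (V.ρ g) μ).mpr (Polynomial.isRoot_of_mem_roots hμ)
  obtain ⟨v, hv⟩ := hμ'.exists_hasEigenvector
  have h1 : (V.ρ g ^ Fintype.card G) v = μ ^ Fintype.card G • v := hv.pow_apply _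
  rw [← map_pow, pow_card_eq_one, map_one, Module.End.one_apply] at h1
  have h2 : μ ^ Fintype.card G = 1 := by
    have : (μ ^ Fintype.card G - 1) • v = 0 := by rw [sub_smul, ← h1, one_smul, sub_self]
    exact sub_eq_zero.mp ((smul_eq_zero.mp this).resolve_right hv.2)
  exact IsIntegral.of_pow Fintype.card_pos (h2 ▸ isIntegral_one)

theorem IsIrrChar.isIntegral_card_mul_div {χ : G → ℂ} (h : IsIrrChar χ) (g : G) (C : Finset G)
    (hC : ∀ x, x ∈ C ↔ IsConj g x) : IsIntegral ℤ (C.card * χ g / χ 1) := by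
  have h1 : χ 1 ≠ 0 := by obtain ⟨d, hd, hd0⟩ := h.exists_dim; rw [hd]; exact_mod_cast hd0
  obtain ⟨V, hV, rfl⟩ := h
  obtain ⟨c, hc⟩ := V.exists_eq_smul_one_of_commute (∑ x ∈ C, V.ρ x) (fun y => by
    rw [← Module.End.mul_eq_comp, ← Module.End.mul_eq_comp, Finset.sum_mul, Finset.mul_sum]
    refine Finset.sum_bij' (fun x _ => y⁻¹ * x * y) (fun x _ => y * x * y⁻¹) ?_ ?_ ?_ ?_ ?_
    · intro x hx
      rw [hC] at hx ⊢
      exact hx.trans (isConj_iff.mpr ⟨y⁻¹, by simp⟩)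
    · intro x hx
      rw [hC] at hx ⊢
      exact hx.trans (isConj_iff.mpr ⟨y, rfl⟩)
    · intro x _; group
    · intro x _; group
    · intro x _
      rw [← map_mul, ← map_mul]
      group)
  have htr := congrArg (LinearMap.trace ℂ V) hc
  rw [map_sum, map_smul, LinearMap.trace_id, smul_eq_mul] at htr
  have hval : ∀ x ∈ C, LinearMap.trace ℂ V (V.ρ x) = V.character g := fun x hx => by
    obtain ⟨y, rfl⟩ := isConj_iff.mp ((hC x).mp hx)
    exact V.char_conj g y
  rw [Finset.sum_congr rfl hval, Finset.sum_const, nsmul_eq_mul, ← FDRep.char_one] at htr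
  rw [htr, mul_div_cancel_right₀ _ h1]
  have hint : IsIntegral ℤ (algebraMap ℂ (Module.End ℂ V) c) := by
    have : algebraMap ℂ (Module.End ℂ V) c =
        MonoidAlgebra.lift ℤ (Module.End ℂ V) G V.ρ (∑ x ∈ C, MonoidAlgebra.of ℤ G x) := by
      rw [map_sum]
      simp only [MonoidAlgebra.lift_of]
      rw [hc]
      rfl
    rw [this]
    exact (IsIntegral.of_finite ℤ _).map _
  have hnt : Nontrivial V := by
    rw [FDRep.char_one] at h1
    exact Module.nontrivial_of_finrank_pos (R := ℂ) (Nat.pos_of_ne_zero (by exact_mod_cast h1))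
  exact (isIntegral_algHom_iff ((Algebra.ofId ℂ (Module.End ℂ V)).restrictScalars ℤ)
    (FaithfulSMul.algebraMap_injective ℂ _)).mp hint

/-- If `2 ^ b` bounds the even part of the class size of `g`, and `χ 1` is divisible by
`2 ^ (b + m)`, then `2 ^ m` divides `χ g`. -/
theorem IsIrrChar.isIntegral_div_two_pow {χ : G → ℂ} (h : IsIrrChar χ) (g : G) (N b m : ℕ)
    (hN : ∀ C : Finset G, (∀ x, x ∈ C ↔ IsConj g x) → C.card ∣ N) (hb : ¬ 2 ^ (b + 1) ∣ N)
    (hd : ∃ d : ℕ, χ 1 = (2 ^ (b + m) * d : ℕ)) : IsIntegral ℤ (χ g / 2 ^ m) := by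
  classical
  set C : Finset G := Finset.univ.filter (IsConj g) with hCdef
  have hC : ∀ x, x ∈ C ↔ IsConj g x := by simp [hCdef]
  obtain ⟨e, he⟩ := hN C hC
  have hint := h.isIntegral_card_mul_div g C hC
  obtain ⟨d', hd', hd0⟩ := h.exists_dim
  obtain ⟨d, hd⟩ := hd
  have hd0' : (d : ℂ) ≠ 0 := by
    intro h0
    rw [hd] at hd'
    have := Nat.cast_injective hd'
    have h1 : d = 0 := by exact_mod_cast h0
    simp [h1] at this
    exact hd0 this.symm
  have hN0 : N ≠ 0 := fun h0 => hb (h0 ▸ dvd_zero _)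
  obtain ⟨k, o, ho, hko⟩ := Nat.exists_eq_two_pow_mul_odd hN0
  have hk : k ≤ b := by
    by_contra! hcon
    exact hb (hko ▸ (pow_dvd_pow 2 hcon).mul_right o)
  have h1 : IsIntegral ℤ ((o : ℂ) * (χ g / 2 ^ m)) := by
    have h2 : (o : ℂ) * (χ g / 2 ^ m) = ((e * d * 2 ^ (b - k) : ℕ) : ℂ) * (C.card * χ g / χ 1) := by
      have : ((C.card : ℂ) * e) = 2 ^ k * o := by exact_mod_cast he.symm.trans hko
      rw [hd]
      push_cast
      have h2b : (2 : ℂ) ^ (b + m) = 2 ^ k * 2 ^ (b - k) * 2 ^ m := by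
        rw [← pow_add, ← pow_add]; congr 1; omega
      rw [h2b]
      field_simp
      linear_combination (-1 : ℂ) * χ g * this
    rw [h2]
    exact (show IsIntegral ℤ ((e * d * 2 ^ (b - k) : ℕ) : ℂ) from
      isIntegral_algebraMap (R := ℤ) (x := ((e * d * 2 ^ (b - k) : ℕ) : ℤ))).mul hint
  have hχ : IsIntegral ℤ ((2 ^ m : ℕ) * (χ g / 2 ^ m)) := by
    have : ((2 ^ m : ℕ) * (χ g / 2 ^ m) : ℂ) = χ g := by
      push_cast
      field_simp
    rw [this]
    exact h.isIntegral g
  obtain ⟨u, v, huv⟩ : ∃ u v : ℤ, u * o + v * (2 ^ m : ℕ) = 1 := by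
    have : IsCoprime (o : ℤ) ((2 ^ m : ℕ) : ℤ) :=
      Nat.isCoprime_iff_coprime.mpr (Nat.Coprime.pow_right _ ho.coprime_two_right)
    exact this
  have hfin : χ g / 2 ^ m = (u : ℂ) * ((o : ℂ) * (χ g / 2 ^ m)) +
      (v : ℂ) * ((2 ^ m : ℕ) * (χ g / 2 ^ m)) := by
    have : (u : ℂ) * o + v * (2 ^ m : ℕ) = 1 := by exact_mod_cast congrArg (Int.cast : ℤ → ℂ) huv
    linear_combination (-(χ g / 2 ^ m)) * this
  rw [hfin]
  have hz : ∀ z : ℤ, IsIntegral ℤ (z : ℂ) := fun z => isIntegral_algebraMap (x := z)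
  exact ((hz u).mul h1).add ((hz v).mul hχ)

end Divisibility

section Eigenspaces

variable {G : Type} [Group G]

/-- The representation of a subgroup twisted by a multiplicative function. -/
noncomputable def twistRep (V : FDRep ℂ G) (U : Subgroup G) (ψ : G → ℂ) (h1 : ψ 1 = 1)
    (hψ : ∀ x ∈ U, ∀ y ∈ U, ψ (x * y) = ψ x * ψ y) : Representation ℂ U V where
  toFun u := ψ u • V.ρ u
  map_one' := by simp [h1]
  map_mul' x y := by
    rw [Subgroup.coe_mul, hψ _ x.2 _ y.2, map_mul, smul_mul_smul_comm]

variable [Fintype G]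

theorem sum_mul_character_eq (V : FDRep ℂ G) (U : Subgroup G) (ψ : G → ℂ) (h1 : ψ 1 = 1)
    (hψ : ∀ x ∈ U, ∀ y ∈ U, ψ (x * y) = ψ x * ψ y) (S : Finset G) (hS : ∀ x, x ∈ S ↔ x ∈ U) :
    ∑ u ∈ S, ψ u * V.character u =
      S.card * Module.finrank ℂ (twistRep V U ψ h1 hψ).invariants := by
  classical
  have hc : (Nat.card U : ℂ) ≠ 0 := by simp
  have hSU : Nat.card U = S.card := Nat.subtype_card S hS
  have := invertibleOfNonzero hc
  have key := (twistRep V U ψ h1 hψ).card_inv_mul_sum_char_eq_finrank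
  rw [inv_mul_eq_iff_eq_mul₀ hc, hSU] at key
  rw [← key, ← Finset.sum_coe_sort, ← (Equiv.subtypeEquivRight hS).sum_comp]
  refine Finset.sum_congr rfl fun u _ => ?_
  simp [Representation.character, twistRep, FDRep.character]

theorem IsIrrChar.exists_sum_mul_eq {χ : G → ℂ} (h : IsIrrChar χ) (U : Subgroup G) (ψ : G → ℂ)
    (h1 : ψ 1 = 1) (hψ : ∀ x ∈ U, ∀ y ∈ U, ψ (x * y) = ψ x * ψ y) (S : Finset G)
    (hS : ∀ x, x ∈ S ↔ x ∈ U) : ∃ N : ℕ, ∑ u ∈ S, ψ u * χ u = S.card * N := by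
  obtain ⟨V, hV, rfl⟩ := h
  exact ⟨_, sum_mul_character_eq V U ψ h1 hψ S hS⟩

theorem IsIrrChar.sum_ne_zero_of_le {χ : G → ℂ} (h : IsIrrChar χ) (U : Subgroup G) (ψ : G → ℂ)
    (h1 : ψ 1 = 1) (hψ : ∀ x ∈ U, ∀ y ∈ U, ψ (x * y) = ψ x * ψ y) (S : Finset G)
    (hS : ∀ x, x ∈ S ↔ x ∈ U) (R : Subgroup G) (T : Finset G) (hT : ∀ x, x ∈ T ↔ x ∈ R)
    (hRU : R ≤ U) (hR : ∀ x ∈ R, ψ x = 1) (h0 : ∑ u ∈ S, ψ u * χ u ≠ 0) : ∑ r ∈ T, χ r ≠ 0 := by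
  obtain ⟨V, hV, rfl⟩ := h
  have hone : ∀ x ∈ R, ∀ y ∈ R, (1 : ℂ) = 1 * 1 := by simp
  have e := sum_mul_character_eq V R (fun _ => 1) rfl hone T hT
  simp only [one_mul] at e
  rw [sum_mul_character_eq V U ψ h1 hψ S hS] at h0
  rw [e]
  have hT0 : T.card ≠ 0 := Finset.card_ne_zero_of_mem ((hT 1).mpr R.one_mem)
  have hle : (twistRep V U ψ h1 hψ).invariants ≤
      (twistRep V R (fun _ => 1) rfl hone).invariants := by
    intro v hv r
    have := hv ⟨r, hRU r.2⟩
    simp only [twistRep, MonoidHom.coe_mk, OneHom.coe_mk, hR _ r.2] at this ⊢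
    exact this
  have h2 := Submodule.finrank_mono hle
  have h3 := right_ne_zero_of_mul h0
  refine mul_ne_zero (by exact_mod_cast hT0) ?_
  have : Module.finrank ℂ (twistRep V U ψ h1 hψ).invariants ≠ 0 := by exact_mod_cast h3
  exact_mod_cast (by omega : Module.finrank ℂ
    (twistRep V R (fun _ => 1) rfl hone).invariants ≠ 0)

end Eigenspaces

section Transpose

open Polynomial in
theorem Polynomial.exists_functional_quotient {F : Type} [Field F] (g : F[X]) (hg : g ≠ 0) :
    ∃ l : (F[X] ⧸ Ideal.span {g}) →+ F, (∀ c x, l (C c • x) = c * l x) ∧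
      ∀ u, (∀ w, l (u * w) = 0) → u = 0 := by
  wlog hm : g.Monic generalizing g
  · have h1 : Ideal.span {g} = Ideal.span {g * C g.leadingCoeff⁻¹} := by
      rw [Ideal.span_singleton_mul_right_unit]
      exact isUnit_C.mpr (IsUnit.mk0 _ (inv_ne_zero (leadingCoeff_ne_zero.mpr hg)))
    rw [h1]
    exact this _ (mul_ne_zero hg (by simpa using hg)) (monic_mul_leadingCoeff_inv hg)
  let l : (F[X] ⧸ Ideal.span {g}) →+ F :=
    QuotientAddGroup.lift (Ideal.span {g}).toAddSubgroup
      (((lcoeff F (g.natDegree - 1)).comp (modByMonicHom g)).toAddMonoidHom) (fun f hf => by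
        have : g ∣ f := Ideal.mem_span_singleton.mp hf
        simp [modByMonicHom, (modByMonic_eq_zero_iff_dvd hm).mpr this])
  have hl : ∀ f, l (Ideal.Quotient.mk _ f) = (f %ₘ g).coeff (g.natDegree - 1) := fun f => rfl
  refine ⟨l, fun c x => ?_, fun u hu => ?_⟩
  · obtain ⟨f, rfl⟩ := Ideal.Quotient.mk_surjective x
    have : C c • (Ideal.Quotient.mk (Ideal.span {g}) f) = Ideal.Quotient.mk _ (C c * f) := rfl
    rw [this, hl, hl, ← smul_eq_C_mul, smul_modByMonic, coeff_smul, smul_eq_mul]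
  · obtain ⟨f, rfl⟩ := Ideal.Quotient.mk_surjective u
    have hfr : Ideal.Quotient.mk (Ideal.span {g}) f = Ideal.Quotient.mk _ (f %ₘ g) := by
      rw [Ideal.Quotient.eq, Ideal.mem_span_singleton]
      exact ⟨f /ₘ g, by linear_combination (-1 : F[X]) * modByMonic_add_div f g⟩
    rw [hfr] at hu ⊢
    by_contra hr
    have hr0 : f %ₘ g ≠ 0 := fun h => hr (by rw [h, map_zero])
    have hlt : (f %ₘ g).natDegree < g.natDegree := natDegree_lt_natDegree hr0 (degree_modByMonic_lt f hm)
    have h1 := hu (Ideal.Quotient.mk _ (X ^ (g.natDegree - 1 - (f %ₘ g).natDegree)))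
    rw [← map_mul, hl, modByMonic_eq_self_iff hm |>.mpr] at h1
    · rw [show g.natDegree - 1 = (f %ₘ g).natDegree + (g.natDegree - 1 - (f %ₘ g).natDegree) by omega,
        Nat.add_sub_cancel_left, coeff_mul_X_pow] at h1
      exact hr0 (leadingCoeff_eq_zero.mp h1)
    · rw [degree_mul, degree_X_pow, degree_eq_natDegree hr0, degree_eq_natDegree hm.ne_zero]
      exact_mod_cast by omega

open Polynomial in
/-- Every square matrix over a field is conjugate to its transpose. -/
theorem Matrix.exists_mul_eq_transpose_mul {F ω : Type} [Field F] [Fintype ω] [DecidableEq ω]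
    (A : Matrix ω ω F) : ∃ S : Matrix ω ω F, IsUnit S ∧ S * A = Aᵀ * S := by
  let M := Module.AEval' (Matrix.toLin' A)
  have htor : Module.IsTorsion F[X] M := Module.AEval.isTorsion_of_finiteDimensional F (ω → F) _
  obtain ⟨ι, _, p, hp, e, ⟨φ⟩⟩ := Module.equiv_directSum_of_isTorsion htor
  classical
  choose l hl1 hl2 using fun i => exists_functional_quotient (p i ^ e i) (pow_ne_zero _ (hp i).ne_zero)
  let φ' : (ω → F) → (i : ι) → F[X] ⧸ Ideal.span {p i ^ e i} :=
    fun u i => φ (Module.AEval'.of (Matrix.toLin' A) u) i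
  have hadd : ∀ u v i, φ' (u + v) i = φ' u i + φ' v i := fun u v i => by simp [φ']
  have hsmul : ∀ (c : F) u i, φ' (c • u) i = C c • φ' u i := fun c u i => by
    simp only [φ']
    rw [map_smul, ← Module.AEval.C_smul, map_smul]
    rfl
  have hX : ∀ u i, φ' (A *ᵥ u) i = X • φ' u i := fun u i => by
    simp only [φ']
    have : Module.AEval'.of (Matrix.toLin' A) (A *ᵥ u) =
      (X : F[X]) • Module.AEval'.of (Matrix.toLin' A) u := by
        rw [Module.AEval'.X_smul_of, Matrix.toLin'_apply]
    rw [this, map_smul, DirectSum.smul_apply]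
  have hsl : ∀ i (c : F[X]) (a b : F[X] ⧸ Ideal.span {p i ^ e i}), c • a * b = c • (a * b) := by
    intro i c a b
    obtain ⟨a, rfl⟩ := Ideal.Quotient.mk_surjective a
    obtain ⟨b, rfl⟩ := Ideal.Quotient.mk_surjective b
    exact congrArg (Ideal.Quotient.mk (Ideal.span {p i ^ e i})) (mul_assoc c a b)
  have hsr : ∀ i (c : F[X]) (a b : F[X] ⧸ Ideal.span {p i ^ e i}), a * c • b = c • (a * b) := by
    intro i c a b
    rw [_root_.mul_comm a, hsl, _root_.mul_comm b]
  let B : (ω → F) →ₗ[F] (ω → F) →ₗ[F] F := LinearMap.mk₂ F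
    (fun u v => ∑ i, l i (φ' u i * φ' v i))
    (fun u u' v => by simp [hadd, add_mul, Finset.sum_add_distrib])
    (fun c u v => by simp only [hsmul, hsl, hl1, Finset.mul_sum, smul_eq_mul])
    (fun u v v' => by simp [hadd, mul_add, Finset.sum_add_distrib])
    (fun c u v => by simp only [hsmul, hsr, hl1, Finset.mul_sum, smul_eq_mul])
  have hB : ∀ u v, B u v = ∑ i, l i (φ' u i * φ' v i) := fun u v => rfl
  have hself : ∀ u v, B (A *ᵥ u) v = B u (A *ᵥ v) := fun u v => by
    simp only [hB, hX, hsl, hsr]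
  have hsep : B.SeparatingLeft := by
    intro u hu
    have h0 : ∀ i, φ' u i = 0 := fun i => hl2 i _ fun w => by
      have := hu ((Module.AEval'.of (Matrix.toLin' A)).symm (φ.symm (DirectSum.of _ i w)))
      rw [hB, Finset.sum_eq_single i] at this
      · simpa [φ'] using this
      · intro j _ hj
        have : φ' ((Module.AEval'.of (Matrix.toLin' A)).symm (φ.symm (DirectSum.of _ i w))) j = 0 := by
          simp only [φ', LinearEquiv.apply_symm_apply]
          exact DirectSum.of_eq_of_ne _ _ _ hj
        rw [this]; simp
      · simp
    have : φ (Module.AEval'.of (Matrix.toLin' A) u) = 0 := by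
      ext i
      exact h0 i
    simpa using this
  refine ⟨LinearMap.toMatrix₂' F B, ?_, ?_⟩
  · rw [Matrix.isUnit_iff_isUnit_det, isUnit_iff_ne_zero]
    exact Matrix.separatingLeft_iff_det_ne_zero.mp (LinearMap.SeparatingLeft.toMatrix₂' hsep)
  · have e1 := LinearMap.toMatrix₂'_comp (R := F) B (Matrix.toLin' A)
    have e2 := LinearMap.toMatrix₂'_compl₂ (R := F) B (Matrix.toLin' A)
    rw [LinearMap.toMatrix'_toLin'] at e1 e2
    rw [← e1, ← e2]
    congr 1
    refine LinearMap.ext fun u => LinearMap.ext fun v => ?_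
    simp only [LinearMap.compl₂_apply, LinearMap.comp_apply, Matrix.toLin'_apply, hself]

end Transpose

section Pattern

variable {F ω : Type} [Field F] [Fintype F] [DecidableEq F] [Fintype ω] [DecidableEq ω]

open Classical in
/-- The invertible matrices that agree with the identity outside the positions in `S`. -/
noncomputable def pat (F : Type) {ω : Type} [Field F] [Fintype F] [DecidableEq F] [Fintype ω]
    [DecidableEq ω] (S : ω → ω → Prop) : Finset (GL ω F) :=
  {x | ∀ a b, ¬ S a b → x.1 a b = (1 : Matrix ω ω F) a b}

theorem mem_pat {S : ω → ω → Prop} {x : GL ω F} :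
    x ∈ pat F S ↔ ∀ a b, ¬ S a b → x.1 a b = (1 : Matrix ω ω F) a b := by
  simp [pat]

theorem one_mem_pat (S : ω → ω → Prop) : (1 : GL ω F) ∈ pat F S :=
  mem_pat.mpr fun _ _ _ => rfl

theorem pat_mono {S S' : ω → ω → Prop} (h : ∀ a b, S a b → S' a b) : pat F S ⊆ pat F S' :=
  fun _ hx => mem_pat.mpr fun a b hab => mem_pat.mp hx a b fun h' => hab (h a b h')

theorem pat_apply_ne_zero {S : ω → ω → Prop} {x : GL ω F} (hx : x ∈ pat F S) {a b : ω}
    (h : x.1 a b ≠ 0) : a = b ∨ S a b := by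
  by_contra! hc
  exact h (by rw [mem_pat.mp hx a b hc.2, Matrix.one_apply_ne hc.1])

theorem mul_mem_pat {S : ω → ω → Prop} (hS : ∀ a b c, S a b → S b c → S a c) {x y : GL ω F}
    (hx : x ∈ pat F S) (hy : y ∈ pat F S) : x * y ∈ pat F S := by
  rw [mem_pat] at *
  intro a b hab
  have h : (x * y).1 = (x.1 - 1) * (y.1 - 1) + (x.1 - 1) + (y.1 - 1) + 1 := by
    rw [Units.val_mul]; noncomm_ring
  rw [h, Matrix.add_apply, Matrix.add_apply, Matrix.add_apply, Matrix.mul_apply,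
    Matrix.sub_apply, Matrix.sub_apply, hx a b hab, hy a b hab, Finset.sum_eq_zero]
  · simp
  · intro c _
    by_cases hac : S a c
    · rw [Matrix.sub_apply y.1, hy c b fun hcb => hab (hS _ _ _ hac hcb)]; simp
    · rw [Matrix.sub_apply x.1, hx a c hac]; simp

theorem inv_mem_pat {S : ω → ω → Prop} (hS : ∀ a b c, S a b → S b c → S a c) {x : GL ω F}
    (hx : x ∈ pat F S) : x⁻¹ ∈ pat F S := by
  have hpow : ∀ k : ℕ, x ^ k ∈ pat F S := fun k => by
    induction k with
    | zero => rw [pow_zero]; exact one_mem_pat S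
    | succ k ih => rw [pow_succ]; exact mul_mem_pat hS ih hx
  have h : x⁻¹ = x ^ (Fintype.card (GL ω F) - 1) := by
    rw [inv_eq_iff_mul_eq_one, ← pow_succ', Nat.sub_add_cancel Fintype.card_pos, pow_card_eq_one]
  rw [h]
  exact hpow _

/-- The pattern subgroup attached to a transitive relation. -/
noncomputable def patSubgroup (F : Type) {ω : Type} [Field F] [Fintype F] [DecidableEq F]
    [Fintype ω] [DecidableEq ω] (S : ω → ω → Prop) (hS : ∀ a b c, S a b → S b c → S a c) :
    Subgroup (GL ω F) where
  carrier := pat F S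
  mul_mem' := mul_mem_pat hS
  one_mem' := one_mem_pat S
  inv_mem' := inv_mem_pat hS

theorem mem_pat_iff_mem_patSubgroup {S : ω → ω → Prop} (hS : ∀ a b c, S a b → S b c → S a c)
    (x : GL ω F) : x ∈ pat F S ↔ x ∈ patSubgroup F S hS := Iff.rfl

theorem conj_mem_pat {S S' E₁ E₂ : ω → ω → Prop} {h x : GL ω F}
    (h₁ : ∀ a b, h.1 a b ≠ 0 → E₁ a b) (h₂ : ∀ a b, (h⁻¹).1 a b ≠ 0 → E₂ a b)
    (hE : ∀ a b c d, E₁ a b → S b c → E₂ c d → S' a d) (hx : x ∈ pat F S) :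
    h * x * h⁻¹ ∈ pat F S' := by
  rw [mem_pat] at *
  intro a d had
  have e : (h * x * h⁻¹).1 = h.1 * (x.1 - 1) * (h⁻¹).1 + 1 := by
    rw [mul_sub, sub_mul, mul_one, ← Units.val_mul h, ← Units.val_mul h, ← Units.val_mul (h * x),
      mul_inv_cancel, Units.val_one, sub_add_cancel]
  rw [e, Matrix.add_apply, add_eq_right, Matrix.mul_apply]
  refine Finset.sum_eq_zero fun c _ => ?_
  by_cases hc : (h⁻¹).1 c d = 0
  · rw [hc, mul_zero]
  rw [Matrix.mul_apply, Finset.sum_eq_zero, zero_mul]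
  intro b _
  by_cases hb : h.1 a b = 0
  · rw [hb, zero_mul]
  rw [Matrix.sub_apply, hx b c fun hbc => had (hE _ _ _ _ (h₁ _ _ hb) hbc (h₂ _ _ hc)), sub_self,
    mul_zero]

theorem sum_pat_conj {M : Type} [AddCommMonoid M] {S S' : ω → ω → Prop} (h : GL ω F)
    (h₁ : ∀ x ∈ pat F S, h * x * h⁻¹ ∈ pat F S') (h₂ : ∀ x ∈ pat F S', h⁻¹ * x * h ∈ pat F S)
    (f : GL ω F → M) : ∑ x ∈ pat F S, f (h * x * h⁻¹) = ∑ x ∈ pat F S', f x :=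
  Finset.sum_bij' (fun x _ => h * x * h⁻¹) (fun x _ => h⁻¹ * x * h) h₁ h₂
    (fun x _ => by group) (fun x _ => by group) (fun x _ => rfl)

theorem sum_pat_mul_right {M : Type} [AddCommMonoid M] {S : ω → ω → Prop}
    (hS : ∀ a b c, S a b → S b c → S a c) {y : GL ω F} (hy : y ∈ pat F S) (f : GL ω F → M) :
    ∑ x ∈ pat F S, f (x * y) = ∑ x ∈ pat F S, f x :=
  Finset.sum_bij' (fun x _ => x * y) (fun x _ => x * y⁻¹) (fun x hx => mul_mem_pat hS hx hy)
    (fun x hx => mul_mem_pat hS hx (inv_mem_pat hS hy))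
    (fun x _ => by group) (fun x _ => by group) (fun x _ => rfl)

theorem sum_pat_mul_left {M : Type} [AddCommMonoid M] {S : ω → ω → Prop}
    (hS : ∀ a b c, S a b → S b c → S a c) {y : GL ω F} (hy : y ∈ pat F S) (f : GL ω F → M) :
    ∑ x ∈ pat F S, f (y * x) = ∑ x ∈ pat F S, f x :=
  Finset.sum_bij' (fun x _ => y * x) (fun x _ => y⁻¹ * x) (fun x hx => mul_mem_pat hS hy hx)
    (fun x hx => mul_mem_pat hS (inv_mem_pat hS hy) hx)
    (fun x _ => by group) (fun x _ => by group) (fun x _ => rfl)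

omit [Fintype F] [DecidableEq F] in
theorem isUnit_of_pattern {S : ω → ω → Prop} (β : ω → ℕ) (hβ : ∀ a b, S a b → β a < β b)
    (A : Matrix ω ω F) (hA : ∀ a b, ¬ S a b → A a b = (1 : Matrix ω ω F) a b) : IsUnit A := by
  have h : ∀ k : ℕ, ∀ a b, ((A - 1) ^ k) a b ≠ 0 → β a + k ≤ β b := by
    intro k
    induction k with
    | zero =>
      intro a b hab
      by_cases e : a = b
      · simp [e]
      · simp [Matrix.one_apply_ne e] at hab
    | succ k ih =>
      intro a b hab
      rw [pow_succ, Matrix.mul_apply] at hab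
      obtain ⟨c, -, hc⟩ := Finset.exists_ne_zero_of_sum_ne_zero hab
      have h1 := ih a c (left_ne_zero_of_mul hc)
      have h2 : S c b := by
        by_contra h'
        exact right_ne_zero_of_mul hc (by rw [Matrix.sub_apply, hA c b h', sub_self])
      have := hβ c b h2
      omega
  have hn : IsNilpotent (A - 1) := by
    refine ⟨Finset.univ.sup β + 1, ?_⟩
    ext a b
    by_contra hab
    have h1 := h _ a b hab
    have h2 : β b ≤ Finset.univ.sup β := Finset.le_sup (Finset.mem_univ b)
    omega
  simpa using hn.isUnit_one_add

open Classical in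
theorem exists_mul_pat {S SC SX : ω → ω → Prop} (β : ω → ℕ) (hβ : ∀ a b, S a b → β a < β b)
    (hX : ∀ a b c, SX a b → SX b c → SX a c)
    (hSX : ∀ a b, SX a b → S a b) (hSC : ∀ a b, S a b → ¬ SX a b → SC a b)
    (hCX : ∀ a b c, S a b → ¬ SX a b → SX b c → SC a c) {r : GL ω F} (hr : r ∈ pat F S) :
    ∃ x ∈ pat F SX, r * x⁻¹ ∈ pat F SC := by
  let A : Matrix ω ω F := Matrix.of fun a b => if SX a b then r.1 a b else (1 : Matrix ω ω F) a b
  have hA : ∀ a b, ¬ SX a b → A a b = (1 : Matrix ω ω F) a b := fun a b h => by simp [A, h]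
  obtain ⟨x, hx⟩ := isUnit_of_pattern β (fun a b h => hβ a b (hSX a b h)) A hA
  have hxX : x ∈ pat F SX := mem_pat.mpr (by rw [hx]; exact hA)
  refine ⟨x, hxX, ?_⟩
  rw [mem_pat]
  intro a c hac
  have e : (r * x⁻¹).1 = (r.1 - A) * (x⁻¹).1 + 1 := by
    rw [sub_mul, ← hx, Units.mul_inv, sub_add_cancel, Units.val_mul]
  rw [e, Matrix.add_apply, add_eq_right, Matrix.mul_apply]
  refine Finset.sum_eq_zero fun b _ => ?_
  by_cases h1 : r.1 a b - A a b = 0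
  · rw [Matrix.sub_apply, h1, zero_mul]
  by_cases h2 : (x⁻¹).1 b c = 0
  · rw [h2, mul_zero]
  exfalso
  have h3 : ¬ SX a b := fun h => h1 (by simp [A, h])
  have h4 : S a b := by
    by_contra h
    exact h1 (by rw [hA a b h3, mem_pat.mp hr a b h, sub_self])
  rcases pat_apply_ne_zero (inv_mem_pat hX hxX) h2 with rfl | h5
  · exact hac (hSC a b h4 h3)
  · exact hac (hCX a b c h4 h3 h5)

theorem sum_pat_eq_sum_sum {M : Type} [AddCommMonoid M] {S SC SX : ω → ω → Prop} (β : ω → ℕ)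
    (hβ : ∀ a b, S a b → β a < β b) (hS : ∀ a b c, S a b → S b c → S a c)
    (hX : ∀ a b c, SX a b → SX b c → SX a c) (hC : ∀ a b c, SC a b → SC b c → SC a c)
    (hSX : ∀ a b, SX a b → S a b) (hSC : ∀ a b, SC a b ↔ S a b ∧ ¬ SX a b)
    (hCX : ∀ a b c, SC a b → SX b c → SC a c) (f : GL ω F → M) :
    ∑ r ∈ pat F S, f r = ∑ x ∈ pat F SX, ∑ c ∈ pat F SC, f (c * x) := by
  rw [← Finset.sum_product']
  symm
  refine Finset.sum_bij (fun p _ => p.2 * p.1) ?_ ?_ ?_ fun _ _ => rfl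
  · rintro ⟨x, c⟩ h
    rw [Finset.mem_product] at h
    exact mul_mem_pat hS (pat_mono (fun a b h => ((hSC a b).mp h).1) h.2) (pat_mono hSX h.1)
  · rintro ⟨x, c⟩ h ⟨x', c'⟩ h' e
    rw [Finset.mem_product] at h h'
    simp only at e h h'
    have e' : c'⁻¹ * c = x' * x⁻¹ := by
      rw [inv_mul_eq_iff_eq_mul, ← mul_assoc, ← e]; group
    have m1 : c'⁻¹ * c ∈ pat F SC := mul_mem_pat hC (inv_mem_pat hC h'.2) h.2
    have m2 : c'⁻¹ * c ∈ pat F SX := e' ▸ mul_mem_pat hX h'.1 (inv_mem_pat hX h.1)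
    have e1 : c'⁻¹ * c = 1 := by
      refine Units.ext (Matrix.ext fun a b => ?_)
      by_cases hab : SX a b
      · exact mem_pat.mp m1 a b fun h => ((hSC a b).mp h).2 hab
      · exact mem_pat.mp m2 a b hab
    rw [e1, eq_comm, mul_inv_eq_one] at e'
    rw [inv_mul_eq_one] at e1
    rw [e1, e']
  · intro r hr
    obtain ⟨x, hx, hc⟩ := exists_mul_pat β hβ hX hSX (fun a b h h' => (hSC a b).mpr ⟨h, h'⟩)
      (fun a b c h h' => hCX a b c ((hSC a b).mpr ⟨h, h'⟩)) hr
    exact ⟨(x, r * x⁻¹), Finset.mem_product.mpr ⟨hx, hc⟩, by group⟩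

end Pattern

section PatternTranspose

variable {F ω : Type} [Field F] [Fintype F] [DecidableEq F] [Fintype ω] [DecidableEq ω]

/-- The transpose of an invertible matrix. -/
def glTranspose (x : GL ω F) : GL ω F :=
  ⟨x.1ᵀ, (x⁻¹).1ᵀ, by rw [← Matrix.transpose_mul, Units.inv_mul, Matrix.transpose_one],
    by rw [← Matrix.transpose_mul, Units.mul_inv, Matrix.transpose_one]⟩

omit [Fintype F] [DecidableEq F] in
theorem glTranspose_apply (x : GL ω F) (a b : ω) : (glTranspose x).1 a b = x.1 b a := rfl

theorem glTranspose_mem_pat {S S' : ω → ω → Prop} (h : ∀ a b, S b a → S' a b) {x : GL ω F}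
    (hx : x ∈ pat F S) : glTranspose x ∈ pat F S' := by
  rw [mem_pat] at *
  intro a b hab
  rw [glTranspose_apply, hx b a fun h' => hab (h a b h')]
  simp only [Matrix.one_apply, eq_comm]

theorem exists_conj_eq_glTranspose (p : ω → Prop) {x : GL ω F}
    (hx : x ∈ pat F (fun a b => p a ∧ p b)) :
    ∃ s ∈ pat F (fun a b => p a ∧ p b), s * x * s⁻¹ = glTranspose x := by
  classical
  let e := Equiv.sumCompl p
  let A : Matrix {a // p a} {a // p a} F := x.1.submatrix (fun a => a.1) (fun a => a.1)
  obtain ⟨S, hS, hSA⟩ := Matrix.exists_mul_eq_transpose_mul A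
  let T : Matrix ω ω F := (Matrix.fromBlocks S 0 0 1).submatrix e.symm e.symm
  have hxA : x.1 = (Matrix.fromBlocks A 0 0 1).submatrix e.symm e.symm := by
    ext a b
    by_cases ha : p a <;> by_cases hb : p b
    · simp [e, ha, hb, A]
    · have : a ≠ b := fun h => hb (h ▸ ha)
      rw [mem_pat.mp hx a b fun h => hb h.2]
      simp [e, ha, hb, this]
    · have : a ≠ b := fun h => ha (h ▸ hb)
      rw [mem_pat.mp hx a b fun h => ha h.1]
      simp [e, ha, hb, this]
    · rw [mem_pat.mp hx a b fun h => ha h.1]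
      simp [e, ha, hb, Matrix.one_apply]
  have hT : IsUnit T := by
    rw [Matrix.isUnit_iff_isUnit_det, Matrix.det_submatrix_equiv_self,
      Matrix.det_fromBlocks_zero₂₁, Matrix.det_one, mul_one, ← Matrix.isUnit_iff_isUnit_det]
    exact hS
  obtain ⟨s, hs⟩ := hT
  refine ⟨s, ?_, ?_⟩
  · rw [mem_pat, hs]
    intro a b hab
    by_cases ha : p a <;> by_cases hb : p b
    · exact absurd ⟨ha, hb⟩ hab
    · have : a ≠ b := fun h => hb (h ▸ ha)
      simp [T, e, ha, hb, this]
    · have : a ≠ b := fun h => ha (h ▸ hb)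
      simp [T, e, ha, hb, this]
    · simp [T, e, ha, hb, Matrix.one_apply]
  · rw [mul_inv_eq_iff_eq_mul]
    refine Units.ext ?_
    change s.1 * x.1 = x.1ᵀ * s.1
    rw [hs, hxA, Matrix.transpose_submatrix, Matrix.submatrix_mul_equiv,
      Matrix.submatrix_mul_equiv, Matrix.fromBlocks_transpose, Matrix.fromBlocks_multiply,
      Matrix.fromBlocks_multiply]
    simp [hSA]

end PatternTranspose

section PatternSums

variable {F ω : Type} [Field F] [Fintype F] [DecidableEq F] [Fintype ω] [DecidableEq ω]

/-- The permutation matrix of `π`, sending the basis vector at `b` to the one at `π b`. -/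
def glPerm (F : Type) [Field F] (π : Equiv.Perm ω) : GL ω F :=
  ⟨Matrix.of fun a b => if a = π b then 1 else 0, Matrix.of fun a b => if b = π a then 1 else 0, by
    ext a b
    rw [Matrix.mul_apply, Finset.sum_eq_single (π.symm b)]
    · simp [Matrix.one_apply]
    · intro c _ hc
      have : b ≠ π c := fun h => hc (by simp [h])
      simp [this]
    · simp, by
    ext a b
    simp [Matrix.mul_apply, Matrix.one_apply, eq_comm]⟩

theorem sum_pat_comp_perm {S : ω → ω → Prop} {χ : GL ω F → ℂ}
    (hχ : ∀ g x, χ (x * g * x⁻¹) = χ g) (π : Equiv.Perm ω) :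
    ∑ r ∈ pat F (fun a b => S (π a) (π b)), χ r = ∑ r ∈ pat F S, χ r := by
  rw [← sum_pat_conj (glPerm F π) (S := fun a b => S (π a) (π b)) (S' := S)]
  · simp only [hχ]
  · intro x hx
    refine conj_mem_pat (E₁ := fun a b => a = π b) (E₂ := fun a b => b = π a) ?_ ?_ ?_ hx
    · intro a b h; by_contra h'; simp [glPerm, h'] at h
    · intro a b h; by_contra h'; simp [glPerm, Units.inv_mk, h'] at h
    · rintro _ b c _ rfl h rfl; exact h
  · intro x hx
    have : (glPerm F π)⁻¹ * x * (glPerm F π) = (glPerm F π)⁻¹ * x * ((glPerm F π)⁻¹)⁻¹ := by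
      rw [inv_inv]
    rw [this]
    refine conj_mem_pat (E₁ := fun a b => b = π a) (E₂ := fun a b => a = π b) ?_ ?_ ?_ hx
    · intro a b h; by_contra h'; simp [glPerm, Units.inv_mk, h'] at h
    · intro a b h; rw [inv_inv] at h; by_contra h'; simp [glPerm, h'] at h
    · rintro a _ _ d rfl h rfl; exact h

/-- A function on a full matrix block invariant under conjugation in the block has the same sum
over a pattern in the block and over the transposed pattern. -/
theorem sum_pat_transpose {S S' : ω → ω → Prop} (p : ω → Prop) (hS : ∀ a b, S a b → p a ∧ p b)
    (hSS' : ∀ a b, S a b ↔ S' b a) {f : GL ω F → ℂ}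
    (hf : ∀ s ∈ pat F (fun a b => p a ∧ p b), ∀ x ∈ pat F (fun a b => p a ∧ p b),
      f (s * x * s⁻¹) = f x) :
    ∑ x ∈ pat F S', f x = ∑ x ∈ pat F S, f x := by
  symm
  refine Finset.sum_bij' (fun x _ => glTranspose x) (fun x _ => glTranspose x) ?_ ?_ ?_ ?_ ?_
  · exact fun x hx => glTranspose_mem_pat (fun a b h => (hSS' b a).mp h) hx
  · exact fun x hx => glTranspose_mem_pat (fun a b h => (hSS' a b).mpr h) hx
  · exact fun x _ => Units.ext (Matrix.transpose_transpose _)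
  · exact fun x _ => Units.ext (Matrix.transpose_transpose _)
  · intro x hx
    have hx' := pat_mono hS hx
    obtain ⟨s, hs, he⟩ := exists_conj_eq_glTranspose p hx'
    rw [← he, hf s hs x hx']

/-- `f` summed against a normalized pattern subgroup and a commuting element is invariant. -/
theorem sum_pat_mul_conj_invariant {S E : ω → ω → Prop} (hE : ∀ a b c, E a b → E b c → E a c)
    (hE₁ : ∀ a b c, E a b → S b c → S a c) (hE₂ : ∀ a b c, S a b → E b c → S a c)
    {χ : GL ω F → ℂ} (hχ : ∀ g x, χ (x * g * x⁻¹) = χ g) (z : GL ω F)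
    (hz : ∀ s ∈ pat F E, s * z = z * s) {s : GL ω F} (hs : s ∈ pat F E) (x : GL ω F) :
    ∑ c ∈ pat F S, χ (c * (s * x * s⁻¹) * z) = ∑ c ∈ pat F S, χ (c * x * z) := by
  have key : ∀ s ∈ pat F E, ∀ c ∈ pat F S, s * c * s⁻¹ ∈ pat F S := by
    intro s hs c hc
    refine conj_mem_pat (E₁ := fun a b => a = b ∨ E a b) (E₂ := fun a b => a = b ∨ E a b)
      (fun a b => pat_apply_ne_zero hs) (fun a b => pat_apply_ne_zero (inv_mem_pat hE hs)) ?_ hc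
    rintro a b c d (rfl | h1) h2 (rfl | h3)
    · exact h2
    · exact hE₂ _ _ _ h2 h3
    · exact hE₁ _ _ _ h1 h2
    · exact hE₂ _ _ _ (hE₁ _ _ _ h1 h2) h3
  rw [← sum_pat_conj s (key s hs) fun c hc => by simpa using key s⁻¹ (inv_mem_pat hE hs) c hc]
  refine Finset.sum_congr rfl fun c _ => ?_
  rw [← hχ (c * x * z) s]
  congr 1
  have := hz _ (inv_mem_pat hE hs)
  calc s * c * s⁻¹ * (s * x * s⁻¹) * z = s * c * x * (s⁻¹ * z) := by group
    _ = s * (c * x * z) * s⁻¹ := by rw [this]; group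

theorem sum_pat_swap_levels {χ : GL ω F → ℂ} (hχ : ∀ g x, χ (x * g * x⁻¹) = χ g) (β : ω → ℕ)
    (v : ℕ) : ∑ r ∈ pat F (fun a b => Equiv.swap v (v + 1) (β a) < Equiv.swap v (v + 1) (β b)), χ r =
      ∑ r ∈ pat F (fun a b => β a < β b), χ r := by
  have hτ : ∀ x, Equiv.swap v (v + 1) x = if x = v then v + 1 else if x = v + 1 then v else x := fun x =>
    Equiv.swap_apply_def _ _ _
  let SX : ω → ω → Prop := fun a b => β a = v ∧ β b = v + 1
  let SX' : ω → ω → Prop := fun a b => β a = v + 1 ∧ β b = v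
  let SC : ω → ω → Prop := fun a b => β a < β b ∧ ¬ SX a b
  rw [sum_pat_eq_sum_sum (S := fun a b => β a < β b) (SC := SC) (SX := SX) β, sum_pat_eq_sum_sum
    (S := fun a b => Equiv.swap v (v + 1) (β a) < Equiv.swap v (v + 1) (β b)) (SC := SC) (SX := SX')
    (fun a => Equiv.swap v (v + 1) (β a))]
  · refine sum_pat_transpose (fun a => β a = v ∨ β a = v + 1) ?_ ?_ ?_
    · simp only [SX]; intro a b; omega
    · simp only [SX, SX']; intro a b; omega
    · intro s hs x _
      have := sum_pat_mul_conj_invariant (F := F) (S := SC) (E := fun a b => (β a = v ∨ β a = v + 1) ∧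
        (β b = v ∨ β b = v + 1)) (by intro a b c; omega) (by simp only [SC, SX]; intro a b c; omega)
        (by simp only [SC, SX]; intro a b c; omega) hχ 1 (fun s _ => by rw [mul_one, one_mul]) hs x
      simpa using this
  all_goals try simp only [SC, SX, SX', hτ]
  all_goals intro a b
  all_goals first | trivial | omega | (split_ifs <;> omega)

theorem sum_pat_comp_perm_levels {N : ℕ} {χ : GL ω F → ℂ} (hχ : ∀ g x, χ (x * g * x⁻¹) = χ g)
    (τ : Equiv.Perm (Fin (N + 1))) (β : ω → Fin (N + 1)) :
    ∑ r ∈ pat F (fun a b => τ (β a) < τ (β b)), χ r = ∑ r ∈ pat F (fun a b => β a < β b), χ r := by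
  have hτ : τ ∈ Submonoid.closure (Set.range fun i : Fin N => Equiv.swap i.castSucc i.succ) := by
    rw [Equiv.Perm.mclosure_swap_castSucc_succ]; trivial
  induction hτ using Submonoid.closure_induction generalizing β with
  | mem τ h =>
    obtain ⟨i, rfl⟩ := h
    have := sum_pat_swap_levels hχ (fun a => (β a).val) i.val
    have e : ∀ x : Fin (N + 1), Equiv.swap i.val (i.val + 1) x.val =
      (Equiv.swap i.castSucc i.succ x).val := fun x => by
        simp only [Equiv.swap_apply_def, Fin.ext_iff, Fin.val_castSucc, Fin.val_succ]
        split_ifs <;> simp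
    simpa only [e, Fin.val_fin_lt] using this
  | one => rfl
  | mul x y _ _ hx hy => exact (hx fun a => y (β a)).trans (hy β)

theorem Equiv.Perm.exists_lt_of_mem_of_notMem {N : ℕ} (E : Set (Fin N)) :
    ∃ τ : Equiv.Perm (Fin N), ∀ v ∈ E, ∀ w ∉ E, τ v < τ w := by
  classical
  let f : Fin N → ℕ := fun v => if v ∈ E then 0 else 1
  refine ⟨(Tuple.sort f)⁻¹, fun v hv w hw => ?_⟩
  by_contra! h
  have := Tuple.monotone_sort f h
  simp [f, hv, hw] at this

/-- If at most `l` indices have a non-singleton level, then the sum over the pattern of the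
levels is also the sum over a pattern containing all `a < b` with `l ≤ b`. -/
theorem exists_sum_pat_eq_of_card_le {N n l : ℕ} {χ : GL (Fin n) F → ℂ}
    (hχ : ∀ g x, χ (x * g * x⁻¹) = χ g) (β : Fin n → Fin (N + 1)) (D : Finset (Fin n))
    (hD : ∀ a a', a ≠ a' → β a = β a' → a ∈ D) (hl : D.card ≤ l) :
    ∃ S : Fin n → Fin n → Prop, (∀ a b c, S a b → S b c → S a c) ∧
      (∀ a b : Fin n, a < b → l ≤ b.val → S a b) ∧ (∀ a, ¬ S a a) ∧
      ∑ r ∈ pat F S, χ r = ∑ r ∈ pat F (fun a b => β a < β b), χ r := by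
  obtain ⟨τ, hτ⟩ := Equiv.Perm.exists_lt_of_mem_of_notMem {v | ∃ a a', a ≠ a' ∧ β a = v ∧ β a' = v}
  let π := Tuple.sort fun a => τ (β a)
  have hmono : Monotone fun a => τ (β (π a)) := Tuple.monotone_sort fun a => τ (β a)
  refine ⟨fun a b => τ (β (π a)) < τ (β (π b)), fun a b c => lt_trans, fun a b hab hlb => ?_,
    fun a => lt_irrefl _, ?_⟩
  · refine lt_of_le_of_ne (hmono hab.le) fun he => ?_
    have h1 : β (π a) = β (π b) := τ.injective he
    have h2 : ∀ c ≤ b, π c ∈ D := by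
      intro c hc
      have h3 : τ (β (π c)) ≤ τ (β (π b)) := hmono hc
      by_contra hcD
      have h4 : β (π c) ∉ {v | ∃ a a', a ≠ a' ∧ β a = v ∧ β a' = v} := by
        rintro ⟨x, y, hxy, hx, hy⟩
        by_cases hxc : x = π c
        · subst hxc
          exact hcD (hD _ y hxy (hx.trans hy.symm))
        · exact hcD (hD _ x (Ne.symm hxc) hx.symm)
      exact absurd h3 (not_le.mpr (hτ _ ⟨π a, π b, fun h => hab.ne (π.injective h), h1, rfl⟩ _ h4))
    have h5 : ((Finset.Iic b).map π.toEmbedding).card ≤ D.card := by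
      refine Finset.card_le_card fun x hx => ?_
      obtain ⟨c, hc, rfl⟩ := Finset.mem_map.mp hx
      exact h2 c (Finset.mem_Iic.mp hc)
    rw [Finset.card_map, Fin.card_Iic] at h5
    omega
  · rw [sum_pat_comp_perm (S := fun a b => τ (β a) < τ (β b)) hχ π, sum_pat_comp_perm_levels hχ τ β]

end PatternSums

section PatternInvariance

variable {F ω : Type} [Field F] [Fintype F] [DecidableEq F] [Fintype ω] [DecidableEq ω]

theorem mul_apply_of_mem_pat {S S' : ω → ω → Prop} {x y : GL ω F} (hx : x ∈ pat F S)
    (hy : y ∈ pat F S') {a b : ω} (h : ∀ c, S a c → ¬ S' c b) :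
    (x * y).1 a b = x.1 a b + y.1 a b - (1 : Matrix ω ω F) a b := by
  have e : (x * y).1 = (x.1 - 1) * (y.1 - 1) + x.1 + y.1 - 1 := by
    rw [Units.val_mul]; noncomm_ring
  rw [e, Matrix.sub_apply, Matrix.add_apply, Matrix.add_apply, Matrix.mul_apply,
    Finset.sum_eq_zero, zero_add]
  intro c _
  by_cases hac : S a c
  · rw [Matrix.sub_apply y.1, mem_pat.mp hy c b (h c hac)]; simp
  · rw [Matrix.sub_apply x.1, mem_pat.mp hx a c hac]; simp

theorem mul_apply_of_row {S : ω → ω → Prop} {x : GL ω F} (hx : x ∈ pat F S) {a : ω}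
    (h : ∀ c, ¬ S a c) (y : GL ω F) (b : ω) : (x * y).1 a b = y.1 a b := by
  rw [Units.val_mul, Matrix.mul_apply, Finset.sum_eq_single a]
  · rw [mem_pat.mp hx a a (h a), Matrix.one_apply_eq, one_mul]
  · intro c _ hc
    rw [mem_pat.mp hx a c (h c), Matrix.one_apply_ne hc.symm, zero_mul]
  · simp

theorem mul_apply_of_col {S : ω → ω → Prop} {x : GL ω F} (hx : x ∈ pat F S) {b : ω}
    (h : ∀ c, ¬ S c b) (y : GL ω F) (a : ω) : (y * x).1 a b = y.1 a b := by
  rw [Units.val_mul, Matrix.mul_apply, Finset.sum_eq_single b]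
  · rw [mem_pat.mp hx b b (h b), Matrix.one_apply_eq, mul_one]
  · intro c _ hc
    rw [mem_pat.mp hx c b (h c), Matrix.one_apply_ne hc, mul_zero]
  · simp

theorem exists_mem_pat_row_eq (P : ω → Prop) {y : ω → F} (hy : ∀ a, ¬ P a → y a = 0) {p : ω}
    (hp : y p ≠ 0) : ∃ k ∈ pat F (fun a b => a = p ∧ P b), ∀ b, k.1 p b = y b := by
  have hP : P p := by
    by_contra h
    exact hp (hy p h)
  have hu : IsUnit ((1 : Matrix ω ω F).updateRow p y) := by
    rw [Matrix.isUnit_iff_isUnit_det, ← Matrix.cramer_transpose_apply,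
      Matrix.transpose_one, Matrix.cramer_one]
    exact isUnit_iff_ne_zero.mpr hp
  obtain ⟨k, hk⟩ := hu
  refine ⟨k, mem_pat.mpr fun a b hab => ?_, fun b => by rw [hk, Matrix.updateRow_self]⟩
  rw [hk]
  by_cases ha : a = p
  · subst ha
    have hb : ¬ P b := fun h => hab ⟨rfl, h⟩
    rw [Matrix.updateRow_self, hy b hb, Matrix.one_apply_ne fun h => hb (by rwa [← h])]
  · rw [Matrix.updateRow_ne ha]

theorem exists_mem_pat_vecMul_eq_single (P : ω → Prop) {y : ω → F} (hy : ∀ a, ¬ P a → y a = 0)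
    (h0 : y ≠ 0) {i : ω} (hi : P i) :
    ∃ h ∈ pat F (fun a b => P a ∧ P b), y ᵥ* h.1 = Pi.single i 1 := by
  obtain ⟨p, hp⟩ := Function.ne_iff.mp h0
  have hPp : P p := by
    by_contra h
    exact hp (hy p h)
  obtain ⟨k, hk, hky⟩ := exists_mem_pat_row_eq P hy hp
  have hk' := pat_mono (S' := fun a b => P a ∧ P b)
    (fun a b (h : a = p ∧ P b) => ⟨by rwa [h.1], h.2⟩) hk
  have hs : glPerm F (Equiv.swap p i) ∈ pat F (fun a b => P a ∧ P b) := by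
    rw [mem_pat]
    intro a b hab
    simp only [glPerm, Matrix.of_apply, Matrix.one_apply, Equiv.swap_apply_def]
    grind
  refine ⟨k⁻¹ * glPerm F (Equiv.swap p i), mul_mem_pat (by tauto) (inv_mem_pat (by tauto) hk') hs, ?_⟩
  have e : y = Pi.single p 1 ᵥ* k.1 := by
    ext b
    rw [Matrix.single_one_vecMul, ← hky b]
    rfl
  rw [e, Matrix.vecMul_vecMul, ← Units.val_mul, mul_inv_cancel_left, Matrix.single_one_vecMul]
  ext b
  simp only [glPerm, Matrix.row_apply, Matrix.of_apply, Pi.single_apply, Equiv.swap_apply_def]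
  grind

end PatternInvariance

section Degenerate

variable {F : Type} [Field F] [Fintype F] [DecidableEq F] {n : ℕ}

/-- The sum of the entries just above the diagonal in the columns in `J`. -/
def superdiag (J : Finset (Fin n)) (M : Matrix (Fin n) (Fin n) F) : F :=
  ∑ p : Fin n × Fin n with p.2 ∈ J ∧ p.1.val + 1 = p.2.val, M p.1 p.2

omit [Fintype F] [DecidableEq F] in
theorem superdiag_congr {J : Finset (Fin n)} {M M' : Matrix (Fin n) (Fin n) F}
    (h : ∀ a b : Fin n, b ∈ J → a.val + 1 = b.val → M a b = M' a b) :
    superdiag J M = superdiag J M' := by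
  refine Finset.sum_congr rfl fun p hp => ?_
  obtain ⟨-, h1, h2⟩ := Finset.mem_filter.mp hp
  exact h _ _ h1 h2

omit [Fintype F] [DecidableEq F] in
theorem superdiag_eq_zero {J : Finset (Fin n)} {M : Matrix (Fin n) (Fin n) F}
    (h : ∀ a b : Fin n, b ∈ J → a.val + 1 = b.val → M a b = 0) : superdiag J M = 0 :=
  Finset.sum_eq_zero fun p hp => by
    obtain ⟨-, h1, h2⟩ := Finset.mem_filter.mp hp
    exact h _ _ h1 h2

theorem superdiag_mul (J : Finset (Fin n)) {x y : GL (Fin n) F}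
    (hx : x ∈ pat F (fun a b : Fin n => a < b)) (hy : y ∈ pat F (fun a b : Fin n => a < b)) :
    superdiag J (x * y).1 = superdiag J x.1 + superdiag J y.1 := by
  rw [superdiag, superdiag, superdiag, ← Finset.sum_add_distrib]
  refine Finset.sum_congr rfl fun p hp => ?_
  obtain ⟨-, -, h2⟩ := Finset.mem_filter.mp hp
  rw [mul_apply_of_mem_pat hx hy (by intro c hc hc'; omega),
    Matrix.one_apply_ne (by intro h; rw [h] at h2; omega), sub_zero]

omit [Fintype F] [DecidableEq F] in
theorem superdiag_insert {J : Finset (Fin n)} {k i : Fin n} (hk : k ∉ J) (hi : i.val + 1 = k.val)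
    (M : Matrix (Fin n) (Fin n) F) : superdiag (insert k J) M = M i k + superdiag J M := by
  have : (Finset.univ.filter fun p : Fin n × Fin n => p.2 ∈ insert k J ∧ p.1.val + 1 = p.2.val) =
      insert (i, k) (Finset.univ.filter fun p : Fin n × Fin n => p.2 ∈ J ∧ p.1.val + 1 = p.2.val) := by
    ext ⟨a, b⟩
    simp only [Finset.mem_filter, Finset.mem_univ, true_and, Finset.mem_insert, Prod.mk.injEq,
      Fin.ext_iff]
    constructor
    · rintro ⟨h1 | h1, h2⟩
      · left; omega
      · exact Or.inr ⟨h1, h2⟩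
    · rintro (⟨h1, h2⟩ | ⟨h1, h2⟩)
      · exact ⟨Or.inl h2, by omega⟩
      · exact ⟨Or.inr h1, h2⟩
  rw [superdiag, this, Finset.sum_insert (by simp [hk]), superdiag]

theorem odd_card_pat {S : Fin n → Fin n → Prop} (h2 : (2 : F) ≠ 0) {k : Fin n}
    (hS : ∀ a b, S a b ↔ a < k ∧ b = k) : Odd (pat F S).card := by
  have hT : ∀ a b c, S a b → S b c → S a c := by simp only [hS]; intro a b c; omega
  by_contra h
  rw [Nat.not_odd_iff_even, even_iff_two_dvd] at h
  have hc : Nat.card (patSubgroup F S hT) = (pat F S).card := by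
    change Nat.card {x // x ∈ pat F S} = _
    simp
  have : Fact (Nat.Prime 2) := ⟨Nat.prime_two⟩
  obtain ⟨⟨x, hx⟩, hx2⟩ := exists_prime_orderOf_dvd_card' 2 (hc ▸ h)
  have hx' : x ∈ pat F S := hx
  have h1 : x * x = 1 := by
    have := pow_orderOf_eq_one (⟨x, hx⟩ : patSubgroup F S hT)
    rw [hx2, pow_two] at this
    exact congrArg Subtype.val this
  have h3 : x = 1 := by
    refine Units.ext (Matrix.ext fun a b => ?_)
    by_cases hab : S a b
    · have h4 := mul_apply_of_mem_pat hx' hx' (a := a) (b := b) (by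
        simp only [hS] at hab ⊢; intro c; omega)
      have h5 : a ≠ b := by rw [hS] at hab; intro h; omega
      rw [h1, Units.val_one, Matrix.one_apply_ne h5, sub_zero, ← two_mul] at h4
      rw [Units.val_one, Matrix.one_apply_ne h5]
      exact (mul_eq_zero.mp h4.symm).resolve_left h2
    · exact mem_pat.mp hx' a b hab
  subst h3
  have : orderOf (⟨1, hx⟩ : patSubgroup F S hT) = 1 := orderOf_eq_one_iff.mpr rfl
  omega

/-- Summing an additive character of a column against itself over the column. -/
theorem sum_pat_column_eq_zero (ψ : AddChar F ℂ) (hψ : ψ ≠ 1) {k : Fin n} {x : GL (Fin n) F}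
    (hx : x ∈ pat F (fun a b => a < k ∧ b = k)) (h1 : x ≠ 1) :
    ∑ y ∈ pat F (fun a b : Fin n => a < k ∧ b = k),
      ψ (∑ a, (if a < k then y.1 a k else 0) * x.1 a k) = 0 := by
  obtain ⟨a, ha, hxa⟩ : ∃ a, a < k ∧ x.1 a k ≠ 0 := by
    by_contra! h
    refine h1 (Units.ext (Matrix.ext fun a b => ?_))
    by_cases hab : a < k ∧ b = k
    · rw [hab.2, h a hab.1, Units.val_one, Matrix.one_apply_ne hab.1.ne]
    · exact mem_pat.mp hx a b hab
  obtain ⟨t, ht⟩ : ∃ t, ψ t ≠ 1 := by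
    by_contra! h
    exact hψ (DFunLike.ext _ _ fun t => by rw [h t, AddChar.one_apply])
  have hoff : ∀ i j, ¬ (i < k ∧ j = k) →
      (1 + Matrix.single a k (t / x.1 a k) : Matrix (Fin n) (Fin n) F) i j =
        (1 : Matrix (Fin n) (Fin n) F) i j := by
    intro i j hij
    rw [Matrix.add_apply, Matrix.single_apply_of_ne, add_zero]
    rintro ⟨rfl, rfl⟩
    exact hij ⟨ha, rfl⟩
  obtain ⟨y₀, hy₀⟩ := isUnit_of_pattern (fun i : Fin n => i.val) (by intro i j; omega) _ hoff
  have hy₀m : y₀ ∈ pat F (fun a b => a < k ∧ b = k) := mem_pat.mpr (by rw [hy₀]; exact hoff)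
  have hval : ψ (∑ a, (if a < k then y₀.1 a k else 0) * x.1 a k) = ψ t := by
    rw [Finset.sum_eq_single a]
    · rw [if_pos ha, hy₀, Matrix.add_apply, Matrix.one_apply_ne ha.ne, Matrix.single_apply_same,
        zero_add, div_mul_cancel₀ _ hxa]
    · intro b _ hb
      split_ifs with h
      · rw [hy₀, Matrix.add_apply, Matrix.one_apply_ne h.ne, Matrix.single_apply_of_ne, zero_add,
          zero_mul]
        exact fun h => hb h.1.symm
      · rw [zero_mul]
    · simp
  have key := sum_pat_mul_left (S := fun a b : Fin n => a < k ∧ b = k) (by intro a b c; omega) hy₀m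
    fun y => ψ (∑ a, (if a < k then y.1 a k else 0) * x.1 a k)
  have : ∀ y ∈ pat F (fun a b : Fin n => a < k ∧ b = k),
      ψ (∑ a, (if a < k then (y₀ * y).1 a k else 0) * x.1 a k) =
      ψ t * ψ (∑ a, (if a < k then y.1 a k else 0) * x.1 a k) := by
    intro y hy
    rw [← hval, ← AddChar.map_add_eq_mul, ← Finset.sum_add_distrib]
    congr 1
    refine Finset.sum_congr rfl fun a _ => ?_
    split_ifs with h
    · rw [mul_apply_of_mem_pat hy₀m hy (by intro c; omega), Matrix.one_apply_ne h.ne]; ring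
    · ring
  rw [Finset.sum_congr rfl this, ← Finset.mul_sum] at key
  by_contra h
  exact ht (mul_right_cancel₀ h (key.trans (one_mul _).symm))

/-- The relation of being strictly above the diagonal in the columns from `k` on. -/
def UpperRel (n k : ℕ) (a b : Fin n) : Prop := a < b ∧ k ≤ b.val

theorem UpperRel.trans {n k : ℕ} (a b c : Fin n) (h : UpperRel n k a b) (h' : UpperRel n k b c) :
    UpperRel n k a c := ⟨h.1.trans h'.1, h'.2⟩

/-- The unnormalized multiplicity of a degenerate character. -/
noncomputable def degSum (ψ : AddChar F ℂ) (χ : GL (Fin n) F → ℂ) (k : ℕ) (J : Finset (Fin n)) : ℂ :=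
  ∑ u ∈ pat F (UpperRel n k), ψ (superdiag J u.1) * χ u

theorem superdiag_conj {k : Fin n} {J : Finset (Fin n)} (hJ : ∀ b ∈ J, k < b) {h : GL (Fin n) F}
    (hh : h ∈ pat F (fun a b : Fin n => a < k ∧ b < k)) (c : GL (Fin n) F) :
    superdiag J (h * c * h⁻¹).1 = superdiag J c.1 := by
  refine superdiag_congr fun a b hb hab => ?_
  have := hJ b hb
  rw [mul_apply_of_col (inv_mem_pat (by intro a b c; omega) hh) (by intro c; omega),
    mul_apply_of_row hh (by intro c; omega)]

theorem degSum_recursion {ψ : AddChar F ℂ} (hψ : ψ ≠ 1) {χ : GL (Fin n) F → ℂ}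
    (hχ : ∀ g x, χ (x * g * x⁻¹) = χ g) {k i : Fin n} (hik : i.val + 1 = k.val)
    {J : Finset (Fin n)} (hJ : ∀ b ∈ J, k < b) :
    ((pat F (fun a b : Fin n => a < k ∧ b = k)).card : ℂ) * degSum ψ χ (k + 1) J =
      degSum ψ χ k J +
        (((pat F (fun a b : Fin n => a < k ∧ b = k)).card - 1 : ℕ) : ℂ) *
          degSum ψ χ k (insert k J) := by
  let SX : Fin n → Fin n → Prop := fun a b => a < k ∧ b = k
  let g : GL (Fin n) F → ℂ := fun x => ∑ c ∈ pat F (UpperRel n (k + 1)), ψ (superdiag J c.1) * χ (c * x)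
  let P : GL (Fin n) F → GL (Fin n) F → ℂ := fun y x =>
    ψ (∑ a, (if a < k then y.1 a k else 0) * x.1 a k)
  have hSX : ∀ a b, SX a b → a < b := by intro a b h; rw [h.2]; exact h.1
  have split : ∀ f : GL (Fin n) F → ℂ, ∑ r ∈ pat F (UpperRel n k), f r =
      ∑ x ∈ pat F SX, ∑ c ∈ pat F (UpperRel n (k + 1)), f (c * x) := fun f =>
    sum_pat_eq_sum_sum (fun a : Fin n => a.val) (fun a b h => h.1) UpperRel.trans
      (by simp only [SX]; intro a b c; omega) UpperRel.trans
      (by simp only [SX, UpperRel]; intro a b; omega)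
      (by simp only [SX, UpperRel]; intro a b; omega)
      (by simp only [SX, UpperRel]; intro a b c; omega) f
  have hup : ∀ x ∈ pat F SX, x ∈ pat F (fun a b : Fin n => a < b) := fun x hx => pat_mono hSX hx
  have hup' : ∀ x ∈ pat F (UpperRel n (k + 1)), x ∈ pat F (fun a b : Fin n => a < b) :=
    fun x hx => pat_mono (fun a b h => h.1) hx
  have hsd : ∀ x ∈ pat F SX, superdiag J x.1 = 0 := fun x hx => superdiag_eq_zero fun a b hb hab => by
    have := hJ b hb
    rw [mem_pat.mp hx a b (by simp only [SX]; omega), Matrix.one_apply_ne (by intro h; rw [h] at hab; omega)]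
  have hkJ : k ∉ J := fun h => (hJ k h).false
  have d1 : degSum ψ χ k J = ∑ x ∈ pat F SX, g x := by
    rw [degSum, split]
    refine Finset.sum_congr rfl fun x hx => Finset.sum_congr rfl fun c hc => ?_
    rw [superdiag_mul J (hup' c hc) (hup x hx), hsd x hx, add_zero]
  have d2 : degSum ψ χ k (insert k J) = ∑ x ∈ pat F SX, ψ (x.1 i k) * g x := by
    rw [degSum, split]
    refine Finset.sum_congr rfl fun x hx => ?_
    rw [Finset.mul_sum]
    refine Finset.sum_congr rfl fun c hc => ?_
    rw [superdiag_mul _ (hup' c hc) (hup x hx), superdiag_insert hkJ hik, superdiag_insert hkJ hik,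
      hsd x hx, mem_pat.mp hc i k (by simp only [UpperRel]; omega),
      Matrix.one_apply_ne (by intro h; rw [h] at hik; omega), zero_add, add_zero,
      AddChar.map_add_eq_mul]
    ring
  have d3 : degSum ψ χ (k + 1) J = g 1 := by simp [degSum, g]
  have hg : ∀ h ∈ pat F (fun a b : Fin n => a < k ∧ b < k), ∀ x, g (h * x * h⁻¹) = g x := by
    intro h hh x
    have hN : ∀ h ∈ pat F (fun a b : Fin n => a < k ∧ b < k), ∀ c ∈ pat F (UpperRel n (k + 1)),
        h * c * h⁻¹ ∈ pat F (UpperRel n (k + 1)) := by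
      intro h hh c hc
      refine conj_mem_pat (fun a b => pat_apply_ne_zero hh)
        (fun a b => pat_apply_ne_zero (inv_mem_pat (by intro a b c; omega) hh)) ?_ hc
      simp only [UpperRel]
      intro a b c d
      omega
    simp only [g]
    rw [← sum_pat_conj h (hN h hh) fun c hc => by
      simpa using hN h⁻¹ (inv_mem_pat (by intro a b c; omega) hh) c hc]
    refine Finset.sum_congr rfl fun c hc => ?_
    rw [superdiag_conj hJ hh, ← hχ (c * x) h]
    congr 2
    group
  have e1 : ∑ y ∈ pat F SX, ∑ x ∈ pat F SX, P y x * g x = (pat F SX).card * g 1 := by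
    rw [Finset.sum_comm, Finset.sum_eq_single 1]
    · rw [← Finset.sum_mul]
      congr 1
      rw [Finset.sum_congr rfl fun y hy => ?_, Finset.sum_const, nsmul_eq_mul, mul_one]
      simp only [P]
      rw [Finset.sum_eq_zero, AddChar.map_zero_eq_one]
      intro a _
      split_ifs with h
      · rw [Units.val_one, Matrix.one_apply_ne h.ne, mul_zero]
      · rw [zero_mul]
    · intro x hx h1
      rw [← Finset.sum_mul, sum_pat_column_eq_zero ψ hψ hx h1, zero_mul]
    · intro h; exact absurd (one_mem_pat SX) h
  have e2 : ∀ y ∈ pat F SX, y ≠ 1 → ∑ x ∈ pat F SX, P y x * g x = degSum ψ χ k (insert k J) := by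
    intro y hy h1
    let v : Fin n → F := fun a => if a < k then y.1 a k else 0
    have hv0 : v ≠ 0 := by
      intro h0
      refine h1 (Units.ext (Matrix.ext fun a b => ?_))
      by_cases hab : SX a b
      · have := congrFun h0 a
        rw [hab.2, Units.val_one, Matrix.one_apply_ne hab.1.ne]
        simpa [v, hab.1] using this
      · exact mem_pat.mp hy a b hab
    obtain ⟨h, hh, hv⟩ := exists_mem_pat_vecMul_eq_single (fun a => a < k) (y := v)
      (fun a ha => by simp [v, ha]) hv0 (i := i) (by omega)
    have hN : ∀ h ∈ pat F (fun a b : Fin n => a < k ∧ b < k), ∀ c ∈ pat F SX,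
        h * c * h⁻¹ ∈ pat F SX := by
      intro h hh c hc
      refine conj_mem_pat (fun a b => pat_apply_ne_zero hh)
        (fun a b => pat_apply_ne_zero (inv_mem_pat (by intro a b c; omega) hh)) ?_ hc
      simp only [SX]
      intro a b c d
      omega
    rw [← sum_pat_conj h (hN h hh) fun c hc => by
      simpa using hN h⁻¹ (inv_mem_pat (by intro a b c; omega) hh) c hc, d2]
    refine Finset.sum_congr rfl fun x hx => ?_
    rw [hg h hh]
    congr 1
    change ψ (∑ a, v a * (h * x * h⁻¹).1 a k) = _
    congr 1
    calc ∑ a, v a * (h * x * h⁻¹).1 a k = ∑ a, v a * (h * x).1 a k := by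
          refine Finset.sum_congr rfl fun a _ => ?_
          rw [mul_apply_of_col (inv_mem_pat (by intro a b c; omega) hh) (by intro c; omega)]
      _ = (v ᵥ* (h * x).1) k := rfl
      _ = x.1 i k := by
        rw [Units.val_mul, ← Matrix.vecMul_vecMul, hv, Matrix.single_one_vecMul]; rfl
  have e3 : ∑ x ∈ pat F SX, P 1 x * g x = degSum ψ χ k J := by
    rw [d1]
    refine Finset.sum_congr rfl fun x hx => ?_
    simp only [P]
    rw [Finset.sum_eq_zero, AddChar.map_zero_eq_one, one_mul]
    intro a _
    split_ifs with h
    · rw [Units.val_one, Matrix.one_apply_ne h.ne, zero_mul]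
    · rw [zero_mul]
  classical
  rw [d3]
  change ((pat F SX).card : ℂ) * g 1 = _
  rw [← e1, ← Finset.add_sum_erase _ _ (one_mem_pat SX), e3, Finset.sum_congr rfl fun y hy =>
    e2 y (Finset.mem_of_mem_erase hy) (Finset.ne_of_mem_erase hy), Finset.sum_const,
    Finset.card_erase_of_mem (one_mem_pat SX), nsmul_eq_mul]

theorem card_pat_upperRel (k : Fin n) : (pat F (UpperRel n k)).card =
    (pat F (fun a b : Fin n => a < k ∧ b = k)).card * (pat F (UpperRel n (k + 1))).card := by
  have := sum_pat_eq_sum_sum (F := F) (S := UpperRel n k) (SC := UpperRel n (k + 1))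
    (SX := fun a b => a < k ∧ b = k) (fun a : Fin n => a.val) (fun a b h => h.1) UpperRel.trans
      (by intro a b c; omega) UpperRel.trans
      (by simp only [UpperRel]; intro a b; omega)
      (by simp only [UpperRel]; intro a b; omega)
      (by simp only [UpperRel]; intro a b c; omega) fun _ => 1
  simpa using this

theorem IsIrrChar.exists_degSum_eq {χ : GL (Fin n) F → ℂ} (h : IsIrrChar χ) (ψ : AddChar F ℂ) (k : ℕ)
    (J : Finset (Fin n)) : ∃ N : ℕ, degSum ψ χ k J = (pat F (UpperRel n k)).card * N := by
  refine h.exists_sum_mul_eq (patSubgroup F (UpperRel n k) UpperRel.trans)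
    (fun u => ψ (superdiag J u.1)) ?_ ?_ (pat F (UpperRel n k)) (mem_pat_iff_mem_patSubgroup _)
  · rw [superdiag_eq_zero, AddChar.map_zero_eq_one]
    intro a b _ hab
    rw [Units.val_one, Matrix.one_apply_ne (by intro h; rw [h] at hab; omega)]
  · intro x hx y hy
    rw [superdiag_mul J, AddChar.map_add_eq_mul]
    · exact pat_mono (fun a b h => h.1) (show x ∈ pat F (UpperRel n k) from hx)
    · exact pat_mono (fun a b h => h.1) (show y ∈ pat F (UpperRel n k) from hy)

theorem exists_degSum_ne_zero (h2 : (2 : F) ≠ 0) {χ : GL (Fin n) F → ℂ} (h : IsIrrChar χ)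
    {ψ : AddChar F ℂ} (hψ : ψ ≠ 1) (k : ℕ) (hk : 1 ≤ k) (hkn : k ≤ n) :
    ∀ (J : Finset (Fin n)) (c N : ℕ), (∀ b ∈ J, k ≤ b.val) →
      degSum ψ χ k J = (pat F (UpperRel n k)).card * N → ¬ 2 ^ c ∣ N →
      ∃ J' : Finset (Fin n), J'.card ≤ J.card + c ∧ degSum ψ χ 1 J' ≠ 0 := by
  induction k, hk using Nat.le_induction with
  | base =>
    intro J c N _ hN hc
    refine ⟨J, by omega, ?_⟩
    rw [hN]
    refine mul_ne_zero (Nat.cast_ne_zero.mpr (Finset.card_ne_zero.mpr ⟨1, one_mem_pat _⟩))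
      (Nat.cast_ne_zero.mpr fun h0 => hc (h0 ▸ dvd_zero _))
  | succ k hk ih =>
    intro J c N hJ hN hc
    let kk : Fin n := ⟨k, by omega⟩
    obtain ⟨N₁, hN₁⟩ := h.exists_degSum_eq ψ k J
    obtain ⟨N₂, hN₂⟩ := h.exists_degSum_eq ψ k (insert kk J)
    have hrec := degSum_recursion hψ (fun g x => h.conj g x) (k := kk) (i := ⟨k - 1, by omega⟩)
      (by simp only [kk]; omega) (J := J) (fun b hb => by have := hJ b hb; simp only [kk, Fin.lt_def]; omega)
    have hodd := odd_card_pat (F := F) h2 (k := kk) (fun a b => Iff.rfl)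
    have hcard := card_pat_upperRel (F := F) kk
    set X := (pat F (fun a b : Fin n => a < kk ∧ b = kk)).card
    change (X : ℂ) * degSum ψ χ (k + 1) J = degSum ψ χ k J + ((X - 1 : ℕ) : ℂ) *
      degSum ψ χ k (insert kk J) at hrec
    change (pat F (UpperRel n k)).card = X * (pat F (UpperRel n (k + 1))).card at hcard
    have hU : ((pat F (UpperRel n k)).card : ℂ) ≠ 0 :=
      Nat.cast_ne_zero.mpr (Finset.card_ne_zero.mpr ⟨1, one_mem_pat _⟩)
    have hNN : N = N₁ + (X - 1) * N₂ := by
      have : ((pat F (UpperRel n k)).card : ℂ) * N =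
          (pat F (UpperRel n k)).card * ((N₁ + (X - 1) * N₂ : ℕ) : ℂ) := by
        rw [hN, hN₁, hN₂] at hrec
        push_cast at hrec ⊢
        rw [mul_add, mul_left_comm, ← hrec, hcard]
        push_cast
        ring
      exact_mod_cast mul_left_cancel₀ hU this
    by_cases hc1 : 2 ^ c ∣ N₁
    · obtain ⟨e, he⟩ : 2 ∣ X - 1 := by obtain ⟨t, ht⟩ := hodd; exact ⟨t, by omega⟩
      obtain ⟨c, rfl⟩ : ∃ d, c = d + 1 := Nat.exists_eq_succ_of_ne_zero (by
        rintro rfl; exact hc (by simp))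
      have hc2 : ¬ 2 ^ c ∣ N₂ := fun hd => hc (by
        rw [hNN, he, mul_assoc]
        refine dvd_add hc1 ?_
        rw [pow_succ']
        exact mul_dvd_mul_left 2 (hd.mul_left e))
      obtain ⟨J', hJ', h'⟩ := ih (by omega) (insert kk J) c N₂ (fun b hb => by
        rcases Finset.mem_insert.mp hb with rfl | hb
        · rfl
        · have := hJ b hb; omega) hN₂ hc2
      refine ⟨J', hJ'.trans ?_, h'⟩
      have := Finset.card_insert_le kk J
      omega
    · exact ih (by omega) J c N₁ (fun b hb => by have := hJ b hb; omega) hN₁ hc1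

/-- An irreducible character whose degree is not divisible by a high power of two has nonzero
fixed vectors under a large unipotent pattern subgroup. -/
theorem IsIrrChar.sum_upperRel_ne_zero (h2 : (2 : F) ≠ 0) {χ : GL (Fin n) F → ℂ} (h : IsIrrChar χ)
    {c d l : ℕ} (hd : χ 1 = d) (hc : ¬ 2 ^ c ∣ d) (hl : 2 * c ≤ l) :
    ∑ r ∈ pat F (UpperRel n l), χ r ≠ 0 := by
  classical
  obtain ⟨ψ, hψ⟩ : ∃ ψ : AddChar F ℂ, ψ ≠ 1 :=
    (AddChar.exists_apply_ne_zero (a := (1 : F))).mpr one_ne_zero |>.imp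
      fun _ h => AddChar.ne_one_iff.mpr ⟨1, h⟩
  have hU1 : ∀ x, x ∈ pat F (UpperRel n n) → x = 1 := fun x hx =>
    Units.ext (Matrix.ext fun a b => mem_pat.mp hx a b (by simp only [UpperRel]; omega))
  have hn0 : ∃ J' : Finset (Fin n), J'.card ≤ c ∧ degSum ψ χ 1 J' ≠ 0 := by
    have hpat : pat F (UpperRel n n) = {1} :=
      Finset.eq_singleton_iff_unique_mem.mpr ⟨one_mem_pat _, hU1⟩
    have hdeg : degSum ψ χ n ∅ = (pat F (UpperRel n n)).card * d := by
      simp [degSum, hpat, superdiag, hd]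
    rcases Nat.eq_zero_or_pos n with rfl | hn
    · refine ⟨∅, by simp, ?_⟩
      have : pat F (UpperRel 0 1) = {1} := by
        ext x
        have : x = 1 := Units.ext (Matrix.ext fun a => a.elim0)
        simp [this, one_mem_pat]
      simp only [degSum, this, Finset.sum_singleton, hd, superdiag]
      simp
      rintro rfl
      simp at hc
    · obtain ⟨J', h1, h2⟩ := exists_degSum_ne_zero h2 h hψ n hn le_rfl ∅ c d (by simp) hdeg hc
      exact ⟨J', by simpa using h1, h2⟩
  obtain ⟨J, hJc, hJ⟩ := hn0
  let β : Fin n → Fin (n + 1) := fun a => ⟨(Finset.univ.filter fun b : Fin n => b ≤ a ∧ b ∉ J).card,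
    Nat.lt_succ_of_le ((Finset.card_le_univ _).trans_eq (Fintype.card_fin n))⟩
  have hmono : ∀ a a', a ≤ a' → β a ≤ β a' := by
    intro a a' haa
    simp only [β, Fin.mk_le_mk]
    refine Finset.card_le_card fun b hb => ?_
    simp only [Finset.mem_filter] at hb ⊢
    exact ⟨hb.1, hb.2.1.trans haa, hb.2.2⟩
  have hlt : ∀ a a' b, a < b → b ≤ a' → b ∉ J → β a < β a' := by
    intro a a' b hab hba hb
    simp only [β, Fin.mk_lt_mk]
    refine Finset.card_lt_card ⟨fun x hx => ?_, fun hx => ?_⟩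
    · simp only [Finset.mem_filter] at hx ⊢
      exact ⟨hx.1, hx.2.1.trans (hab.le.trans hba), hx.2.2⟩
    · have := @hx b (by simp [hba, hb])
      simp only [Finset.mem_filter] at this
      exact absurd this.2.1 (not_le.mpr hab)
  have hβ : ∀ a b, β a < β b → a < b := fun a b hab => by
    by_contra hba
    exact absurd (hmono b a (not_lt.mp hba)) (not_le.mpr hab)
  have hβJ : ∀ a b : Fin n, b ∈ J → a.val + 1 = b.val → β a = β b := by
    intro a b hb hab
    have : (Finset.univ.filter fun x : Fin n => x ≤ a ∧ x ∉ J) =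
        Finset.univ.filter fun x : Fin n => x ≤ b ∧ x ∉ J := by
      ext x
      simp only [Finset.mem_filter, Finset.mem_univ, true_and, Fin.le_def]
      constructor
      · rintro ⟨h1, h2⟩; exact ⟨by omega, h2⟩
      · rintro ⟨h1, h2⟩
        have : x ≠ b := fun h => h2 (h ▸ hb)
        have : x.val ≠ b.val := fun h => this (Fin.ext h)
        exact ⟨by omega, h2⟩
    simp only [β, this]
  have step : ∑ r ∈ pat F (fun a b => β a < β b), χ r ≠ 0 := by
    have htr : ∀ a b c : Fin n, β a < β b → β b < β c → β a < β c := fun a b c => lt_trans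
    refine h.sum_ne_zero_of_le (patSubgroup F (UpperRel n 1) UpperRel.trans)
      (fun u => ψ (superdiag J u.1)) ?_ ?_ (pat F (UpperRel n 1)) (mem_pat_iff_mem_patSubgroup _)
      (patSubgroup F (fun a b => β a < β b) htr) _ (mem_pat_iff_mem_patSubgroup _) ?_ ?_ hJ
    · rw [superdiag_eq_zero, AddChar.map_zero_eq_one]
      intro a b _ hab
      rw [Units.val_one, Matrix.one_apply_ne (by intro h; rw [h] at hab; omega)]
    · intro x hx y hy
      rw [superdiag_mul J, AddChar.map_add_eq_mul]
      · exact pat_mono (fun a b h => h.1) (show x ∈ pat F (UpperRel n 1) from hx)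
      · exact pat_mono (fun a b h => h.1) (show y ∈ pat F (UpperRel n 1) from hy)
    · refine pat_mono (F := F) (S := fun a b => β a < β b) fun a b hab => ?_
      have := hβ a b hab
      exact ⟨this, by omega⟩
    · intro x hx
      rw [superdiag_eq_zero, AddChar.map_zero_eq_one]
      intro a b hb hab
      rw [mem_pat.mp (show x ∈ pat F _ from hx) a b (by rw [hβJ a b hb hab]; exact lt_irrefl _),
        Matrix.one_apply_ne (by intro h; rw [h] at hab; omega)]
  let D : Finset (Fin n) := J ∪ J.image fun b => ⟨b.val - 1, by omega⟩
  have hD : ∀ a a', a ≠ a' → β a = β a' → a ∈ D := by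
    intro a a' hne he
    rcases lt_or_gt_of_ne hne with hlt' | hlt'
    · have hb : (⟨a.val + 1, by omega⟩ : Fin n) ∈ J := by
        by_contra hb
        exact (hlt a a' _ (by simp [Fin.lt_def]) (by simp [Fin.le_def]; omega) hb).ne he
      exact Finset.mem_union_right _ (Finset.mem_image.mpr ⟨_, hb, by simp⟩)
    · refine Finset.mem_union_left _ ?_
      by_contra hb
      exact (hlt a' a a hlt' le_rfl hb).ne' he
  have hDl : D.card ≤ l := by
    have h1 := Finset.card_union_le J (J.image fun b => (⟨b.val - 1, by omega⟩ : Fin n))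
    have h2 := Finset.card_image_le (s := J) (f := fun b => (⟨b.val - 1, by omega⟩ : Fin n))
    simp only [D]
    omega
  obtain ⟨S, htr, hS, -, he⟩ := exists_sum_pat_eq_of_card_le (fun g x => h.conj g x) β D hD hDl
  refine h.sum_ne_zero_of_le (patSubgroup F S htr) (fun _ => 1) rfl (by simp) (pat F S)
    (mem_pat_iff_mem_patSubgroup _) (patSubgroup F (UpperRel n l) UpperRel.trans) _
    (mem_pat_iff_mem_patSubgroup _) ?_ (by simp) ?_
  · exact pat_mono (F := F) (S := UpperRel n l) fun a b hab => hS a b hab.1 hab.2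
  · simpa only [one_mul, he] using step

end Degenerate

section Cycles

variable {F : Type} [Field F] [Fintype F] [DecidableEq F] {n : ℕ}

/-- The cycle `p → p + 1 → ⋯ → m - 1 → p`. -/
def cyclePerm (n p m : ℕ) : Equiv.Perm (Fin n) :=
  if h : p < m ∧ m ≤ n then
    { toFun := fun b => ⟨if p ≤ b.val ∧ b.val < m then (if b.val + 1 < m then b.val + 1 else p)
        else b.val, by split_ifs <;> omega⟩
      invFun := fun a => ⟨if p ≤ a.val ∧ a.val < m then (if a.val = p then m - 1 else a.val - 1)
        else a.val, by split_ifs <;> omega⟩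
      left_inv := fun b => by
        refine Fin.ext ?_
        simp only
        split_ifs <;> omega
      right_inv := fun a => by
        refine Fin.ext ?_
        simp only
        split_ifs <;> omega }
  else 1

theorem cyclePerm_val {p m : ℕ} (hpm : p < m) (hm : m ≤ n) (b : Fin n) : (cyclePerm n p m b).val =
    if p ≤ b.val ∧ b.val < m then (if b.val + 1 < m then b.val + 1 else p) else b.val := by
  rw [cyclePerm, dif_pos ⟨hpm, hm⟩]; rfl

theorem cyclePerm_mul {p i m : ℕ} (hpi : p ≤ i) (him : i < m) (hm : m ≤ n) :
    cyclePerm n p (i + 1) * cyclePerm n i m = cyclePerm n p m := by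
  ext b
  rw [Equiv.Perm.mul_apply, cyclePerm_val (by omega) (by omega), cyclePerm_val (by omega) (by omega),
    cyclePerm_val (by omega) (by omega)]
  split_ifs <;> omega

omit [Fintype F] [DecidableEq F] in
theorem glPerm_mul {ω : Type} [Fintype ω] [DecidableEq ω] (π σ : Equiv.Perm ω) :
    glPerm F π * glPerm F σ = glPerm F (π * σ) := by
  refine Units.ext (Matrix.ext fun a b => ?_)
  simp only [glPerm, Units.val_mul, Matrix.mul_apply, Matrix.of_apply, Equiv.Perm.mul_apply, mul_ite,
    mul_one, mul_zero, Finset.sum_ite_eq', Finset.mem_univ, if_true]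
  split_ifs <;> simp_all

omit [Fintype F] [DecidableEq F] in
theorem glPerm_one {ω : Type} [Fintype ω] [DecidableEq ω] : glPerm F (1 : Equiv.Perm ω) = 1 :=
  Units.ext (Matrix.ext fun a b => by
    simp only [glPerm, Matrix.of_apply, Equiv.Perm.one_apply, Units.val_one, Matrix.one_apply]
    split_ifs <;> simp_all)

/-- The diagonal matrix with entry `t` at position `p` and ones elsewhere. -/
def diagAt (n p : ℕ) (t : Fˣ) : GL (Fin n) F :=
  ⟨Matrix.diagonal fun a => if a.val = p then t.1 else 1,
    Matrix.diagonal fun a => if a.val = p then (t⁻¹).1 else 1, by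
      rw [Matrix.diagonal_mul_diagonal, ← Matrix.diagonal_one]
      congr 1; funext a; split_ifs <;> simp, by
      rw [Matrix.diagonal_mul_diagonal, ← Matrix.diagonal_one]
      congr 1; funext a; split_ifs <;> simp⟩

/-- The matrix of the cycle `p → p + 1 → ⋯ → m - 1 → p`, with entry `t` in row `p`. -/
def colorCycle (n p m : ℕ) (t : Fˣ) : GL (Fin n) F := diagAt n p t * glPerm F (cyclePerm n p m)

omit [Fintype F] [DecidableEq F] in
theorem colorCycle_apply (p m : ℕ) (t : Fˣ) (a b : Fin n) : (colorCycle n p m t).1 a b =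
    if a = cyclePerm n p m b then (if a.val = p then t.1 else 1) else 0 := by
  simp [colorCycle, diagAt, glPerm, Matrix.diagonal_mul]

omit [Fintype F] [DecidableEq F] in
theorem colorCycle_inv_apply (p m : ℕ) (t : Fˣ) {a b : Fin n}
    (h : ((colorCycle n p m t)⁻¹).1 a b ≠ 0) : b = cyclePerm n p m a := by
  by_contra hb
  refine h ?_
  rw [colorCycle, _root_.mul_inv_rev, Units.val_mul]
  simp [diagAt, glPerm, Units.inv_mk, Matrix.mul_diagonal, hb]

omit [Fintype F] [DecidableEq F] in
theorem colorCycle_apply_ne_zero (p m : ℕ) (t : Fˣ) {a b : Fin n}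
    (h : (colorCycle n p m t).1 a b ≠ 0) : a = cyclePerm n p m b := by
  by_contra hb
  exact h (by rw [colorCycle_apply, if_neg hb])

omit [Fintype F] [DecidableEq F] in
theorem colorCycle_mul {p i m : ℕ} (hpi : p ≤ i) (him : i < m) (hm : m ≤ n) (t : Fˣ) :
    colorCycle n p (i + 1) t * colorCycle n i m 1 = colorCycle n p m t := by
  have h1 : diagAt n i (1 : Fˣ) = 1 := Units.ext (by simp [diagAt])
  rw [colorCycle, colorCycle, colorCycle, h1, one_mul, mul_assoc, glPerm_mul,
    cyclePerm_mul hpi him hm]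

omit [Fintype F] [DecidableEq F] in
theorem colorCycle_succ_self {p : ℕ} (hp : p < n) (t : Fˣ) :
    colorCycle n p (p + 1) t = diagAt n p t := by
  have : cyclePerm n p (p + 1) = 1 := by
    ext b
    rw [cyclePerm_val (by omega) (by omega), Equiv.Perm.one_apply]
    split_ifs <;> omega
  rw [colorCycle, this, glPerm_one, mul_one]

theorem colorCycle_mem_pat {p m : ℕ} (hpm : p < m) (hm : m ≤ n) (t : Fˣ) :
    colorCycle n p m t ∈ pat F (fun a b : Fin n => (p ≤ a.val ∧ a.val < m) ∧ p ≤ b.val ∧ b.val < m) := by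
  rw [mem_pat]
  intro a b hab
  have h := cyclePerm_val hpm hm b
  rw [colorCycle_apply, Matrix.one_apply]
  simp only [Fin.ext_iff]
  rw [h]
  split_ifs <;> first | rfl | omega

/-- Elements supported on disjoint blocks commute. -/
theorem mul_comm_of_mem_pat {ω : Type} [Fintype ω] [DecidableEq ω] {S S' : ω → ω → Prop}
    {x y : GL ω F} (hx : x ∈ pat F S) (hy : y ∈ pat F S') (h : ∀ a b c, S a b → ¬ S' b c)
    (h' : ∀ a b c, S' a b → ¬ S b c) : x * y = y * x := by
  refine Units.ext (Matrix.ext fun a b => ?_)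
  rw [mul_apply_of_mem_pat hx hy fun c => h a c b, mul_apply_of_mem_pat hy hx fun c => h' a c b,
    add_comm]

/-- Clearing a column above a row having only one nonzero entry. -/
theorem exists_mul_col_mem_pat {j : ℕ} {h : GL (Fin n) F} (hj : j < n)
    (hh : h ∈ pat F (fun a b : Fin n => a.val ≤ j ∧ b.val ≤ j))
    (hrow : ∀ b : Fin n, b.val ≠ j → h.1 ⟨j, hj⟩ b = 0) :
    ∃ u ∈ pat F (fun a b : Fin n => a.val < j ∧ b.val = j),
      u * h ∈ pat F (fun a b : Fin n => (a.val < j ∧ b.val < j) ∨ (a.val = j ∧ b.val = j)) := by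
  have hjj : h.1 ⟨j, hj⟩ ⟨j, hj⟩ ≠ 0 := by
    intro h0
    have e : (h * h⁻¹).1 ⟨j, hj⟩ ⟨j, hj⟩ = 1 := by rw [mul_inv_cancel, Units.val_one, Matrix.one_apply_eq]
    rw [Units.val_mul, Matrix.mul_apply, Finset.sum_eq_zero] at e
    · exact zero_ne_one e
    · intro c _
      by_cases hc : c.val = j
      · have : c = ⟨j, hj⟩ := Fin.ext hc
        rw [this, h0, zero_mul]
      · rw [hrow c hc, zero_mul]
  let v : Fin n → F := fun a => if a.val < j then - h.1 a ⟨j, hj⟩ / h.1 ⟨j, hj⟩ ⟨j, hj⟩ else 0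
  let A : Matrix (Fin n) (Fin n) F := 1 + Matrix.vecMulVec v (Pi.single ⟨j, hj⟩ 1)
  have hA : ∀ a b : Fin n, ¬ (a.val < j ∧ b.val = j) → A a b = (1 : Matrix _ _ F) a b := by
    intro a b hab
    simp only [A, Matrix.add_apply, Matrix.vecMulVec_apply, add_eq_left, v, Pi.single_apply, Fin.ext_iff]
    split_ifs <;> first | omega | simp
  obtain ⟨u, hu⟩ := isUnit_of_pattern (fun a : Fin n => a.val)
    (S := fun a b : Fin n => a.val < j ∧ b.val = j) (by intro a b; omega) A hA
  refine ⟨u, mem_pat.mpr (by rw [hu]; exact hA), mem_pat.mpr fun a b hab => ?_⟩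
  have e : (u * h).1 a b = h.1 a b + v a * h.1 ⟨j, hj⟩ b := by
    rw [Units.val_mul, hu, add_mul, one_mul, Matrix.add_apply, Matrix.vecMulVec_mul,
      Matrix.single_one_vecMul, Matrix.vecMulVec_apply]
    rfl
  rw [e]
  by_cases hb : b.val = j
  · obtain rfl : b = ⟨j, hj⟩ := Fin.ext hb
    by_cases ha : a.val < j
    · simp only [v, if_pos ha]
      rw [div_mul_cancel₀ _ hjj, add_neg_cancel, Matrix.one_apply_ne]
      intro h; rw [h] at ha; exact lt_irrefl _ ha
    · simp only [v, if_neg ha]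
      rw [zero_mul, add_zero, mem_pat.mp hh]
      omega
  · rw [hrow b hb, mul_zero, add_zero]
    by_cases ha : a.val = j
    · obtain rfl : a = ⟨j, hj⟩ := Fin.ext ha
      rw [hrow b hb, Matrix.one_apply_ne]
      intro h; exact hb (by rw [← h])
    · rw [mem_pat.mp hh]
      omega

/-- A vector whose first nonzero entry is at `j` is moved to the basis vector at `max j (l - 1)`
by the pattern of all `a < b` with `l ≤ b` and a block normalizing it. -/
theorem exists_vecMul_eq_single {l : ℕ} {y : Fin n → F} (hl : 0 < l) {j : Fin n} (hj : y j ≠ 0)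
    (h0 : ∀ a < j, y a = 0) {p i : Fin n} (hp : p.val = max j.val (l - 1))
    (hi : ∀ a, i < a → y a = 0) :
    ∃ r ∈ pat F (fun a b : Fin n => a < b ∧ l ≤ b.val ∧ b ≤ i), ∃ g ∈ pat F (fun a b : Fin n =>
      (a ≤ p ∧ (l ≤ p.val → a = p)) ∧ (b ≤ p ∧ (l ≤ p.val → b = p))),
      y ᵥ* (r * g).1 = Pi.single p 1 := by
  classical
  let v : Fin n → F := fun b => if j < b ∧ l ≤ b.val ∧ b ≤ i then - y b / y j else 0
  let A : Matrix (Fin n) (Fin n) F := 1 + Matrix.vecMulVec (Pi.single j 1) v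
  have hA : ∀ a b : Fin n, ¬ (a < b ∧ l ≤ b.val ∧ b ≤ i) → A a b = (1 : Matrix _ _ F) a b := by
    intro a b hab
    simp only [A, Matrix.add_apply, Matrix.vecMulVec_apply, add_eq_left, v, Pi.single_apply]
    split_ifs with h1 h2
    · subst h1; exact absurd h2 hab
    · simp
    · simp
    · simp
  obtain ⟨r, hr⟩ := isUnit_of_pattern (fun a : Fin n => a.val)
    (S := fun a b : Fin n => a < b ∧ l ≤ b.val ∧ b ≤ i) (by intro a b h; exact h.1) A hA
  have e : ∀ b, (y ᵥ* r.1) b = y b + y j * v b := by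
    intro b
    rw [hr, Matrix.vecMul_add, Matrix.vecMul_one, Pi.add_apply, Matrix.vecMul_vecMulVec]
    simp
  have h1 : ∀ b, ¬ (b ≤ p ∧ (l ≤ p.val → b = p)) → (y ᵥ* r.1) b = 0 := by
    intro b hb
    rw [e]
    simp only [v]
    split_ifs with h
    · rw [mul_div_cancel₀ _ hj, add_neg_cancel]
    · rw [mul_zero, add_zero]
      by_cases h1 : b < j
      · exact h0 b h1
      · refine hi b ?_
        simp only [Fin.le_def, Fin.lt_def, Fin.ext_iff] at *
        omega
  have h2 : y ᵥ* r.1 ≠ 0 := by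
    refine Function.ne_iff.mpr ⟨j, ?_⟩
    rw [e]
    simpa [v] using hj
  obtain ⟨g, hg, hyg⟩ := exists_mem_pat_vecMul_eq_single
    (fun a : Fin n => a ≤ p ∧ (l ≤ p.val → a = p)) h1 h2 (i := p) ⟨le_rfl, fun _ => rfl⟩
  exact ⟨r, mem_pat.mpr (by rw [hr]; exact hA), g, hg, by
    rw [Units.val_mul, ← Matrix.vecMul_vecMul, hyg]⟩

end Cycles

section Translates

variable {F : Type} [Field F] [Fintype F] [DecidableEq F] {n : ℕ}

/-- The sum of `f` over the coset of the pattern subgroup of `UpperRel n l` through `g`. -/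
noncomputable def cosetSum (l : ℕ) (f : GL (Fin n) F → ℂ) (g : GL (Fin n) F) : ℂ :=
  ∑ r ∈ pat F (UpperRel n l), f (r * g)

variable {l : ℕ} {f : GL (Fin n) F → ℂ}

theorem cosetSum_mul_left {r : GL (Fin n) F} (hr : r ∈ pat F (UpperRel n l)) (g : GL (Fin n) F) :
    cosetSum l f (r * g) = cosetSum l f g := by
  simpa only [cosetSum, mul_assoc] using sum_pat_mul_right UpperRel.trans hr fun x => f (x * g)

theorem cosetSum_mul_right (hf : ∀ g x, f (x * g * x⁻¹) = f g) {r : GL (Fin n) F}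
    (hr : r ∈ pat F (UpperRel n l)) (g : GL (Fin n) F) :
    cosetSum l f (g * r) = cosetSum l f g := by
  refine Eq.trans ?_ (sum_pat_mul_left UpperRel.trans hr fun x => f (x * g))
  refine Finset.sum_congr rfl fun x _ => ?_
  rw [← hf (x * (g * r)) r]
  congr 1
  group

theorem cosetSum_mul_eq_zero (hf : ∀ g x, f (x * g * x⁻¹) = f g) {SX SC : Fin n → Fin n → Prop}
    {a h : GL (Fin n) F} (hX : ∀ a b c, SX a b → SX b c → SX a c)
    (hC : ∀ a b c, SC a b → SC b c → SC a c)
    (hdec : ∀ r ∈ pat F (UpperRel n l), ∃ x ∈ pat F SX, r * x⁻¹ ∈ pat F SC)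
    (ha : ∀ x ∈ pat F SX, a * x * a⁻¹ ∈ pat F (UpperRel n l))
    (hh : ∀ c ∈ pat F SC, h⁻¹ * c * h ∈ pat F (UpperRel n l))
    (hh' : ∀ c ∈ pat F SC, h * c * h⁻¹ ∈ pat F (UpperRel n l))
    (h0 : ∀ x ∈ pat F SX, cosetSum l f (h * x * a) = 0) : cosetSum l f (a * h) = 0 := by
  have h1 : ∀ s ∈ pat F (UpperRel n l), cosetSum l f (a * s * h) = cosetSum l f (a * h) := by
    intro s hs
    obtain ⟨x, hx, hc⟩ := hdec s⁻¹ (inv_mem_pat UpperRel.trans hs)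
    have e : a * s * h = (a * x⁻¹ * a⁻¹) * ((a * h) * (h⁻¹ * (s⁻¹ * x⁻¹)⁻¹ * h)) := by group
    rw [e, cosetSum_mul_left (ha _ (inv_mem_pat hX hx)),
      cosetSum_mul_right hf (hh _ (inv_mem_pat hC hc))]
  have h2 : ∀ s ∈ pat F (UpperRel n l), cosetSum l f (h * s * a) = 0 := by
    intro s hs
    obtain ⟨x, hx, hc⟩ := hdec s hs
    have e : h * s * a = (h * (s * x⁻¹) * h⁻¹) * (h * x * a) := by group
    rw [e, cosetSum_mul_left (hh' _ hc), h0 x hx]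
  have h3 : ∑ s ∈ pat F (UpperRel n l), cosetSum l f (a * s * h) = 0 := by
    rw [← Finset.sum_eq_zero h2]
    simp only [cosetSum]
    rw [Finset.sum_comm]
    refine Finset.sum_congr rfl fun r _ => Finset.sum_congr rfl fun s _ => ?_
    rw [← hf (r * (a * s * h)) (s * h)]
    congr 1
    group
  rw [Finset.sum_congr rfl h1, Finset.sum_const, nsmul_eq_mul, mul_eq_zero] at h3
  refine h3.resolve_left (Nat.cast_ne_zero.mpr (Finset.card_ne_zero_of_mem (one_mem_pat _)))

omit [Fintype F] [DecidableEq F] in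
theorem apply_self_ne_zero_of_row {j : Fin n} {h : GL (Fin n) F}
    (hrow : ∀ b, b ≠ j → h.1 j b = 0) : h.1 j j ≠ 0 := by
  intro h0
  have e : (h * h⁻¹).1 j j = 1 := by rw [mul_inv_cancel, Units.val_one, Matrix.one_apply_eq]
  rw [Units.val_mul, Matrix.mul_apply, Finset.sum_eq_zero] at e
  · exact zero_ne_one e
  · intro c _
    by_cases hc : c = j
    · rw [hc, h0, zero_mul]
    · rw [hrow c hc, zero_mul]

set_option maxHeartbeats 1000000 in
theorem cosetSum_colorCycle_step (hf : ∀ g x, f (x * g * x⁻¹) = f g) (hl : 0 < l) {i m : ℕ}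
    (hli : l ≤ i + 1) (him : i + 1 < m) (hm : m ≤ n) {w : GL (Fin n) F}
    (hw : w ∈ pat F (fun a b : Fin n => m ≤ a.val ∧ m ≤ b.val))
    (hi : ∀ h ∈ pat F (fun a b : Fin n => a.val < i + 1 ∧ b.val < i + 1),
      cosetSum l f (h * (colorCycle n i m 1 * w)) = 0)
    (hj : ∀ h ∈ pat F (fun a b : Fin n => (a.val < i + 1 ∧ b.val < i + 1) ∨
      (a.val = i + 1 ∧ b.val = i + 1)), cosetSum l f (h * (colorCycle n (i + 1) m 1 * w)) = 0)
    {h : GL (Fin n) F} (hh : h ∈ pat F (fun a b : Fin n => a.val < i + 1 + 1 ∧ b.val < i + 1 + 1)) :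
    cosetSum l f (h * (colorCycle n (i + 1) m 1 * w)) = 0 := by
  have hG : ∀ k : ℕ, ∀ a b c : Fin n, a.val < k ∧ b.val < k → b.val < k ∧ c.val < k →
    a.val < k ∧ c.val < k := by intros; omega
  set z := colorCycle n (i + 1) m 1 * w with hz
  have hzmem : z ∈ pat F (fun a b : Fin n => i + 1 ≤ a.val ∧ i + 1 ≤ b.val) := by
    refine mul_mem_pat (by intros; omega) (pat_mono ?_ (colorCycle_mem_pat him hm 1)) (pat_mono ?_ hw)
      <;> (intros; omega)
  have hzinv : z⁻¹ ∈ pat F (fun a b : Fin n => i + 1 ≤ a.val ∧ i + 1 ≤ b.val) :=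
    inv_mem_pat (by intros; omega) hzmem
  have hu : ∀ u ∈ pat F (fun a b : Fin n => a.val < i + 1 ∧ b.val = i + 1), ∀ k,
      cosetSum l f (k * (u * z)) = cosetSum l f (k * z) := by
    intro u hu k
    have e : k * (u * z) = (k * z) * (z⁻¹ * u * z⁻¹⁻¹) := by group
    rw [e]
    refine cosetSum_mul_right hf (conj_mem_pat (h := z⁻¹)
      (fun a b => pat_apply_ne_zero hzinv) (fun a b hab => pat_apply_ne_zero hzmem (a := a) (b := b)
        (by rwa [inv_inv] at hab)) ?_ hu) _
    intro a b c d
    simp only [UpperRel, Fin.ext_iff, Fin.lt_def]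
    omega
  have hjn : i + 1 < n := by omega
  have hhinv := inv_mem_pat (hG _) hh
  by_cases hy : ∀ b : Fin n, b.val ≠ i + 1 → (h⁻¹).1 ⟨i + 1, hjn⟩ b = 0
  · obtain ⟨u, hu', hx⟩ := exists_mul_col_mem_pat hjn (h := h⁻¹)
      (pat_mono (by intros; omega) hhinv) hy
    have e : h * z = (u * h⁻¹)⁻¹ * (u * z) := by group
    rw [e, hu u hu']
    exact hj _ (inv_mem_pat (by intros; omega) hx)
  · obtain ⟨j₀, hj₀, hmin⟩ := WellFounded.has_min (r := (· < · : Fin n → Fin n → Prop)) wellFounded_lt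
      {b | (h⁻¹).1 ⟨i + 1, hjn⟩ b ≠ 0 ∧ b.val ≠ i + 1} (by push Not at hy; exact hy.imp fun b h => h.symm)
    simp only [Set.mem_ofPred_eq] at hj₀ hmin
    have hgt : ∀ b : Fin n, i + 1 < b.val → (h⁻¹).1 ⟨i + 1, hjn⟩ b = 0 := by
      intro b hb
      rw [mem_pat.mp hhinv _ _ (by omega), Matrix.one_apply_ne]
      simp only [ne_eq, Fin.ext_iff]; omega
    have hj₀i : j₀.val < i + 1 := by
      by_contra hc
      exact hj₀.1 (hgt j₀ (by omega))
    let p : Fin n := ⟨max j₀.val (l - 1), by omega⟩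
    have hpi : p.val ≤ i := by simp only [p]; omega
    obtain ⟨r, hr, g, hg, hrg⟩ := exists_vecMul_eq_single hl hj₀.1 (p := p) (i := ⟨i + 1, hjn⟩)
      (fun a ha => by
        by_contra hc
        exact hmin a ⟨hc, by have := Fin.lt_def.mp ha; omega⟩ ha) rfl
      (fun a ha => hgt a (by simpa [Fin.lt_def] using ha))
    have hgG : g ∈ pat F (fun a b : Fin n => a.val < i + 1 ∧ b.val < i + 1) :=
      pat_mono (by intro a b; simp only [Fin.le_def]; omega) hg
    have hcG : colorCycle n p.val (i + 1) 1 ∈ pat F (fun a b : Fin n => a.val < i + 1 ∧ b.val < i + 1) :=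
      pat_mono (by intros; omega) (colorCycle_mem_pat (F := F) (n := n) (by omega) (by omega) 1)
    have hcG' : colorCycle n p.val (i + 1 + 1) 1 ∈
        pat F (fun a b : Fin n => a.val < i + 1 + 1 ∧ b.val < i + 1 + 1) :=
      pat_mono (by intros; omega) (colorCycle_mem_pat (F := F) (n := n) (by omega) (by omega) 1)
    set v := h⁻¹ * (r * g) * colorCycle n p.val (i + 1 + 1) 1 with hv
    have hvG : v ∈ pat F (fun a b : Fin n => a.val < i + 1 + 1 ∧ b.val < i + 1 + 1) := by
      refine mul_mem_pat (hG _) (mul_mem_pat (hG _) hhinv (mul_mem_pat (hG _) (pat_mono ?_ hr)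
        (pat_mono ?_ hg))) hcG'
      · intro a b; simp only [Fin.lt_def, Fin.le_def]; omega
      · intro a b; simp only [Fin.le_def]; omega
    have hvrow : ∀ b, v.1 ⟨i + 1, hjn⟩ b = if b.val = i + 1 then 1 else 0 := by
      intro b
      have e : v.1 ⟨i + 1, hjn⟩ b = ((h⁻¹).1 ⟨i + 1, hjn⟩ ᵥ* (r * g).1 ᵥ*
          (colorCycle n p.val (i + 1 + 1) (1 : Fˣ)).1) b := by
        rw [hv, Units.val_mul, Units.val_mul (h⁻¹)]; rfl
      have hc := cyclePerm_val (n := n) (p := p.val) (m := i + 1 + 1) (by omega) (by omega) b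
      rw [e, hrg, Matrix.single_one_vecMul, Matrix.row_apply, colorCycle_apply]
      simp only [Fin.ext_iff]
      rw [hc]
      simp only [Units.val_one, ite_self]
      split_ifs <;> first | rfl | omega
    obtain ⟨u, hu', hx⟩ := exists_mul_col_mem_pat hjn (h := v) (pat_mono (by intros; omega) hvG)
      (fun b hb => by rw [hvrow, if_neg hb])
    have hxG : u * v ∈ pat F (fun a b : Fin n => a.val < i + 1 ∧ b.val < i + 1) := by
      rw [mem_pat]
      intro a b hab
      by_cases hab' : a.val = i + 1 ∧ b.val = i + 1
      · obtain rfl : a = ⟨i + 1, hjn⟩ := Fin.ext hab'.1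
        obtain rfl : b = ⟨i + 1, hjn⟩ := Fin.ext hab'.2
        rw [mul_apply_of_row hu' (by intro c; simp), hvrow, if_pos rfl, Matrix.one_apply_eq]
      · exact mem_pat.mp hx a b (by tauto)
    have hxinv := inv_mem_pat (hG _) hxG
    have e1 : h * z = r * (g * colorCycle n p.val (i + 1 + 1) 1 * (u * v)⁻¹ * (u * z)) := by
      rw [hv]
      simp only [mul_assoc, _root_.mul_inv_rev, inv_inv, mul_inv_cancel_left, inv_mul_cancel_left]
    have hrR : r ∈ pat F (UpperRel n l) := pat_mono (by intro a b h; exact ⟨h.1, h.2.1⟩) hr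
    have hcomm : (u * v)⁻¹ * z = z * (u * v)⁻¹ :=
      mul_comm_of_mem_pat hxinv hzmem (by intros; omega) (by intros; omega)
    have e2 : g * colorCycle n p.val (i + 1 + 1) 1 * (u * v)⁻¹ * z =
        (g * colorCycle n p.val m 1 * w) * (u * v)⁻¹ := by
      rw [mul_assoc, hcomm, hz, ← colorCycle_mul (p := p.val) (i := i + 1) (by omega) him hm]
      simp only [mul_assoc]
    rw [e1, cosetSum_mul_left hrR, hu u hu', e2]
    refine cosetSum_mul_eq_zero hf (SX := fun a b : Fin n => a < b ∧ l ≤ b.val ∧ b.val < i + 1)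
      (SC := fun a b : Fin n => a < b ∧ i + 1 ≤ b.val) ?_ ?_ ?_ ?_ ?_ ?_ ?_
    · intro a b c h1 h2; exact ⟨h1.1.trans h2.1, h2.2⟩
    · intro a b c h1 h2; exact ⟨h1.1.trans h2.1, h2.2⟩
    · intro s hs
      refine exists_mul_pat (fun a : Fin n => a.val) (S := UpperRel n l) ?_ ?_ ?_ ?_ ?_ hs
      all_goals simp only [UpperRel, Fin.lt_def]; intros; omega
    · intro x hx
      have h1 : w * x * w⁻¹ = x := by
        rw [mul_comm_of_mem_pat hw hx (by intro a b c; simp only [Fin.lt_def]; omega)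
          (by intro a b c; simp only [Fin.lt_def]; omega)]
        group
      have e : g * colorCycle n p.val m 1 * w * x * (g * colorCycle n p.val m 1 * w)⁻¹ =
          g * (colorCycle n p.val m 1 * (w * x * w⁻¹) * (colorCycle n p.val m 1)⁻¹) * g⁻¹ := by group
      rw [e, h1]
      refine conj_mem_pat (S := UpperRel n l) (fun a b => pat_apply_ne_zero hg)
        (fun a b => pat_apply_ne_zero (inv_mem_pat ?_ hg)) ?_ ?_
      · intros; tauto
      · intro a b c d
        simp only [UpperRel, Fin.ext_iff, Fin.lt_def, Fin.le_def]
        omega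
      · refine conj_mem_pat (fun a b => colorCycle_apply_ne_zero _ _ _)
          (fun a b => colorCycle_inv_apply _ _ _) ?_ hx
        rintro _ b c _ rfl hbc rfl
        have h2 := cyclePerm_val (n := n) (p := p.val) (m := m) (by omega) hm b
        have h3 := cyclePerm_val (n := n) (p := p.val) (m := m) (by omega) hm c
        simp only [UpperRel, Fin.lt_def] at hbc ⊢
        rw [h2, h3]
        split_ifs <;> omega
    · intro c hc
      rw [show (u * v)⁻¹⁻¹ * c * (u * v)⁻¹ = (u * v) * c * (u * v)⁻¹ by rw [inv_inv]]
      refine conj_mem_pat (fun a b => pat_apply_ne_zero hxG)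
        (fun a b => pat_apply_ne_zero hxinv) ?_ hc
      intro a b c d
      simp only [UpperRel, Fin.ext_iff, Fin.lt_def]
      omega
    · intro c hc
      refine conj_mem_pat (fun a b => pat_apply_ne_zero hxinv)
        (fun a b => pat_apply_ne_zero (inv_mem_pat (hG _) hxinv)) ?_ hc
      intro a b c d
      simp only [UpperRel, Fin.ext_iff, Fin.lt_def]
      omega
    · intro x hx
      have e : (u * v)⁻¹ * x * (g * colorCycle n p.val m 1 * w) =
          ((u * v)⁻¹ * x * (g * colorCycle n p.val (i + 1) 1)) * (colorCycle n i m 1 * w) := by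
        rw [← colorCycle_mul (p := p.val) (i := i) hpi (by omega) hm]
        simp only [mul_assoc]
      rw [e]
      refine hi _ (mul_mem_pat (hG _) (mul_mem_pat (hG _) hxinv (pat_mono ?_ hx))
        (mul_mem_pat (hG _) hgG hcG))
      intro a b; simp only [Fin.lt_def]; omega

theorem cosetSum_block_eq_zero (hf : ∀ g x, f (x * g * x⁻¹) = f g) (hl : 0 < l) {m : ℕ}
    (hlm : l ≤ m) (hm : m ≤ n) {w : GL (Fin n) F}
    (hw : w ∈ pat F (fun a b : Fin n => m ≤ a.val ∧ m ≤ b.val))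
    (h0 : ∀ h ∈ pat F (fun a b : Fin n => a.val < l ∧ b.val < l),
      cosetSum l f (h * (colorCycle n (l - 1) m 1 * w)) = 0)
    (hj : ∀ j, l ≤ j → j < m → ∀ h ∈ pat F (fun a b : Fin n => (a.val < j ∧ b.val < j) ∨
      (a.val = j ∧ b.val = j)), cosetSum l f (h * (colorCycle n j m 1 * w)) = 0)
    {h : GL (Fin n) F} (hh : h ∈ pat F (fun a b : Fin n => a.val < m ∧ b.val < m)) :
    cosetSum l f (h * w) = 0 := by
  have key : ∀ i, l ≤ i + 1 → i < m → ∀ h ∈ pat F (fun a b : Fin n => a.val < i + 1 ∧ b.val < i + 1),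
      cosetSum l f (h * (colorCycle n i m 1 * w)) = 0 := by
    intro i
    induction i with
    | zero =>
      intro h1 _
      obtain rfl : l = 1 := by omega
      exact h0
    | succ i ih =>
      intro h1 h2 h hh
      rcases Nat.lt_or_ge (i + 1) l with h3 | h3
      · obtain rfl : l = i + 1 + 1 := by omega
        exact h0 h hh
      · exact cosetSum_colorCycle_step hf hl h3 h2 hm hw (ih h3 (by omega)) (hj _ h3 h2) hh
  obtain ⟨i, rfl⟩ : ∃ i, m = i + 1 := ⟨m - 1, by omega⟩
  have := key i hlm (by omega) h hh
  have h1 : diagAt n i (1 : Fˣ) = 1 := Units.ext (by simp [diagAt])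
  rwa [colorCycle_succ_self (by omega), h1, one_mul] at this

/-- The total length of a colored composition. -/
def colorSize (L : List (ℕ × Fˣ)) : ℕ := (L.map Prod.fst).sum

/-- The product of colored cycles on consecutive intervals, ending at `n`. -/
def colorWord (n : ℕ) : List (ℕ × Fˣ) → GL (Fin n) F
  | [] => 1
  | x :: L => colorCycle n (n - colorSize L - x.1) (n - colorSize L) x.2 * colorWord n L

theorem colorWord_mem_pat {L : List (ℕ × Fˣ)} (hL : ∀ x ∈ L, 1 ≤ x.1) (hn : colorSize L ≤ n) :
    colorWord n L ∈ pat F (fun a b : Fin n => n - colorSize L ≤ a.val ∧ n - colorSize L ≤ b.val) := by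
  induction L with
  | nil => exact one_mem_pat _
  | cons x L ih =>
    have hs : colorSize (x :: L) = x.1 + colorSize L := by simp [colorSize]
    have hx := hL x (by simp)
    rw [hs] at hn ⊢
    refine mul_mem_pat (by intros; omega) (pat_mono ?_ (colorCycle_mem_pat (by omega) (by omega) _))
      (pat_mono ?_ (ih (fun y hy => hL y (by simp [hy])) (by omega)))
    · intros; omega
    · intros; omega

theorem exists_mul_diagAt {j : ℕ} (hj : j < n) {h : GL (Fin n) F}
    (hh : h ∈ pat F (fun a b : Fin n => (a.val < j ∧ b.val < j) ∨ (a.val = j ∧ b.val = j))) :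
    ∃ x ∈ pat F (fun a b : Fin n => a.val < j ∧ b.val < j), ∃ t, h = x * diagAt n j t := by
  have hjj : h.1 ⟨j, hj⟩ ⟨j, hj⟩ ≠ 0 := by
    refine apply_self_ne_zero_of_row fun b hb => ?_
    rw [mem_pat.mp hh, Matrix.one_apply_ne hb.symm]
    have : b.val ≠ j := fun e => hb (Fin.ext e)
    simp [this]
  refine ⟨h * (diagAt n j (Units.mk0 _ hjj))⁻¹, mem_pat.mpr fun a b hab => ?_, Units.mk0 _ hjj,
    by group⟩
  have e : (h * (diagAt n j (Units.mk0 _ hjj))⁻¹).1 a b =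
      h.1 a b * (if b.val = j then (h.1 ⟨j, hj⟩ ⟨j, hj⟩)⁻¹ else 1) := by
    rw [Units.val_mul]
    simp [diagAt, Units.inv_mk, Matrix.mul_diagonal]
  rw [e]
  by_cases hb : b.val = j
  · obtain rfl : b = ⟨j, hj⟩ := Fin.ext hb
    by_cases ha : a.val = j
    · obtain rfl : a = ⟨j, hj⟩ := Fin.ext ha
      simp [hjj]
    · have ha' : a ≠ ⟨j, hj⟩ := fun e => ha (by rw [e])
      rw [mem_pat.mp hh _ _ (by simp [ha]), Matrix.one_apply_ne ha', zero_mul]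
  · rw [if_neg hb, mul_one]
    exact mem_pat.mp hh _ _ (by omega)

/-- The coset sums of a class function vanish as soon as they vanish on a small set. -/
theorem cosetSum_eq_zero_of_colorWord (hf : ∀ g x, f (x * g * x⁻¹) = f g) (hl : 0 < l) (hln : l ≤ n)
    (h0 : ∀ L : List (ℕ × Fˣ), (∀ x ∈ L, 1 ≤ x.1) → colorSize L + l ≤ n →
      ∀ h ∈ pat F (fun a b : Fin n => a.val < l ∧ b.val < l),
        cosetSum l f (h * (colorCycle n (l - 1) (n - colorSize L) 1 * colorWord n L)) = 0)
    (g : GL (Fin n) F) : cosetSum l f g = 0 := by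
  have key : ∀ m, ∀ L : List (ℕ × Fˣ), (∀ x ∈ L, 1 ≤ x.1) → colorSize L + l ≤ n →
      n - colorSize L = m → ∀ h ∈ pat F (fun a b : Fin n => a.val < m ∧ b.val < m),
        cosetSum l f (h * colorWord n L) = 0 := by
    intro m
    induction m using Nat.strong_induction_on with
    | _ m ih =>
      rintro L hL hs rfl h hh
      refine cosetSum_block_eq_zero hf hl (by omega) (by omega) (colorWord_mem_pat hL (by omega))
        (h0 L hL hs) ?_ hh
      intro j hlj hjm h hh
      obtain ⟨x, hx, t, rfl⟩ := exists_mul_diagAt (by omega) hh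
      have hs' : colorSize ((n - colorSize L - j, t) :: L) = (n - colorSize L - j) + colorSize L := by
        simp [colorSize]
      have e : x * diagAt n j t * (colorCycle n j (n - colorSize L) 1 * colorWord n L) =
          x * colorWord n ((n - colorSize L - j, t) :: L) := by
        have e' : n - colorSize L - (n - colorSize L - j) = j := by omega
        rw [colorWord, e', ← colorCycle_mul (i := j) le_rfl hjm (by omega) t,
          colorCycle_succ_self (by omega)]
        simp only [mul_assoc]
      rw [e]
      refine ih j hjm _ ?_ (by omega) (by omega) x hx
      intro y hy
      rcases List.mem_cons.mp hy with rfl | hy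
      · simp only; omega
      · exact hL y hy
  have := key n [] (by simp) (by simp [colorSize, hln]) (by simp [colorSize]) g
    (mem_pat.mpr fun a b hab => absurd ⟨a.2, b.2⟩ hab)
  simpa [colorWord] using this

end Translates

section Swap

variable {F : Type} [Field F] [Fintype F] [DecidableEq F] {n : ℕ}

omit [Fintype F] [DecidableEq F] in
theorem glPerm_conj_apply {ω : Type} [Fintype ω] [DecidableEq ω] (π : Equiv.Perm ω) (x : GL ω F)
    (a b : ω) : (glPerm F π * x * (glPerm F π)⁻¹).1 (π a) (π b) = x.1 a b := by
  simp [glPerm, Units.inv_mk, Matrix.mul_apply]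

theorem exists_perm_reverse {p q : ℕ} (hq : q ≤ n) : ∃ π : Equiv.Perm (Fin n), ∀ b,
    (π b).val = if p ≤ b.val ∧ b.val < q then p + q - 1 - b.val else b.val := by
  let r : Fin n → Fin n := fun b => ⟨if p ≤ b.val ∧ b.val < q then p + q - 1 - b.val else b.val, by
    split_ifs <;> omega⟩
  have hr : Function.Involutive r := fun b => by
    refine Fin.ext ?_
    simp only [r]
    split_ifs <;> omega
  exact ⟨hr.toPerm, fun b => rfl⟩

omit [Fintype F] in
theorem glPerm_conj_glTranspose_colorCycle {p q i m : ℕ} (hp : p ≤ i) (him : i < m) (hmq : m ≤ q)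
    (hq : q ≤ n) {π : Equiv.Perm (Fin n)}
    (hπ : ∀ b, (π b).val = if p ≤ b.val ∧ b.val < q then p + q - 1 - b.val else b.val) (t : Fˣ) :
    glPerm F π * glTranspose (colorCycle n i m t) * (glPerm F π)⁻¹ =
      colorCycle n (p + q - m) (p + q - i) t := by
  refine Units.ext (Matrix.ext fun a b => ?_)
  obtain ⟨a, rfl⟩ := π.surjective a
  obtain ⟨b, rfl⟩ := π.surjective b
  rw [glPerm_conj_apply, glTranspose_apply, colorCycle_apply, colorCycle_apply]
  simp only [Fin.ext_iff]
  rw [cyclePerm_val him (by omega), cyclePerm_val (by omega) (by omega), hπ, hπ]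
  split_ifs <;> first | rfl | omega

theorem cosetSum_swap {l : ℕ} {f : GL (Fin n) F → ℂ} (hf : ∀ g x, f (x * g * x⁻¹) = f g)
    {p a b : ℕ} (hlp : l ≤ p) (ha : 1 ≤ a) (hb : 1 ≤ b) (hn : p + a + b ≤ n) (s t : Fˣ)
    {g w : GL (Fin n) F} (hg : g ∈ pat F (fun i j : Fin n => i.val < p ∧ j.val < p))
    (hw : w ∈ pat F (fun i j : Fin n => p + a + b ≤ i.val ∧ p + a + b ≤ j.val)) :
    cosetSum l f (g * (colorCycle n p (p + b) t * (colorCycle n (p + b) (p + a + b) s * w))) =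
    cosetSum l f (g * (colorCycle n p (p + a) s * (colorCycle n (p + a) (p + a + b) t * w))) := by
  set q := p + a + b with hq
  let E : Fin n → Fin n → Prop := fun i j => (p ≤ i.val ∧ i.val < q) ∧ p ≤ j.val ∧ j.val < q
  let SX : Fin n → Fin n → Prop := fun i j => i < j ∧ E i j
  let SC : Fin n → Fin n → Prop := fun i j => UpperRel n l i j ∧ ¬ SX i j
  have hE : ∀ i j k, E i j → E j k → E i k := by simp only [E]; intros; omega
  have hX : ∀ i j k, SX i j → SX j k → SX i k := fun i j k h h' =>
    ⟨h.1.trans h'.1, hE _ _ _ h.2 h'.2⟩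
  have hzE : ∀ x ∈ pat F E, x * (g * w) = (g * w) * x := fun x hx => by
    rw [← mul_assoc, mul_comm_of_mem_pat hx hg, mul_assoc, mul_comm_of_mem_pat hx hw, mul_assoc]
    all_goals simp only [E]; intros; omega
  have hgx : ∀ x ∈ pat F E, x * g = g * x := fun x hx => by
    rw [mul_comm_of_mem_pat hx hg]
    all_goals simp only [E]; intros; omega
  let φ : GL (Fin n) F → ℂ := fun x => ∑ c ∈ pat F SC, f (c * x * (g * w))
  have hφ : ∀ x, ∀ s ∈ pat F E, φ (s * x * s⁻¹) = φ x := fun x s hs =>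
    sum_pat_mul_conj_invariant hE (by simp only [E, SC, SX, UpperRel, Fin.lt_def]; intros; omega)
      (by simp only [E, SC, SX, UpperRel, Fin.lt_def]; intros; omega) hf (g * w) hzE hs x
  have hsum : ∀ x₀, cosetSum l f (x₀ * (g * w)) = ∑ x ∈ pat F SX, φ (x * x₀) := by
    intro x₀
    rw [cosetSum, sum_pat_eq_sum_sum (SX := SX) (SC := SC) (fun i : Fin n => i.val)
      (fun i j h => h.1) UpperRel.trans hX]
    · simp only [φ, mul_assoc]
    · simp only [E, SC, SX, UpperRel, Fin.lt_def]; intros; omega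
    · simp only [E, SX, UpperRel, Fin.lt_def]; intros; omega
    · intros; exact Iff.rfl
    · simp only [E, SC, SX, UpperRel, Fin.lt_def]; intros; omega
  obtain ⟨π, hπ⟩ := exists_perm_reverse (p := p) (q := q) hn
  have hπE : glPerm F π ∈ pat F E := by
    rw [mem_pat]
    intro i j hij
    simp only [glPerm, Matrix.of_apply, Matrix.one_apply, Fin.ext_iff]
    rw [hπ]
    simp only [E] at hij
    split_ifs <;> first | rfl | omega
  let σ : GL (Fin n) F → GL (Fin n) F := fun y => glPerm F π * glTranspose y * (glPerm F π)⁻¹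
  have hσmul : ∀ x y, σ (x * y) = σ y * σ x := fun x y => by
    have : glTranspose (x * y) = glTranspose y * glTranspose x :=
      Units.ext (Matrix.transpose_mul _ _)
    simp only [σ, this]
    group
  have hσφ : ∀ y ∈ pat F E, φ (σ y) = φ y := fun y hy => by
    obtain ⟨s, hs, he⟩ := exists_conj_eq_glTranspose (fun i : Fin n => p ≤ i.val ∧ i.val < q) hy
    rw [hφ _ _ hπE, ← he, hφ _ _ hs]
  have hσX : ∀ x ∈ pat F SX, σ x ∈ pat F SX := by
    intro x hx
    rw [mem_pat]
    intro i j hij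
    obtain ⟨i, rfl⟩ := π.surjective i
    obtain ⟨j, rfl⟩ := π.surjective j
    rw [glPerm_conj_apply, glTranspose_apply, mem_pat.mp hx]
    · simp only [Matrix.one_apply, π.injective.eq_iff, eq_comm]
    · intro h
      refine hij ?_
      simp only [SX, E, Fin.lt_def] at h ⊢
      rw [hπ, hπ]
      split_ifs <;> omega
  have hσinj : Function.Injective σ := by
    intro x y hxy
    have : glTranspose x = glTranspose y := by simpa [σ] using hxy
    exact Units.ext (Matrix.transpose_injective (congrArg Units.val this))
  have hσsum : ∀ u : GL (Fin n) F → ℂ, ∑ x ∈ pat F SX, u (σ x) = ∑ x ∈ pat F SX, u x := fun u =>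
    Finset.sum_bij (fun x _ => σ x) hσX (fun x _ y _ h => hσinj h)
      (fun b hb => by
        obtain ⟨a, ha, e⟩ := Finset.surj_on_of_inj_on_of_card_le (fun x _ => σ x) hσX
          (fun x y _ _ h => hσinj h) le_rfl b hb
        exact ⟨a, ha, e.symm⟩) (fun _ _ => rfl)
  have key : ∀ x₀ ∈ pat F E, cosetSum l f (x₀ * (g * w)) = cosetSum l f (σ x₀ * (g * w)) := by
    intro x₀ hx₀
    rw [hsum, hsum]
    have hXE : ∀ x ∈ pat F SX, x ∈ pat F E := fun x hx => pat_mono (fun _ _ h => h.2) hx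
    calc ∑ x ∈ pat F SX, φ (x * x₀) = ∑ x ∈ pat F SX, φ (σ x₀ * σ x) :=
          Finset.sum_congr rfl fun x hx => by
            rw [← hσφ _ (mul_mem_pat hE (hXE x hx) hx₀), hσmul]
      _ = ∑ x ∈ pat F SX, φ (σ x₀ * x) := hσsum fun x => φ (σ x₀ * x)
      _ = ∑ x ∈ pat F SX, φ (x * σ x₀) := Finset.sum_congr rfl fun x hx => by
            rw [← hφ _ _ (hXE x hx)]
            congr 1
            group
  have h1 : colorCycle n p (p + b) t ∈ pat F E :=
    pat_mono (by simp only [E]; intros; omega) (colorCycle_mem_pat (by omega) (by omega) t)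
  have h2 : colorCycle n (p + b) q s ∈ pat F E :=
    pat_mono (by simp only [E]; intros; omega) (colorCycle_mem_pat (by omega) (by omega) s)
  have h3 : colorCycle n p (p + a) s ∈ pat F E :=
    pat_mono (by simp only [E]; intros; omega) (colorCycle_mem_pat (by omega) (by omega) s)
  have h4 : colorCycle n (p + a) q t ∈ pat F E :=
    pat_mono (by simp only [E]; intros; omega) (colorCycle_mem_pat (by omega) (by omega) t)
  have e : ∀ x y, x ∈ pat F E → y ∈ pat F E → g * (x * (y * w)) = (x * y) * (g * w) := by
    intro x y hx hy
    rw [← mul_assoc (x * y), hgx _ (mul_mem_pat hE hx hy)]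
    simp only [mul_assoc]
  rw [e _ _ h1 h2, e _ _ h3 h4, key _ (mul_mem_pat hE h1 h2), hσmul]
  simp only [σ]
  rw [glPerm_conj_glTranspose_colorCycle (p := p) (q := q) (by omega) (by omega) le_rfl hn hπ,
    glPerm_conj_glTranspose_colorCycle (p := p) (q := q) le_rfl (by omega) (by omega) hn hπ]
  have e1 : p + q - q = p := by omega
  have e2 : p + q - (p + b) = p + a := by omega
  have e3 : p + q - p = q := by omega
  rw [e1, e2, e3]

omit [Fintype F] [DecidableEq F] in
theorem colorSize_cons (x : ℕ × Fˣ) (L : List (ℕ × Fˣ)) : colorSize (x :: L) = x.1 + colorSize L := by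
  simp [colorSize]

omit [Fintype F] [DecidableEq F] in
theorem colorSize_perm {L L' : List (ℕ × Fˣ)} (h : L.Perm L') : colorSize L = colorSize L' :=
  (h.map Prod.fst).sum_eq

theorem cosetSum_colorWord_perm {l : ℕ} {f : GL (Fin n) F → ℂ} (hf : ∀ g x, f (x * g * x⁻¹) = f g)
    {L L' : List (ℕ × Fˣ)} (h : L.Perm L') (hL : ∀ x ∈ L, 1 ≤ x.1) (hs : colorSize L + l ≤ n) :
    ∀ g ∈ pat F (fun i j : Fin n => i.val < n - colorSize L ∧ j.val < n - colorSize L),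
      cosetSum l f (g * colorWord n L) = cosetSum l f (g * colorWord n L') := by
  induction h with
  | nil => exact fun _ _ => rfl
  | @cons x L L' h ih =>
    intro g hg
    rw [colorSize_cons] at hs hg
    have hx := hL x (by simp)
    rw [colorWord, colorWord, ← colorSize_perm h, ← mul_assoc, ← mul_assoc]
    refine ih (fun y hy => hL y (by simp [hy])) (by omega) _
      (mul_mem_pat (by intros; omega) (pat_mono ?_ hg)
        (pat_mono ?_ (colorCycle_mem_pat (by omega) (by omega) _)))
    · intros; omega
    · intros; omega
  | @swap x y L =>
    intro g hg
    rw [colorSize_cons, colorSize_cons] at hs hg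
    have hx := hL x (by simp)
    have hy := hL y (by simp)
    have hw := colorWord_mem_pat (n := n) (L := L) (fun z hz => hL z (by simp [hz])) (by omega)
    simp only [colorWord, colorSize_cons]
    obtain ⟨p, hp⟩ : ∃ p, p = n - colorSize L - x.1 - y.1 := ⟨_, rfl⟩
    have e1 : n - colorSize L = p + x.1 + y.1 := by omega
    have e2 : n - (x.1 + colorSize L) = p + y.1 := by omega
    have e3 : n - (y.1 + colorSize L) = p + x.1 := by omega
    have e4 : p + x.1 + y.1 - x.1 = p + y.1 := by omega
    have e5 : p + x.1 + y.1 - y.1 = p + x.1 := by omega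
    have e6 : p + y.1 - y.1 = p := by omega
    have e7 : p + x.1 - x.1 = p := by omega
    rw [e1] at hw
    rw [e1, e2, e3, e4, e5, e6, e7]
    exact cosetSum_swap hf (by omega) hx hy (by omega) x.2 y.2 (pat_mono (by intros; omega) hg) hw
  | trans h1 h2 ih1 ih2 =>
    intro g hg
    rw [ih1 hL hs g hg]
    exact ih2 (fun x hx => hL x (h1.mem_iff.mpr hx)) (colorSize_perm h1 ▸ hs) g
      (colorSize_perm h1 ▸ hg)

end Swap

section Count

theorem card_weight_le {ι : Type} [Fintype ι] [DecidableEq ι] (n : ℕ) {x : ℝ} (h0 : 0 < x) (h1 : x < 1) :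
    ((Finset.univ.filter fun c : Fin n × ι → Fin (n + 1) =>
        ∑ b, (b.1.val + 1) * (c b).val ≤ n).card : ℝ) * x ^ n ≤
      Real.exp (Fintype.card ι * (x / (1 - x) ^ 2)) := by
  have hx : 0 < 1 - x := by linarith
  have hgeom : ∀ b : ℕ, ∑ k : Fin (n + 1), x ^ ((b + 1) * k.val) ≤
      Real.exp (x ^ (b + 1) / (1 - x)) := by
    intro b
    have hy0 : 0 < x ^ (b + 1) := pow_pos h0 _
    have hyx : x ^ (b + 1) ≤ x := pow_le_of_le_one h0.le h1.le (by omega)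
    have hy1 : 0 < 1 - x ^ (b + 1) := by linarith
    calc ∑ k : Fin (n + 1), x ^ ((b + 1) * k.val) = ∑ k ∈ Finset.range (n + 1), (x ^ (b + 1)) ^ k := by
          rw [Finset.sum_range]
          simp only [pow_mul]
      _ ≤ (1 - x ^ (b + 1))⁻¹ := by
          rw [← tsum_geometric_of_lt_one hy0.le (by linarith)]
          exact (summable_geometric_of_lt_one hy0.le (by linarith)).sum_le_tsum _
            (fun _ _ => by positivity)
      _ = 1 + x ^ (b + 1) / (1 - x ^ (b + 1)) := by field_simp; ring
      _ ≤ 1 + x ^ (b + 1) / (1 - x) := by gcongr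
      _ ≤ _ := by linarith [Real.add_one_le_exp (x ^ (b + 1) / (1 - x))]
  have hsum : ∑ b : Fin n, x ^ (b.val + 1) ≤ x / (1 - x) := by
    rw [← Finset.sum_range fun b => x ^ (b + 1)]
    simp only [pow_succ', ← Finset.mul_sum]
    rw [div_eq_mul_inv, ← tsum_geometric_of_lt_one h0.le h1]
    exact mul_le_mul_of_nonneg_left ((summable_geometric_of_lt_one h0.le h1).sum_le_tsum _
      (fun _ _ => by positivity)) h0.le
  calc ((Finset.univ.filter fun c : Fin n × ι → Fin (n + 1) =>
        ∑ b, (b.1.val + 1) * (c b).val ≤ n).card : ℝ) * x ^ n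
      = ∑ c ∈ (Finset.univ.filter fun c : Fin n × ι → Fin (n + 1) =>
        ∑ b, (b.1.val + 1) * (c b).val ≤ n), x ^ n := by simp
    _ ≤ ∑ c ∈ (Finset.univ.filter fun c : Fin n × ι → Fin (n + 1) =>
        ∑ b, (b.1.val + 1) * (c b).val ≤ n), ∏ b, x ^ ((b.1.val + 1) * (c b).val) := by
        refine Finset.sum_le_sum fun c hc => ?_
        rw [Finset.prod_pow_eq_pow_sum]
        exact pow_le_pow_of_le_one h0.le h1.le (Finset.mem_filter.mp hc).2
    _ ≤ ∑ c : Fin n × ι → Fin (n + 1), ∏ b, x ^ ((b.1.val + 1) * (c b).val) :=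
        Finset.sum_le_sum_of_subset_of_nonneg (Finset.filter_subset _ _)
          (fun _ _ _ => Finset.prod_nonneg fun _ _ => by positivity)
    _ = ∏ b : Fin n × ι, ∑ k : Fin (n + 1), x ^ ((b.1.val + 1) * k.val) := by
        rw [Finset.prod_univ_sum, Fintype.piFinset_univ]
    _ ≤ ∏ b : Fin n × ι, Real.exp (x ^ (b.1.val + 1) / (1 - x)) :=
        Finset.prod_le_prod (fun _ _ => Finset.sum_nonneg fun _ _ => by positivity)
          fun b _ => hgeom b.1
    _ = Real.exp (∑ b : Fin n × ι, x ^ (b.1.val + 1) / (1 - x)) := (Real.exp_sum _ _).symm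
    _ ≤ _ := by
        refine Real.exp_le_exp.mpr ?_
        rw [Fintype.sum_prod_type]
        simp only [Finset.sum_const, Finset.card_univ, nsmul_eq_mul, ← Finset.mul_sum,
          ← Finset.sum_div]
        refine mul_le_mul_of_nonneg_left ?_ (Nat.cast_nonneg _)
        rw [pow_two, ← div_div]
        gcongr

variable {F : Type} [Field F] [Fintype F] [DecidableEq F] {n : ℕ}

theorem colorSize_eq_sum {L : List (ℕ × Fˣ)} (hL : ∀ x ∈ L, 1 ≤ x.1 ∧ x.1 ≤ n) :
    colorSize L = ∑ b : Fin n × Fˣ, (b.1.val + 1) * L.count (b.1.val + 1, b.2) := by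
  induction L with
  | nil => simp [colorSize]
  | cons x L ih =>
    obtain ⟨a, t⟩ := x
    have hx := hL (a, t) (by simp)
    rw [colorSize_cons, ih fun y hy => hL y (by simp [hy])]
    simp only [List.count_cons, mul_add, Finset.sum_add_distrib, add_comm a]
    congr 1
    rw [Finset.sum_eq_single (⟨⟨a - 1, by simp at hx; omega⟩, t⟩ : Fin n × Fˣ)]
    · have : a - 1 + 1 = a := by simp at hx; omega
      simp [this]
    · rintro ⟨b, s⟩ - hne
      have : ((a, t) == (b.val + 1, s)) = false := by
        simp only [beq_eq_false_iff_ne, ne_eq, Prod.mk.injEq, not_and]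
        rintro h rfl
        exact hne (Prod.ext (Fin.ext (by simp; omega)) rfl)
      simp [this]
    · simp

omit [Fintype F] [DecidableEq F] in
theorem le_colorSize {L : List (ℕ × Fˣ)} {x : ℕ × Fˣ} (h : x ∈ L) : x.1 ≤ colorSize L :=
  List.le_sum_of_mem (List.mem_map_of_mem h)

theorem card_le_of_sum_upperRel_ne_zero {l : ℕ} (hl : 0 < l) (hln : l ≤ n)
    {B : Finset (GL (Fin n) F → ℂ)}
    (hB : ∀ χ ∈ B, IsIrrChar χ ∧ ∑ r ∈ pat F (UpperRel n l), χ r ≠ 0) :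
    B.card ≤ Fintype.card F ^ (l * l) * (Finset.univ.filter fun c : Fin n × Fˣ → Fin (n + 1) =>
        ∑ b, (b.1.val + 1) * (c b).val ≤ n).card := by
  classical
  set T := Finset.univ.filter fun c : Fin n × Fˣ → Fin (n + 1) =>
        ∑ b, (b.1.val + 1) * (c b).val ≤ n with hT
  set P := pat F (fun a b : Fin n => a.val < l ∧ b.val < l) with hP
  have hPcard : P.card ≤ Fintype.card F ^ (l * l) := by
    let e : GL (Fin n) F → (Fin l → Fin l → F) := fun g a b => g.1 (a.castLE hln) (b.castLE hln)
    have he : Set.InjOn e P := by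
      intro x hx y hy hxy
      rw [hP, Finset.mem_coe, mem_pat] at hx hy
      refine Units.ext (Matrix.ext fun a b => ?_)
      by_cases h : a.val < l ∧ b.val < l
      · exact congrFun (congrFun hxy ⟨a, h.1⟩) ⟨b, h.2⟩
      · rw [hx a b h, hy a b h]
    calc P.card ≤ (Finset.univ : Finset (Fin l → Fin l → F)).card :=
          Finset.card_le_card_of_injOn e (fun _ _ => by simp) he
      _ = _ := by simp [pow_mul]
  let Val : (Fin n × Fˣ → Fin (n + 1)) → List (ℕ × Fˣ) → Prop := fun c L =>
    (∀ x ∈ L, 1 ≤ x.1) ∧ colorSize L + l ≤ n ∧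
      ∀ b : Fin n × Fˣ, L.count (b.1.val + 1, b.2) = (c b).val
  let rep : (Fin n × Fˣ → Fin (n + 1)) → List (ℕ × Fˣ) := fun c =>
    if h : ∃ L, Val c L then h.choose else []
  let pt : P × T → GL (Fin n) F := fun x =>
    x.1.1 * (colorCycle n (l - 1) (n - colorSize (rep x.2.1)) 1 * colorWord n (rep x.2.1))
  let Φ : (B → ℂ) →ₗ[ℂ] (P × T → ℂ) :=
    LinearMap.pi fun x => ∑ χ : B, cosetSum l χ.1 (pt x) • LinearMap.proj χ
  have hΦ : ∀ a x, Φ a x = ∑ χ : B, cosetSum l χ.1 (pt x) * a χ := fun a x => by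
    simp [Φ]
  have hinj : Function.Injective Φ := by
    rw [injective_iff_map_eq_zero]
    intro a ha
    let a' : (GL (Fin n) F → ℂ) → ℂ := fun χ => if h : χ ∈ B then a ⟨χ, h⟩ else 0
    have ha' : ∀ χ : B, a' χ.1 = a χ := fun χ => by simp [a']
    let f : GL (Fin n) F → ℂ := fun g => ∑ χ ∈ B, a' χ * χ g
    have hf : ∀ g x, f (x * g * x⁻¹) = f g := fun g x =>
      Finset.sum_congr rfl fun χ hχ => by rw [(hB χ hχ).1.conj]
    have hpt : ∀ x, cosetSum l f (pt x) = 0 := by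
      intro x
      have := congrFun ha x
      rw [hΦ] at this
      rw [Pi.zero_apply] at this
      rw [← this, cosetSum]
      simp only [f]
      rw [Finset.sum_comm, ← Finset.sum_coe_sort B]
      refine Finset.sum_congr rfl fun χ _ => ?_
      rw [← Finset.mul_sum, ha', cosetSum, _root_.mul_comm]
    have hzero := cosetSum_eq_zero_of_colorWord hf hl hln (by
      intro L hL hs h hh
      have hle : ∀ x ∈ L, 1 ≤ x.1 ∧ x.1 ≤ n := fun x hx =>
        ⟨hL x hx, (le_colorSize hx).trans (by omega)⟩
      have hcs := colorSize_eq_sum hle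
      have hlt : ∀ b : Fin n × Fˣ, L.count (b.1.val + 1, b.2) < n + 1 := by
        intro b
        have : (b.1.val + 1) * L.count (b.1.val + 1, b.2) ≤ colorSize L := by
          rw [hcs]
          exact Finset.single_le_sum (f := fun b : Fin n × Fˣ =>
            (b.1.val + 1) * L.count (b.1.val + 1, b.2)) (fun _ _ => Nat.zero_le _) (Finset.mem_univ b)
        nlinarith
      let c : Fin n × Fˣ → Fin (n + 1) := fun b => ⟨_, hlt b⟩
      have hcT : c ∈ T := by
        rw [hT, Finset.mem_filter]
        exact ⟨Finset.mem_univ _, by rw [← hcs]; omega⟩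
      have hex : ∃ L, Val c L := ⟨L, hL, hs, fun _ => rfl⟩
      have hrep : rep c = hex.choose := dif_pos hex
      obtain ⟨hR, hRs, hRc⟩ : Val c (rep c) := hrep ▸ hex.choose_spec
      have hperm : L.Perm (rep c) := by
        rw [List.perm_iff_count]
        rintro ⟨a, t⟩
        by_cases hab : 1 ≤ a ∧ a ≤ n
        · obtain ⟨b, rfl⟩ : ∃ b, a = b + 1 := ⟨a - 1, by omega⟩
          exact (hRc (⟨b, by omega⟩, t)).symm
        · rw [List.count_eq_zero_of_not_mem fun h => hab (hle _ h),
            List.count_eq_zero_of_not_mem fun h => hab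
              ⟨hR _ h, (le_colorSize h).trans (by omega)⟩]
      have hG : h * colorCycle n (l - 1) (n - colorSize L) 1 ∈
          pat F (fun i j : Fin n => i.val < n - colorSize L ∧ j.val < n - colorSize L) :=
        mul_mem_pat (by intros; omega) (pat_mono (by intros; omega) hh)
          (pat_mono (by intros; omega) (colorCycle_mem_pat (by omega) (by omega) _))
      rw [← mul_assoc, cosetSum_colorWord_perm hf hperm hL hs _ hG, mul_assoc, colorSize_perm hperm]
      exact hpt (⟨h, hh⟩, ⟨c, hcT⟩))
    have := IsIrrChar.eq_zero_of_sum_translates_eq_zero B (pat F (UpperRel n l)) hB a' hzero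
    funext χ
    rw [← ha', this χ.1 χ.2, Pi.zero_apply]
  have hfin := LinearMap.finrank_le_finrank_of_injective hinj
  simp only [Module.finrank_fintype_fun_eq_card, Fintype.card_coe, Fintype.card_prod] at hfin
  exact hfin.trans (Nat.mul_le_mul_right _ hPcard)

end Count

section TwoAdic

theorem IsConj.card_mul_dvd {G K : Type} [Group G] [Group K] [Finite G] (φ : K →* G)
    (hφ : Function.Injective φ) {g : G} (hg : ∀ k, φ k * g = g * φ k) {C : Finset G}
    (hC : ∀ x, x ∈ C ↔ IsConj g x) : C.card * Nat.card K ∣ Nat.card G := by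
  have hcard : (MulAction.stabilizer (ConjAct G) g).index = C.card := by
    rw [MulAction.index_stabilizer, ← Set.ncard_coe_finset]
    congr 1
    ext x
    rw [ConjAct.mem_orbit_conjAct, isConj_comm, Finset.mem_coe, hC]
  let ψ : K →* MulAction.stabilizer (ConjAct G) g :=
    ((ConjAct.toConjAct (G := G)).toMonoidHom.comp φ).codRestrict _ fun k => by
      rw [MulAction.mem_stabilizer_iff]
      simp [ConjAct.smul_def, hg]
  have hψ : Function.Injective ψ := fun x y h =>
    hφ (ConjAct.toConjAct.injective (congrArg Subtype.val h))
  have e : Nat.card (ConjAct G) = Nat.card G := rfl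
  rw [← e, ← Subgroup.card_mul_index (MulAction.stabilizer (ConjAct G) g), hcard, _root_.mul_comm]
  exact Nat.mul_dvd_mul_right (Subgroup.card_dvd_of_injective ψ hψ) _

theorem padicValNat_finset_prod {ι : Type} (p : ℕ) [Fact p.Prime] (s : Finset ι) {f : ι → ℕ}
    (hf : ∀ i ∈ s, f i ≠ 0) : padicValNat p (∏ i ∈ s, f i) = ∑ i ∈ s, padicValNat p (f i) := by
  classical
  induction s using Finset.induction_on with
  | empty => simp
  | insert a s ha ih =>
    rw [Finset.prod_insert ha, Finset.sum_insert ha,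
      padicValNat.mul (hf a (by simp)) (Finset.prod_ne_zero_iff.mpr fun i hi => hf i (by simp [hi])),
      ih fun i hi => hf i (by simp [hi])]

theorem padicValNat_pow_sub_one_le {q j : ℕ} (hq : Odd q) (hq1 : 1 < q) (hj : j ≠ 0) :
    padicValNat 2 (q ^ j - 1) ≤ padicValNat 2 (q + 1) + padicValNat 2 (q - 1) + Nat.log 2 j := by
  have h1 : 1 < q ^ j := Nat.one_lt_pow hj hq1
  have h2 : padicValNat 2 (q ^ j - 1) ≤ padicValNat 2 (q ^ (2 * j) - 1) := by
    have : q ^ (2 * j) - 1 = (q ^ j - 1) * (q ^ j + 1) := by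
      rw [_root_.mul_comm 2, pow_mul, _root_.mul_comm]
      exact Nat.sq_sub_sq (q ^ j) 1
    rw [this, padicValNat.mul (by omega) (by omega)]
    omega
  have h3 := padicValNat.pow_two_sub_one hq1 (by rwa [← even_iff_two_dvd, Nat.not_even_iff_odd])
    (n := 2 * j) (by omega) (by simp)
  rw [padicValNat.mul (by omega) hj, padicValNat.self (by omega)] at h3
  have := padicValNat_le_nat_log (p := 2) j
  omega

variable {F : Type} [Field F] [Fintype F] [DecidableEq F]

omit [DecidableEq F] in
theorem padicValNat_card_GL (hq : Odd (Fintype.card F)) (n : ℕ) :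
    padicValNat 2 (Nat.card (GL (Fin n) F)) =
      ∑ j ∈ Finset.range n, padicValNat 2 (Fintype.card F ^ (j + 1) - 1) := by
  have hq1 : 1 < Fintype.card F := Fintype.one_lt_card
  rw [Matrix.card_GL_field, ← Finset.prod_range fun i => Fintype.card F ^ n - Fintype.card F ^ i,
    padicValNat_finset_prod, ← Finset.sum_range_reflect]
  · refine Finset.sum_congr rfl fun i hi => ?_
    have hin := Finset.mem_range.mp hi
    have : Fintype.card F ^ n - Fintype.card F ^ (n - 1 - i) =
        Fintype.card F ^ (n - 1 - i) * (Fintype.card F ^ (i + 1) - 1) := by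
      rw [Nat.mul_sub, ← pow_add, mul_one]
      congr 2
      omega
    have h1 : 1 < Fintype.card F ^ (i + 1) := Nat.one_lt_pow (by omega) hq1
    rw [this, padicValNat.mul (by positivity) (by omega), padicValNat.eq_zero_of_not_dvd, zero_add]
    rw [← even_iff_two_dvd, Nat.not_even_iff_odd]
    exact hq.pow
  · intro i hi
    have := Nat.pow_lt_pow_right hq1 (Finset.mem_range.mp hi)
    omega

omit [Fintype F] [DecidableEq F] in
theorem exists_hom_commute_glEmbed {n₀ n : ℕ} (h : n₀ ≤ n) (g : GL (Fin n₀) F) :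
    ∃ φ : GL (Fin (n - n₀)) F →* GL (Fin n) F, Function.Injective φ ∧
      ∀ k, φ k * glEmbed F h g = glEmbed F h g * φ k := by
  set e : Fin n₀ ⊕ Fin (n - n₀) ≃ Fin n := finSumFinEquiv.trans (finCongr (Nat.add_sub_cancel' h))
  let ψ : Matrix (Fin (n - n₀)) (Fin (n - n₀)) F →*
      Matrix (Fin n₀ ⊕ Fin (n - n₀)) (Fin n₀ ⊕ Fin (n - n₀)) F :=
    { toFun := fun y => Matrix.fromBlocks 1 0 0 y
      map_one' := Matrix.fromBlocks_one
      map_mul' := fun x y => by simp [Matrix.fromBlocks_multiply] }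
  refine ⟨Units.map ((Matrix.reindexAlgEquiv F F e).toRingEquiv.toMonoidHom.comp ψ), ?_, ?_⟩
  · refine Units.map_injective fun x y hxy => ?_
    have : ψ x = ψ y := (Matrix.reindexAlgEquiv F F e).injective hxy
    exact (Matrix.fromBlocks_inj.mp this).2.2.2
  · intro k
    refine Units.ext ?_
    have : ψ k.1 * Matrix.fromBlocks g.val 0 0 1 = Matrix.fromBlocks g.val 0 0 1 * ψ k.1 := by
      simp [ψ, Matrix.fromBlocks_multiply]
    have h' := congrArg (Matrix.reindexAlgEquiv F F e) this
    rw [map_mul, map_mul] at h'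
    exact h'

theorem exists_card_conjClass_dvd (hq : Odd (Fintype.card F)) {n₀ n : ℕ} (h : n₀ ≤ n)
    (g : GL (Fin n₀) F) : ∃ N : ℕ,
      (∀ C : Finset (GL (Fin n) F), (∀ x, x ∈ C ↔ IsConj (glEmbed F h g) x) → C.card ∣ N) ∧
      ¬ 2 ^ (n₀ * (padicValNat 2 (Fintype.card F + 1) + padicValNat 2 (Fintype.card F - 1) +
        Nat.log 2 n) + 1) ∣ N := by
  classical
  obtain ⟨φ, hφ, hcomm⟩ := exists_hom_commute_glEmbed h g
  have hpos : 0 < Nat.card (GL (Fin (n - n₀)) F) := Nat.card_pos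
  have hposn : 0 < Nat.card (GL (Fin n) F) := Nat.card_pos
  have hdvd : ∀ C : Finset (GL (Fin n) F), (∀ x, x ∈ C ↔ IsConj (glEmbed F h g) x) →
      C.card * Nat.card (GL (Fin (n - n₀)) F) ∣ Nat.card (GL (Fin n) F) := fun C hC =>
    IsConj.card_mul_dvd φ hφ hcomm hC
  obtain ⟨N, hN⟩ : Nat.card (GL (Fin (n - n₀)) F) ∣ Nat.card (GL (Fin n) F) :=
    (Dvd.intro_left _ rfl).trans
      (hdvd (Finset.univ.filter (IsConj (glEmbed F h g))) (by simp))
  have hN0 : N ≠ 0 := by rintro rfl; omega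
  refine ⟨N, fun C hC => ?_, fun hd => ?_⟩
  · have := hdvd C hC
    rw [hN, _root_.mul_comm] at this
    exact Nat.dvd_of_mul_dvd_mul_left hpos this
  · rw [padicValNat_dvd_iff_le hN0] at hd
    have h1 := congrArg (padicValNat 2) hN
    rw [padicValNat.mul hpos.ne' hN0, padicValNat_card_GL hq, padicValNat_card_GL hq] at h1
    obtain ⟨k, rfl⟩ : ∃ k, n = k + n₀ := ⟨n - n₀, by omega⟩
    rw [Nat.add_sub_cancel, Finset.sum_range_add] at h1
    have h2 : ∑ x ∈ Finset.range n₀, padicValNat 2 (Fintype.card F ^ (k + x + 1) - 1) ≤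
        n₀ * (padicValNat 2 (Fintype.card F + 1) + padicValNat 2 (Fintype.card F - 1) +
        Nat.log 2 (k + n₀)) := by
      refine (Finset.sum_le_card_nsmul _ _ (padicValNat 2 (Fintype.card F + 1) +
        padicValNat 2 (Fintype.card F - 1) + Nat.log 2 (k + n₀)) fun x hx => ?_).trans (by simp)
      refine (padicValNat_pow_sub_one_le hq Fintype.one_lt_card (by omega)).trans ?_
      have := Finset.mem_range.mp hx
      exact Nat.add_le_add_left (Nat.log_mono_right (by omega)) _
    omega

end TwoAdic

section RealClasses

theorem Polynomial.exists_charpoly_eq {F : Type} [Field F] {k : ℕ} {f : Polynomial F}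
    (hf : f.Monic) (hk : f.natDegree = k) : ∃ Y : Matrix (Fin k) (Fin k) F, Y.charpoly = f := by
  subst hk
  let pb := AdjoinRoot.powerBasis' hf
  refine ⟨Matrix.reindex (finCongr (AdjoinRoot.powerBasis'_dim hf))
    (finCongr (AdjoinRoot.powerBasis'_dim hf)) (Algebra.leftMulMatrix pb.basis pb.gen), ?_⟩
  rw [Matrix.charpoly_reindex, charpoly_leftMulMatrix]
  exact AdjoinRoot.minpoly_powerBasis_gen_of_monic hf

theorem Matrix.exists_injective_charpoly (F : Type) [Field F] (k : ℕ) :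
    ∃ Y : (Fin k → F) → Matrix (Fin k) (Fin k) F,
      Function.Injective fun v => (Y v).charpoly := by
  have h : ∀ v : Fin k → F, ∃ Y : Matrix (Fin k) (Fin k) F,
      Y.charpoly = Polynomial.X ^ k + ((Polynomial.degreeLTEquiv F k).symm v).1 := fun v => by
    have hd : (((Polynomial.degreeLTEquiv F k).symm v).1).degree < k :=
      Polynomial.mem_degreeLT.mp ((Polynomial.degreeLTEquiv F k).symm v).2
    exact Polynomial.exists_charpoly_eq (Polynomial.monic_X_pow_add hd)
      (Polynomial.natDegree_eq_of_degree_eq_some (by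
        rw [Polynomial.degree_add_eq_left_of_degree_lt (by simpa using hd), Polynomial.degree_X_pow]))
  choose Y hY using h
  refine ⟨Y, fun v w hvw => ?_⟩
  simp only [hY] at hvw
  exact (Polynomial.degreeLTEquiv F k).symm.injective (Subtype.ext (add_left_cancel hvw))

variable {F : Type} [Field F]

/-- A unit of order dividing two. -/
def unitOfMulSelf {R : Type} [Monoid R] (a : R) (h : a * a = 1) : Rˣ := ⟨a, a, h, h⟩

theorem exists_real_elements (k r : ℕ) :
    ∃ x : (Fin k → F) → GL ((Fin k ⊕ Fin k) ⊕ Fin r) F,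
      (∀ v w, IsConj (x v) (x w) → v = w) ∧ ∀ v, IsConj (x v) (x v)⁻¹ := by
  obtain ⟨Y, hY⟩ := Matrix.exists_injective_charpoly F k
  let a : Matrix ((Fin k ⊕ Fin k) ⊕ Fin r) ((Fin k ⊕ Fin k) ⊕ Fin r) F :=
    fromBlocks (fromBlocks 1 0 1 (-1)) 0 0 1
  let b : (Fin k → F) → Matrix ((Fin k ⊕ Fin k) ⊕ Fin r) ((Fin k ⊕ Fin k) ⊕ Fin r) F := fun v =>
    fromBlocks (fromBlocks 1 (Y v - 2) 0 (-1)) 0 0 1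
  have ha : a * a = 1 := by
    simp [a, fromBlocks_multiply, ← fromBlocks_one]
  have hb : ∀ v, b v * b v = 1 := fun v => by
    simp [b, fromBlocks_multiply, ← fromBlocks_one]
  have hsum : ∀ v, a * b v + b v * a = fromBlocks (fromBlocks (Y v) 0 0 (Y v)) 0 0 2 := fun v => by
    simp only [a, b, fromBlocks_multiply, fromBlocks_add]
    simp
    refine ⟨?_, one_add_one_eq_two⟩
    rw [fromBlocks_add, fromBlocks_inj, ← one_add_one_eq_two]
    refine ⟨?_, ?_, ?_, ?_⟩ <;> abel
  let A := unitOfMulSelf a ha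
  let B := fun v => unitOfMulSelf (b v) (hb v)
  refine ⟨fun v => A * B v, fun v w hvw => ?_, fun v => isConj_iff.mpr ⟨A⁻¹, ?_⟩⟩
  · obtain ⟨c, hc⟩ := isConj_iff.mp hvw
    have hinv : ∀ v, (A * B v)⁻¹.1 = b v * a := fun _ => rfl
    have h1 : c.1 * (a * b v) * (c⁻¹).1 = a * b w := congrArg Units.val hc
    have h2 : c.1 * (b v * a) * (c⁻¹).1 = b w * a := by
      have : c * (A * B v)⁻¹ * c⁻¹ = (A * B w)⁻¹ := by
        rw [show A * B w = c * (A * B v) * c⁻¹ from hc.symm]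
        group
      exact congrArg Units.val this
    have h3 : c.1 * (a * b v + b v * a) * (c⁻¹).1 = a * b w + b w * a := by
      rw [Matrix.mul_add, Matrix.add_mul, h1, h2]
    have h4 := congrArg Matrix.charpoly h3
    rw [Matrix.coe_units_inv, Matrix.charpoly_units_conj, hsum, hsum] at h4
    simp only [Matrix.charpoly_fromBlocks_zero₁₂] at h4
    have h5 := mul_right_cancel₀ (Matrix.charpoly_monic _).ne_zero h4
    rw [← pow_two, ← pow_two] at h5
    refine hY ?_
    rcases sq_eq_sq_iff_eq_or_eq_neg.mp h5 with h | h
    · exact h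
    · have e : (1 : F) = -1 := by
        have := congrArg Polynomial.leadingCoeff h
        rwa [Polynomial.leadingCoeff_neg, (Matrix.charpoly_monic _).leadingCoeff,
          (Matrix.charpoly_monic _).leadingCoeff] at this
      change (Y v).charpoly = (Y w).charpoly
      rw [h, ← neg_one_mul, ← Polynomial.C_1, ← Polynomial.C_neg, ← e, Polynomial.C_1, one_mul]
  · simp only [_root_.mul_inv_rev, inv_inv, inv_mul_cancel_left]
    rfl

end RealClasses

section Limit

variable {F : Type} [Field F] [Fintype F] [DecidableEq F]

theorem pow_half_le_card_selfDual (n : ℕ) :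
    Fintype.card F ^ (n / 2) ≤
      Nat.card {χ : GL (Fin n) F → ℂ // IsIrrChar χ ∧ ∀ x, χ x⁻¹ = χ x} := by
  obtain ⟨x, hx, hreal⟩ := exists_real_elements (F := F) (n / 2) (n - (n / 2 + n / 2))
  let e : (Fin (n / 2) ⊕ Fin (n / 2)) ⊕ Fin (n - (n / 2 + n / 2)) ≃ Fin n :=
    (Equiv.sumCongr finSumFinEquiv (Equiv.refl _)).trans
      (finSumFinEquiv.trans (finCongr (by omega)))
  let E : GL ((Fin (n / 2) ⊕ Fin (n / 2)) ⊕ Fin (n - (n / 2 + n / 2))) F ≃* GL (Fin n) F :=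
    Units.mapEquiv (Matrix.reindexAlgEquiv F F e).toRingEquiv.toMulEquiv
  have h := card_le_card_selfDual (fun v => E (x v))
    (fun v w hvw => hx v w (by
      have := E.symm.toMonoidHom.map_isConj hvw
      simpa using this))
    (fun v => by
      have := E.toMonoidHom.map_isConj (hreal v)
      simpa using this)
  simpa using h

omit [DecidableEq F] in
theorem two_ne_zero_of_odd_card (hq : Odd (Fintype.card F)) : (2 : F) ≠ 0 := fun h => by
  have : CharP F 2 := CharTwo.of_one_ne_zero_of_two_eq_zero one_ne_zero h
  obtain ⟨k, -, hk⟩ := FiniteField.card F 2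
  rw [hk] at hq
  exact (Nat.not_odd_iff_even.mpr ((even_two).pow_of_ne_zero k.ne_zero)) hq

theorem card_not_isIntegral_le (hq : Odd (Fintype.card F)) {n₀ n m l : ℕ} (h : n₀ ≤ n)
    (g : GL (Fin n₀) F) (hln : l ≤ n)
    (hl : l = 2 * (n₀ * (padicValNat 2 (Fintype.card F + 1) + padicValNat 2 (Fintype.card F - 1) +
      Nat.log 2 n) + m) + 1) :
    Nat.card {χ : GL (Fin n) F → ℂ // IsIrrChar χ ∧
        ¬ IsIntegral ℤ (χ (glEmbed F h g) / (2 ^ m : ℂ))} ≤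
      Fintype.card F ^ (l * l) * (Finset.univ.filter fun c : Fin n × Fˣ → Fin (n + 1) =>
        ∑ b, (b.1.val + 1) * (c b).val ≤ n).card := by
  have hfin : {χ : GL (Fin n) F → ℂ | IsIrrChar χ ∧
      ¬ IsIntegral ℤ (χ (glEmbed F h g) / (2 ^ m : ℂ))}.Finite :=
    finite_setOf_isIrrChar.subset fun _ h => h.1
  obtain ⟨N, hN, hb⟩ := exists_card_conjClass_dvd hq h g
  have key := card_le_of_sum_upperRel_ne_zero (F := F) (n := n) (l := l) (by omega) hln
    (B := hfin.toFinset) (fun χ hχ => by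
      rw [Set.Finite.mem_toFinset] at hχ
      obtain ⟨hχ, hint⟩ := hχ
      obtain ⟨d, hd, -⟩ := hχ.exists_dim
      refine ⟨hχ, hχ.sum_upperRel_ne_zero (two_ne_zero_of_odd_card hq) hd (c := n₀ *
        (padicValNat 2 (Fintype.card F + 1) + padicValNat 2 (Fintype.card F - 1) + Nat.log 2 n) + m)
        (fun ⟨d', hd'⟩ => hint ?_) (by omega)⟩
      exact hχ.isIntegral_div_two_pow _ N _ m hN hb ⟨d', by rw [hd, hd']⟩)
  rwa [← Set.ncard_eq_toFinset_card _ hfin, ← Nat.card_coe_set_eq] at key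

theorem eventually_sq_log_le (a b : ℕ) :
    ∀ᶠ n : ℕ in atTop, ((a + b * Nat.log 2 n : ℕ) : ℝ) ^ 2 ≤ 2 * a ^ 2 + n / 8 := by
  have h := ((Real.isLittleO_pow_log_id_atTop (n := 2)).const_mul_left
    (2 * (b / Real.log 2) ^ 2)).def (show (0 : ℝ) < 1 / 8 by norm_num)
  have h' := (tendsto_natCast_atTop_atTop (R := ℝ)).eventually h
  filter_upwards [h'] with n hn
  have hlog : (0 : ℝ) < Real.log 2 := Real.log_pos (by norm_num)
  have h1 : (Nat.log 2 n : ℝ) ≤ Real.log n / Real.log 2 := by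
    simpa [Real.logb] using Real.natLog_le_logb n 2
  rw [Real.norm_of_nonneg (by positivity), id, Real.norm_of_nonneg (by positivity)] at hn
  have h2 : (b * Nat.log 2 n : ℝ) ^ 2 ≤ (b / Real.log 2) ^ 2 * Real.log n ^ 2 := by
    rw [← mul_pow]
    refine pow_le_pow_left₀ (by positivity) ?_ 2
    calc (b * Nat.log 2 n : ℝ) ≤ b * (Real.log n / Real.log 2) := by gcongr
      _ = _ := by ring
  push_cast
  nlinarith [sq_nonneg ((a : ℝ) - b * Nat.log 2 n)]

theorem eventually_card_not_isIntegral_le (hq : Odd (Fintype.card F)) {n₀ : ℕ}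
    (g : GL (Fin n₀) F) (m : ℕ) :
    ∃ K L : ℝ, ∀ᶠ n : ℕ in atTop, ∀ h : n₀ ≤ n,
      (Nat.card {χ : GL (Fin n) F → ℂ // IsIrrChar χ ∧
        ¬ IsIntegral ℤ (χ (glEmbed F h g) / (2 ^ m : ℂ))} : ℝ) /
      Nat.card {χ : GL (Fin n) F → ℂ // IsIrrChar χ ∧ ∀ x, χ x⁻¹ = χ x} ≤
      K * (Fintype.card F : ℝ) ^ (L - n / 8) := by
  set q := Fintype.card F with hqdef
  have hq1 : (1 : ℝ) < q := by exact_mod_cast (Fintype.one_lt_card : 1 < Fintype.card F)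
  have hq0 : (0 : ℝ) < q := by linarith
  set A := padicValNat 2 (q + 1) + padicValNat 2 (q - 1) with hA
  set a := 2 * (n₀ * A + m) + 1 with ha
  set b := 2 * n₀ with hb
  set x : ℝ := (q : ℝ) ^ (-(1 / 4) : ℝ) with hx
  have hx0 : 0 < x := Real.rpow_pos_of_pos hq0 _
  have hx1 : x < 1 := Real.rpow_lt_one_of_one_lt_of_neg hq1 (by norm_num)
  refine ⟨Real.exp (Fintype.card Fˣ * (x / (1 - x) ^ 2)), 2 * a ^ 2 + 1 / 2, ?_⟩
  filter_upwards [eventually_sq_log_le a b, eventually_ge_atTop (4 * a ^ 2)] with n hn hna h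
  obtain ⟨l, hl⟩ : ∃ l, l = a + b * Nat.log 2 n := ⟨_, rfl⟩
  rw [← hl] at hn
  have hl' : l = 2 * (n₀ * (A + Nat.log 2 n) + m) + 1 := by rw [hl, ha, hb]; ring
  have hln : l ≤ n := by
    have h1 : (4 * a ^ 2 : ℝ) ≤ n := by exact_mod_cast hna
    have h2 : (l : ℝ) ≤ l ^ 2 := by exact_mod_cast Nat.le_self_pow two_ne_zero l
    have h3 : (l : ℝ) ≤ n := by linarith [Nat.cast_nonneg (α := ℝ) n]
    exact_mod_cast h3
  have hbad := card_not_isIntegral_le hq h g hln hl'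
  have hT := card_weight_le (ι := Fˣ) n hx0 hx1
  set T := (Finset.univ.filter fun c : Fin n × Fˣ → Fin (n + 1) =>
        ∑ b, (b.1.val + 1) * (c b).val ≤ n).card
  set K := Real.exp (Fintype.card Fˣ * (x / (1 - x) ^ 2))
  have hx' : x ^ n = (q : ℝ) ^ (-(n / 4) : ℝ) := by
    rw [hx, ← Real.rpow_natCast, ← Real.rpow_mul hq0.le]
    congr 1
    ring
  have hT' : (T : ℝ) ≤ K * (q : ℝ) ^ (n / 4 : ℝ) := by
    rw [hx', Real.rpow_neg hq0.le, ← div_eq_mul_inv, div_le_iff₀ (Real.rpow_pos_of_pos hq0 _)] at hT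
    exact hT
  have hhalf : (q : ℝ) ^ ((n : ℝ) / 2 - 1 / 2) ≤
      Nat.card {χ : GL (Fin n) F → ℂ // IsIrrChar χ ∧ ∀ x, χ x⁻¹ = χ x} := by
    calc (q : ℝ) ^ ((n : ℝ) / 2 - 1 / 2) ≤ (q : ℝ) ^ ((n / 2 : ℕ) : ℝ) := by
          refine Real.rpow_le_rpow_of_exponent_le hq1.le ?_
          have : (n : ℝ) ≤ 2 * (n / 2 : ℕ) + 1 := by
            have : n ≤ 2 * (n / 2) + 1 := by omega
            exact_mod_cast this
          linarith
      _ = ((q ^ (n / 2) : ℕ) : ℝ) := by rw [Real.rpow_natCast, Nat.cast_pow]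
      _ ≤ _ := Nat.cast_le.mpr (pow_half_le_card_selfDual n)
  calc _ ≤ (q : ℝ) ^ ((l : ℝ) ^ 2) * (K * (q : ℝ) ^ (n / 4 : ℝ)) / (q : ℝ) ^ ((n : ℝ) / 2 - 1 / 2) := by
        refine div_le_div₀ (by positivity) ?_ (Real.rpow_pos_of_pos hq0 _) hhalf
        refine (Nat.cast_le.mpr hbad).trans ?_
        rw [Nat.cast_mul, Nat.cast_pow]
        refine mul_le_mul (le_of_eq ?_) hT' (Nat.cast_nonneg _) (by positivity)
        rw [← Real.rpow_natCast]
        push_cast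
        rw [pow_two]
    _ = K * (q : ℝ) ^ ((l : ℝ) ^ 2 + n / 4 - ((n : ℝ) / 2 - 1 / 2)) := by
        rw [Real.rpow_sub hq0 ((l : ℝ) ^ 2 + n / 4), Real.rpow_add hq0]
        ring
    _ ≤ _ := by
        refine mul_le_mul_of_nonneg_left ?_ (Real.exp_pos _).le
        refine Real.rpow_le_rpow_of_exponent_le hq1.le ?_
        linarith

theorem tendsto_const_mul_rpow_sub {q : ℝ} (hq : 1 < q) (K L : ℝ) :
    Tendsto (fun n : ℕ => K * q ^ (L - n / 8)) atTop (𝓝 0) := by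
  have h1 : Tendsto (fun n : ℕ => L - (n : ℝ) / 8) atTop atBot :=
    tendsto_atBot_add_const_left _ L (tendsto_neg_atTop_atBot.comp
      ((tendsto_natCast_atTop_atTop (R := ℝ)).atTop_div_const (by norm_num)))
  simpa using ((tendsto_rpow_atBot_of_base_gt_one q hq).comp h1).const_mul K

end Limit

/-- For a fixed odd prime power `q`, `n₀ ≥ 1`, `g ∈ GL_{n₀}(𝔽_q)` and `m ≥ 0`, the proportion of
self-dual irreducible complex characters `χ` of `GL_n(𝔽_q)` such that `2^m` divides `χ(g)`
(i.e. `χ(g)/2^m` is an algebraic integer), among all self-dual irreducible characters,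
tends to `1` as `n → ∞`. -/
theorem stmt0 (q : ℕ) (hq : Odd q) (hqpp : IsPrimePow q)
    (F : Type) [Field F] [Fintype F] [DecidableEq F] (hF : Fintype.card F = q)
    (n₀ : ℕ) (hn₀ : 1 ≤ n₀) (g : GL (Fin n₀) F) (m : ℕ) :
    Filter.Tendsto (fun n : ℕ =>
      (Nat.card {χ : GL (Fin n) F → ℂ //
          (∃ V : FDRep ℂ (GL (Fin n) F), Simple V ∧ χ = V.character) ∧
          (∀ x, χ x⁻¹ = χ x) ∧
          ∀ h : n₀ ≤ n, IsIntegral ℤ (χ (glEmbed F h g) / (2 ^ m : ℂ))} : ℝ) /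
      (Nat.card {χ : GL (Fin n) F → ℂ //
          (∃ V : FDRep ℂ (GL (Fin n) F), Simple V ∧ χ = V.character) ∧
          ∀ x, χ x⁻¹ = χ x} : ℝ))
      Filter.atTop (𝓝 1) := by
  subst hF
  obtain ⟨K, L, hKL⟩ := eventually_card_not_isIntegral_le hq g m
  have hlim := tendsto_const_mul_rpow_sub
    (by exact_mod_cast (Fintype.one_lt_card : 1 < Fintype.card F) : (1 : ℝ) < Fintype.card F) K L
  refine tendsto_of_tendsto_of_tendsto_of_le_of_le' (by simpa using hlim.const_sub 1)
    tendsto_const_nhds ?_ ?_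
  · filter_upwards [hKL, eventually_ge_atTop n₀] with n hn h
    have hn := hn h
    have hS : {χ : GL (Fin n) F → ℂ | IsIrrChar χ ∧ ∀ x, χ x⁻¹ = χ x}.Finite :=
      finite_setOf_isIrrChar.subset fun _ h => h.1
    have hpos : (0 : ℝ) < Nat.card {χ : GL (Fin n) F → ℂ // IsIrrChar χ ∧ ∀ x, χ x⁻¹ = χ x} := by
      have h1 := pow_half_le_card_selfDual (F := F) n
      have h2 : 0 < Fintype.card F ^ (n / 2) := pow_pos Fintype.card_pos _
      exact_mod_cast h2.trans_le h1
    have hle : {χ : GL (Fin n) F → ℂ | IsIrrChar χ ∧ ∀ x, χ x⁻¹ = χ x}.ncard ≤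
        {χ : GL (Fin n) F → ℂ | IsIrrChar χ ∧ (∀ x, χ x⁻¹ = χ x) ∧
          ∀ h : n₀ ≤ n, IsIntegral ℤ (χ (glEmbed F h g) / (2 ^ m : ℂ))}.ncard +
        {χ : GL (Fin n) F → ℂ | IsIrrChar χ ∧
          ¬ IsIntegral ℤ (χ (glEmbed F h g) / (2 ^ m : ℂ))}.ncard := by
      refine (Set.ncard_le_ncard (fun χ hχ => ?_) ?_).trans (Set.ncard_union_le _ _)
      · by_cases hi : IsIntegral ℤ (χ (glEmbed F h g) / (2 ^ m : ℂ))
        · exact Or.inl ⟨hχ.1, hχ.2, fun _ => hi⟩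
        · exact Or.inr ⟨hχ.1, hi⟩
      · exact (finite_setOf_isIrrChar.subset fun _ h => h.1).union
          (finite_setOf_isIrrChar.subset fun _ h => h.1)
    refine (sub_le_sub_left hn 1).trans ?_
    change _ ≤ (Nat.card {χ : GL (Fin n) F → ℂ // IsIrrChar χ ∧ (∀ x, χ x⁻¹ = χ x) ∧
          ∀ h : n₀ ≤ n, IsIntegral ℤ (χ (glEmbed F h g) / (2 ^ m : ℂ))} : ℝ) /
      Nat.card {χ : GL (Fin n) F → ℂ // IsIrrChar χ ∧ ∀ x, χ x⁻¹ = χ x}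
    rw [le_div_iff₀ hpos, sub_mul, div_mul_cancel₀ _ hpos.ne', one_mul, sub_le_iff_le_add]
    exact_mod_cast hle
  · refine Eventually.of_forall fun n => div_le_one_of_le₀ (Nat.cast_le.mpr ?_) (Nat.cast_nonneg _)
    refine Set.ncard_le_ncard (s := {χ : GL (Fin n) F → ℂ | IsIrrChar χ ∧ (∀ x, χ x⁻¹ = χ x) ∧
          ∀ h : n₀ ≤ n, IsIntegral ℤ (χ (glEmbed F h g) / (2 ^ m : ℂ))})
      (t := {χ : GL (Fin n) F → ℂ | IsIrrChar χ ∧ ∀ x, χ x⁻¹ = χ x})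
      (fun χ hχ => ⟨hχ.1, hχ.2.1⟩) (finite_setOf_isIrrChar.subset fun _ h => h.1)
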